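/- arXiv:1610.05199 — 2 statements merged into one kernel-verified Lean document; each statement's English description precedes it below -/
import Mathlib

section
/- (Entropy bound from Gaussian interpolation.) Let T be a finite set, (X_x)_{x∈T} a centered Gaussian process with natural metric d and Gaussian width functional G, K(t,x) := inf_{s≥0} { t·s + G(T) − G(B(x,s)) } with B(x,s) := { y ∈ T : d(x,y) ≤ s }, and let s(t,x) denote a minimizer. Then there is a universal constant C such that for every n ≥ 0, every A ⊆ T and every a > 0: e_n(A) ≤ C · ( a·diam(A) + (a+1)·sup_{x∈A} s(a·2^{n/2}, x) ), where the entropy number e_n(A) and diam(A) are with respect to the metric d. -/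
open scoped ENNReal NNReal ProbabilityTheory
open MeasureTheory ProbabilityTheory Set

noncomputable section

universe u v

/-- The natural metric of the process: `d(x,y) = (E|X_x − X_y|²)^{1/2}`. -/
def natDist {Ω : Type u} {ι : Type v} [MeasureSpace Ω] (X : ι → Ω → ℝ) (x y : ι) : ℝ :=
  Real.sqrt (∫ ω, (X x ω - X y ω) ^ 2)

/-- The Gaussian width `G(A) = E[sup_{x∈A} X_x]`. -/
def gWidth {Ω : Type u} {ι : Type v} [MeasureSpace Ω] (X : ι → Ω → ℝ) (A : Set ι) : ℝ :=
  ∫ ω, sSup ((fun x => X x ω) '' A)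

/-- `X` is a centered Gaussian process: every finite linear combination of the
`X_x` is a centered Gaussian random variable. -/
def IsCenteredGaussianProcess {Ω : Type u} {ι : Type v} [MeasureSpace Ω] [Fintype ι]
    (X : ι → Ω → ℝ) : Prop :=
  (∀ x, Measurable (X x)) ∧
    ∀ c : ι → ℝ, ∃ v : ℝ≥0,
      Measure.map (fun ω => ∑ x, c x * X x ω) ℙ = gaussianReal 0 v

/-- Diameter with respect to the extended distance `D`. -/
def eDiam {ι : Type v} (D : ι → ι → ℝ≥0∞) (A : Set ι) : ℝ≥0∞ :=
  ⨆ x ∈ A, ⨆ y ∈ A, D x y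

/-- Entropy numbers with respect to the extended distance `D`. -/
def entN {ι : Type v} (D : ι → ι → ℝ≥0∞) (n : ℕ) (A : Set ι) : ℝ≥0∞ :=
  ⨅ (S : Finset ι) (_ : S.card < 2 ^ 2 ^ n), ⨆ x ∈ A, ⨅ y ∈ S, D x y

section GaussLemmas

variable {ι : Type v} [Fintype ι] (μ : Measure (ι → ℝ)) [IsGaussian μ]

lemma ge_int_norm : Integrable (fun x : ι → ℝ => ‖x‖) μ :=
  (IsGaussian.integrable_id (μ := μ)).norm

lemma ge_int_norm_sq : Integrable (fun x : ι → ℝ => ‖x‖ ^ 2) μ :=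
  (IsGaussian.memLp_two_id (μ := μ)).integrable_norm_pow (by norm_num)

lemma ge_rot (h0 : ∀ L : StrongDual ℝ (ι → ℝ), μ[L] = 0) (θ : ℝ)
    (F : (ι → ℝ) × (ι → ℝ) → ℝ) (hF : Continuous F) :
    ∫ z, F (Real.cos θ • z.1 + Real.sin θ • z.2, -Real.sin θ • z.1 + Real.cos θ • z.2)
      ∂(μ.prod μ) = ∫ z, F z ∂(μ.prod μ) := by
  have h := IsGaussian.map_rotation_eq_self_of_forall_strongDual_eq_zero (μ := μ) h0 θ
  conv_rhs => rw [← h]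
  rw [integral_map (by fun_prop) (hF.aestronglyMeasurable)]
  simp [ContinuousLinearMap.rotation_apply]

lemma ge_ibp (h0 : ∀ L : StrongDual ℝ (ι → ℝ), μ[L] = 0)
    (Φ : (ι → ℝ) → ℝ) (DΦ : (ι → ℝ) → (ι → ℝ) →L[ℝ] ℝ) (hΦ : ∀ x, HasFDerivAt Φ (DΦ x) x)
    (B : ℝ) (hB : ∀ x, |Φ x| ≤ B) (hDB : ∀ x, ‖DΦ x‖ ≤ B) (hc : Continuous DΦ) (a : ι) :
    Integrable (fun z : (ι → ℝ) × (ι → ℝ) => DΦ z.1 z.2 * z.2 a) (μ.prod μ) ∧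
    ∫ x, Φ x * x a ∂μ = ∫ z, DΦ z.1 z.2 * z.2 a ∂(μ.prod μ) := by
  have hΦc : Continuous Φ := continuous_iff_continuousAt.2 fun x => (hΦ x).continuousAt
  have hB0 : 0 ≤ B := (abs_nonneg _).trans (hB 0)
  let F : ℝ → (ι → ℝ) × (ι → ℝ) → ℝ := fun t z =>
    Φ (Real.cos t • z.1 + Real.sin t • z.2) * ((-Real.sin t • z.1 + Real.cos t • z.2) a)
  let F' : ℝ → (ι → ℝ) × (ι → ℝ) → ℝ := fun t z =>
    DΦ (Real.cos t • z.1 + Real.sin t • z.2) (-Real.sin t • z.1 + Real.cos t • z.2)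
        * ((-Real.sin t • z.1 + Real.cos t • z.2) a)
      + Φ (Real.cos t • z.1 + Real.sin t • z.2) * ((-Real.cos t • z.1 - Real.sin t • z.2) a)
  have hn1 : Integrable (fun z : (ι → ℝ) × (ι → ℝ) => ‖z.1‖) (μ.prod μ) :=
    (ge_int_norm μ).comp_fst μ
  have hn2 : Integrable (fun z : (ι → ℝ) × (ι → ℝ) => ‖z.2‖) (μ.prod μ) :=
    (ge_int_norm μ).comp_snd μ
  have hs1 : Integrable (fun z : (ι → ℝ) × (ι → ℝ) => ‖z.1‖ ^ 2) (μ.prod μ) :=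
    (ge_int_norm_sq μ).comp_fst μ
  have hs2 : Integrable (fun z : (ι → ℝ) × (ι → ℝ) => ‖z.2‖ ^ 2) (μ.prod μ) :=
    (ge_int_norm_sq μ).comp_snd μ
  have hcomb : ∀ (c d : ℝ), |c| ≤ 1 → |d| ≤ 1 → ∀ z : (ι → ℝ) × (ι → ℝ),
      ‖c • z.1 + d • z.2‖ ≤ ‖z.1‖ + ‖z.2‖ := by
    intro c d h1 h2 z
    refine (norm_add_le _ _).trans ?_
    rw [norm_smul, norm_smul, Real.norm_eq_abs, Real.norm_eq_abs]
    nlinarith [norm_nonneg z.1, norm_nonneg z.2]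
  have hF0 : Integrable (F 0) (μ.prod μ) := by
    refine (hn2.const_mul B).mono' (by fun_prop) (Filter.Eventually.of_forall fun z => ?_)
    simp only [F, Real.norm_eq_abs, abs_mul]
    refine mul_le_mul (hB _) ?_ (abs_nonneg _) hB0
    simpa using norm_le_pi_norm z.2 a
  have key := hasDerivAt_integral_of_dominated_loc_of_deriv_le (μ := μ.prod μ) (F := F) (F' := F')
    (x₀ := 0) (s := univ) (bound := fun z => 2 * B * (‖z.1‖ ^ 2 + ‖z.2‖ ^ 2) + B * (‖z.1‖ + ‖z.2‖))
    Filter.univ_mem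
    (Filter.Eventually.of_forall fun t => by fun_prop) hF0 (by fun_prop)
    (Filter.Eventually.of_forall fun z t _ => ?_)
    (((hs1.add hs2).const_mul _).add ((hn1.add hn2).const_mul _))
    (Filter.Eventually.of_forall fun z t _ => ?_)
  rotate_left
  · have e1 : ‖-Real.sin t • z.1 + Real.cos t • z.2‖ ≤ ‖z.1‖ + ‖z.2‖ :=
      hcomb _ _ (by rw [abs_neg]; exact Real.abs_sin_le_one t) (Real.abs_cos_le_one t) z
    have e2 : ‖-Real.cos t • z.1 - Real.sin t • z.2‖ ≤ ‖z.1‖ + ‖z.2‖ := by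
      have := hcomb (-Real.cos t) (-Real.sin t) (by rw [abs_neg]; exact Real.abs_cos_le_one t)
        (by rw [abs_neg]; exact Real.abs_sin_le_one t) z
      rwa [neg_smul (Real.sin t), ← sub_eq_add_neg] at this
    have e3 := (norm_le_pi_norm (-Real.sin t • z.1 + Real.cos t • z.2) a).trans e1
    have e4 := (norm_le_pi_norm (-Real.cos t • z.1 - Real.sin t • z.2) a).trans e2
    have e5 : ‖DΦ (Real.cos t • z.1 + Real.sin t • z.2) (-Real.sin t • z.1 + Real.cos t • z.2)‖
        ≤ B * (‖z.1‖ + ‖z.2‖) :=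
      (ContinuousLinearMap.le_opNorm _ _).trans (mul_le_mul (hDB _) e1 (norm_nonneg _) hB0)
    have h1 : ‖F' t z‖ ≤ B * (‖z.1‖ + ‖z.2‖) * (‖z.1‖ + ‖z.2‖) + B * (‖z.1‖ + ‖z.2‖) := by
      refine (norm_add_le _ _).trans (add_le_add ?_ ?_)
      · rw [norm_mul]
        exact mul_le_mul e5 e3 (norm_nonneg _) (by positivity)
      · rw [norm_mul]
        exact mul_le_mul (hB _) e4 (norm_nonneg _) hB0
    refine h1.trans ?_
    have : 0 ≤ B * (‖z.1‖ - ‖z.2‖) ^ 2 := by positivity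
    nlinarith
  · have d1 : HasDerivAt (fun t => Real.cos t • z.1 + Real.sin t • z.2)
        (-Real.sin t • z.1 + Real.cos t • z.2) t :=
      ((Real.hasDerivAt_cos t).smul_const z.1).add ((Real.hasDerivAt_sin t).smul_const z.2)
    have d2 : HasDerivAt (fun t => -Real.sin t • z.1 + Real.cos t • z.2)
        (-Real.cos t • z.1 - Real.sin t • z.2) t := by
      have := ((Real.hasDerivAt_sin t).neg.smul_const z.1).add
        ((Real.hasDerivAt_cos t).smul_const z.2)
      rw [neg_smul (Real.sin t), ← sub_eq_add_neg] at this
      exact this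
    have d3 := (hΦ (Real.cos t • z.1 + Real.sin t • z.2)).comp_hasDerivAt t d1
    have d4 := (hasDerivAt_pi.1 d2) a
    exact d3.mul d4
  obtain ⟨hI, hD⟩ := key
  have hconst : ∀ t, ∫ z, F t z ∂(μ.prod μ) = ∫ z, F 0 z ∂(μ.prod μ) := by
    intro t
    have := ge_rot μ h0 t (fun z => Φ z.1 * z.2 a) (by fun_prop)
    simp only [F]
    rw [this]
    simp
  have hz : ∫ z, F' 0 z ∂(μ.prod μ) = 0 := by
    have h1 : (fun t => ∫ z, F t z ∂(μ.prod μ)) = fun _ => ∫ z, F 0 z ∂(μ.prod μ) :=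
      funext hconst
    rw [h1] at hD
    exact hD.unique (hasDerivAt_const _ _)
  have hI2 : Integrable (fun z : (ι → ℝ) × (ι → ℝ) => Φ z.1 * z.1 a) (μ.prod μ) := by
    refine (hn1.const_mul B).mono' (by fun_prop) (Filter.Eventually.of_forall fun z => ?_)
    rw [norm_mul]
    exact mul_le_mul (hB _) (norm_le_pi_norm z.1 a) (norm_nonneg _) hB0
  have hF'0 : F' 0 = fun z => DΦ z.1 z.2 * z.2 a - Φ z.1 * z.1 a := by
    funext z
    simp [F', sub_eq_add_neg]
  have hI3 : Integrable (fun z : (ι → ℝ) × (ι → ℝ) => DΦ z.1 z.2 * z.2 a) (μ.prod μ) := by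
    have := hI.add hI2
    rw [hF'0] at this
    refine this.congr (Filter.Eventually.of_forall fun z => ?_)
    simp
  refine ⟨hI3, ?_⟩
  rw [hF'0, integral_sub hI3 hI2] at hz
  have : ∫ z : (ι → ℝ) × (ι → ℝ), Φ z.1 * z.1 a ∂(μ.prod μ) = ∫ x, Φ x * x a ∂μ := by
    have := integral_fun_fst (μ := μ) (ν := μ) (fun x : ι → ℝ => Φ x * x a)
    simpa using this
  linarith

end GaussLemmas
set_option linter.unusedSectionVars false

section Softmax

variable {ι : Type v} [Fintype ι] {κ : Type v} [Fintype κ] [Nonempty κ]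

def gsm (β : ℝ) (e : κ → ι) (x : ι → ℝ) (i : κ) : ℝ :=
  Real.exp (β * x (e i)) / ∑ j, Real.exp (β * x (e j))

lemma gsm_den_pos (β : ℝ) (e : κ → ι) (x : ι → ℝ) : 0 < ∑ j, Real.exp (β * x (e j)) :=
  Finset.sum_pos (fun _ _ => Real.exp_pos _) Finset.univ_nonempty

lemma gsm_pos (β : ℝ) (e : κ → ι) (x : ι → ℝ) (i : κ) : 0 < gsm β e x i :=
  div_pos (Real.exp_pos _) (gsm_den_pos β e x)

lemma gsm_sum (β : ℝ) (e : κ → ι) (x : ι → ℝ) : ∑ i, gsm β e x i = 1 := by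
  simp only [gsm]
  rw [← Finset.sum_div]
  exact div_self (gsm_den_pos β e x).ne'

lemma gsm_le_one (β : ℝ) (e : κ → ι) (x : ι → ℝ) (i : κ) : gsm β e x i ≤ 1 := by
  rw [← gsm_sum β e x]
  exact Finset.single_le_sum (fun j _ => (gsm_pos β e x j).le) (Finset.mem_univ i)

lemma gsm_cont (β : ℝ) (e : κ → ι) (i : κ) : Continuous (fun x => gsm β e x i) := by
  unfold gsm
  refine Continuous.div (by fun_prop) (by fun_prop) fun x => (gsm_den_pos β e x).ne'

@[fun_prop]
lemma gsm_cont_comp {α : Type*} [TopologicalSpace α] (β : ℝ) (e : κ → ι) (i : κ)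
    (f : α → ι → ℝ) (hf : Continuous f) : Continuous (fun a => gsm β e (f a) i) :=
  (gsm_cont β e i).comp hf

def gsmD (β : ℝ) (e : κ → ι) (x : ι → ℝ) (i : κ) : (ι → ℝ) →L[ℝ] ℝ :=
  (β * gsm β e x i) • (ContinuousLinearMap.proj (e i) -
    ∑ j, gsm β e x j • (ContinuousLinearMap.proj (e j) : (ι → ℝ) →L[ℝ] ℝ))

lemma gsmD_apply (β : ℝ) (e : κ → ι) (x : ι → ℝ) (i : κ) (k : ι → ℝ) :
    gsmD β e x i k = β * gsm β e x i * (k (e i) - ∑ j, gsm β e x j * k (e j)) := by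
  simp [gsmD]

lemma gsmD_cont (β : ℝ) (e : κ → ι) (i : κ) : Continuous (fun x => gsmD β e x i) := by
  unfold gsmD
  fun_prop

lemma gsmD_norm (β : ℝ) (e : κ → ι) (x : ι → ℝ) (i : κ) : ‖gsmD β e x i‖ ≤ 2 * |β| := by
  refine ContinuousLinearMap.opNorm_le_bound _ (by positivity) fun k => ?_
  rw [gsmD_apply, norm_mul, norm_mul, Real.norm_eq_abs β, Real.norm_of_nonneg (gsm_pos β e x i).le]
  have h1 : ‖k (e i) - ∑ j, gsm β e x j * k (e j)‖ ≤ 2 * ‖k‖ := by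
    refine (norm_sub_le _ _).trans ?_
    have : ‖∑ j, gsm β e x j * k (e j)‖ ≤ ‖k‖ := by
      refine (norm_sum_le _ _).trans ?_
      calc ∑ j, ‖gsm β e x j * k (e j)‖ ≤ ∑ j, gsm β e x j * ‖k‖ := by
            refine Finset.sum_le_sum fun j _ => ?_
            rw [norm_mul, Real.norm_of_nonneg (gsm_pos β e x j).le]
            exact mul_le_mul_of_nonneg_left (norm_le_pi_norm k _) (gsm_pos β e x j).le
        _ = ‖k‖ := by rw [← Finset.sum_mul, gsm_sum, one_mul]
    linarith [norm_le_pi_norm k (e i)]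
  calc |β| * gsm β e x i * ‖k (e i) - ∑ j, gsm β e x j * k (e j)‖
      ≤ |β| * 1 * (2 * ‖k‖) := by
        gcongr
        exact gsm_le_one β e x i
    _ = 2 * |β| * ‖k‖ := by ring

lemma gsm_hasFDerivAt (β : ℝ) (e : κ → ι) (x : ι → ℝ) (i : κ) :
    HasFDerivAt (fun x => gsm β e x i) (gsmD β e x i) x := by
  have hp : ∀ j : κ, HasFDerivAt (fun x : ι → ℝ => Real.exp (β * x (e j)))
      (Real.exp (β * x (e j)) • β • (ContinuousLinearMap.proj (e j) : (ι → ℝ) →L[ℝ] ℝ)) x := by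
    intro j
    have := (ContinuousLinearMap.proj (R := ℝ) (φ := fun _ : ι => ℝ) (e j)).hasFDerivAt (x := x)
    exact (this.const_mul β).exp
  have hs := HasFDerivAt.fun_sum (u := Finset.univ) (fun j _ => hp j)
  have hd := (hp i).mul ((hasDerivAt_inv (gsm_den_pos β e x).ne').comp_hasFDerivAt x hs)
  have hne := (gsm_den_pos β e x).ne'
  refine (hd.congr_fderiv ?_)
  ext k
  rw [gsmD_apply]
  simp only [gsm, div_eq_mul_inv]
  simp
  have h2 : ∑ j, Real.exp (β * x (e j)) * (∑ j, Real.exp (β * x (e j)))⁻¹ * k (e j)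
      = (∑ j, Real.exp (β * x (e j)) * k (e j)) * (∑ j, Real.exp (β * x (e j)))⁻¹ := by
    rw [Finset.sum_mul]; exact Finset.sum_congr rfl fun j _ => by ring
  have h3 : ∑ j, Real.exp (β * x (e j)) * (β * k (e j))
      = β * ∑ j, Real.exp (β * x (e j)) * k (e j) := by
    rw [Finset.mul_sum]; exact Finset.sum_congr rfl fun j _ => by ring
  rw [h2, h3]
  field_simp
  ring

lemma ge_entropy_term (m p : ℝ) (hm : 2 ≤ m) (hp : 0 < p) (hp1 : p ≤ 1) :
    -(p * Real.log p) ≤ Real.log m * (16 * (p * (1 - p))) + Real.log m / (2 * m) := by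
  have hl2 : (0.69 : ℝ) < Real.log 2 := by linarith [Real.log_two_gt_d9]
  have hlm : Real.log 2 ≤ Real.log m := Real.log_le_log (by norm_num) hm
  have hr : 0 ≤ Real.log m / (2 * m) := div_nonneg (by linarith) (by linarith)
  have hl : 0 ≤ Real.log m * (16 * (p * (1 - p))) :=
    mul_nonneg (by linarith) (mul_nonneg (by norm_num) (mul_nonneg hp.le (by linarith)))
  by_cases h1 : m⁻¹ ^ 8 ≤ p
  · have hlog : -Real.log p ≤ 8 * Real.log m := by
      have := Real.log_le_log (by positivity) h1
      rw [Real.log_pow, Real.log_inv] at this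
      push_cast at this
      linarith
    by_cases h2 : p ≤ 1 / 2
    · have : p * (-Real.log p) ≤ p * (8 * Real.log m) := mul_le_mul_of_nonneg_left hlog hp.le
      have h3 : p * (8 * Real.log m) ≤ Real.log m * (16 * (p * (1 - p))) := by
        have : 0 ≤ p * Real.log m := mul_nonneg hp.le (by linarith)
        nlinarith
      linarith
    · push Not at h2
      have h3 : -Real.log p ≤ p⁻¹ - 1 := by
        have := Real.log_le_sub_one_of_pos (inv_pos.2 hp)
        rwa [Real.log_inv] at this
      have h4 : p * (-Real.log p) ≤ 1 - p := by
        have := mul_le_mul_of_nonneg_left h3 hp.le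
        rw [mul_sub, mul_inv_cancel₀ hp.ne'] at this
        linarith
      have h5 : 1 - p ≤ Real.log m * (16 * (p * (1 - p))) := by
        have : 1 ≤ Real.log m * (16 * p) := by nlinarith
        nlinarith
      linarith
  · push Not at h1
    have hs : 0 < Real.sqrt p := Real.sqrt_pos.2 hp
    have h3 : -Real.log (Real.sqrt p) ≤ (Real.sqrt p)⁻¹ - 1 := by
      have := Real.log_le_sub_one_of_pos (inv_pos.2 hs)
      rwa [Real.log_inv] at this
    rw [Real.log_sqrt hp.le] at h3
    have h4 : -(p * Real.log p) ≤ 2 * Real.sqrt p := by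
      have h5 := mul_le_mul_of_nonneg_left h3 hp.le
      have h6 : p * (Real.sqrt p)⁻¹ = Real.sqrt p := by
        rw [← div_eq_mul_inv, Real.div_sqrt]
      rw [mul_sub, h6] at h5
      linarith
    have h5 : Real.sqrt p ≤ m⁻¹ ^ 4 := by
      rw [Real.sqrt_le_left (by positivity)]
      calc p ≤ m⁻¹ ^ 8 := h1.le
        _ = (m⁻¹ ^ 4) ^ 2 := by ring
    have h6 : 2 * m⁻¹ ^ 4 ≤ Real.log m / (2 * m) := by
      rw [le_div_iff₀ (by linarith)]
      have : 2 * m⁻¹ ^ 4 * (2 * m) = 4 * m⁻¹ ^ 3 := by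
        have : m ≠ 0 := by linarith
        field_simp; norm_num
      rw [this]
      have h7 : m⁻¹ ≤ 2⁻¹ := inv_anti₀ (by norm_num) hm
      have h8 : m⁻¹ ^ 3 ≤ (2⁻¹ : ℝ) ^ 3 := pow_le_pow_left₀ (by positivity) h7 3
      have h9 : (2⁻¹ : ℝ) ^ 3 = 1 / 8 := by norm_num
      rw [h9] at h8
      linarith
    linarith

lemma ge_entropy (hm : (2 : ℝ) ≤ Fintype.card κ) (p : κ → ℝ) (hp : ∀ i, 0 < p i)
    (hs : ∑ i, p i = 1) :
    -∑ i, p i * Real.log (p i) ≤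
      Real.log (Fintype.card κ) * (16 * (1 - ∑ i, p i ^ 2) + 1 / 2) := by
  have h1 : ∀ i, p i ≤ 1 := fun i => by
    rw [← hs]; exact Finset.single_le_sum (fun j _ => (hp j).le) (Finset.mem_univ i)
  have := Finset.sum_le_sum fun i (_ : i ∈ Finset.univ) =>
    ge_entropy_term (Fintype.card κ) (p i) hm (hp i) (h1 i)
  rw [Finset.sum_add_distrib, Finset.sum_neg_distrib, ← Finset.mul_sum, ← Finset.mul_sum] at this
  refine this.trans (le_of_eq ?_)
  have h2 : ∑ i, p i * (1 - p i) = 1 - ∑ i, p i ^ 2 := by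
    simp only [mul_sub, mul_one, Finset.sum_sub_distrib, hs, pow_two]
  rw [h2]
  simp only [Finset.sum_const, Finset.card_univ, nsmul_eq_mul]
  have : (Fintype.card κ : ℝ) ≠ 0 := by linarith
  field_simp

lemma ge_pointwise (hm : (2 : ℝ) ≤ Fintype.card κ) (β : ℝ) (e : κ → ι) (x : ι → ℝ) :
    Real.log (Fintype.card κ) + β / (Fintype.card κ) * ∑ i, x (e i) ≤
      Real.log (Fintype.card κ) * (16 * (1 - ∑ i, gsm β e x i ^ 2) + 1 / 2) +
        β * ∑ i, gsm β e x i * x (e i) := by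
  have hm0 : (0 : ℝ) < Fintype.card κ := by linarith
  have hZ := gsm_den_pos β e x
  have h1 := ge_entropy hm (gsm β e x) (gsm_pos β e x) (gsm_sum β e x)
  have h2 : ∑ i, gsm β e x i * Real.log (gsm β e x i) =
      β * ∑ i, gsm β e x i * x (e i) - Real.log (∑ j, Real.exp (β * x (e j))) := by
    have : ∀ i, Real.log (gsm β e x i) = β * x (e i) - Real.log (∑ j, Real.exp (β * x (e j))) := by
      intro i
      rw [gsm, Real.log_div (Real.exp_pos _).ne' hZ.ne', Real.log_exp]
    simp only [this, mul_sub, Finset.sum_sub_distrib, ← Finset.sum_mul, gsm_sum, one_mul]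
    rw [Finset.mul_sum]
    congr 1
    exact Finset.sum_congr rfl fun i _ => by ring
  have h3 : Real.log (Fintype.card κ) + β / (Fintype.card κ) * ∑ i, x (e i) ≤
      Real.log (∑ j, Real.exp (β * x (e j))) := by
    rw [Real.le_log_iff_exp_le hZ, Real.exp_add, Real.exp_log hm0]
    have := convexOn_exp.map_sum_le (t := Finset.univ) (w := fun _ : κ => (Fintype.card κ : ℝ)⁻¹)
      (p := fun i => β * x (e i)) (fun _ _ => by positivity)
      (by simp [hm0.ne']) (fun _ _ => mem_univ _)
    simp only [smul_eq_mul, ← Finset.mul_sum] at this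
    have h4 : β / (Fintype.card κ) * ∑ i, x (e i) =
      (Fintype.card κ : ℝ)⁻¹ * (β * ∑ i, x (e i)) := by ring
    rw [h4]
    calc _ ≤ (Fintype.card κ : ℝ) * ((Fintype.card κ : ℝ)⁻¹ * ∑ i, Real.exp (β * x (e i))) :=
          mul_le_mul_of_nonneg_left this hm0.le
      _ = _ := by rw [← mul_assoc, mul_inv_cancel₀ hm0.ne', one_mul]
  linarith

end Softmax
section Cov

variable {ι : Type v} [Fintype ι] {κ : Type v} [Fintype κ] [Nonempty κ]
  (μ : Measure (ι → ℝ)) [IsGaussian μ]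

def gcov (a b : ι) : ℝ := ∫ x, x a * x b ∂μ

lemma ge_int_mul (a b : ι) : Integrable (fun x : ι → ℝ => x a * x b) μ := by
  refine (ge_int_norm_sq μ).mono' (by fun_prop) (Filter.Eventually.of_forall fun x => ?_)
  rw [norm_mul, pow_two]
  exact mul_le_mul (norm_le_pi_norm x a) (norm_le_pi_norm x b) (norm_nonneg _) (norm_nonneg _)

lemma ge_int_coord (a : ι) : Integrable (fun x : ι → ℝ => x a) μ :=
  (ge_int_norm μ).mono' (continuous_apply a).aestronglyMeasurable
    (Filter.Eventually.of_forall fun x => norm_le_pi_norm x a)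

lemma ge_gsm_ibp (h0 : ∀ L : StrongDual ℝ (ι → ℝ), μ[L] = 0) (β : ℝ) (e : κ → ι)
    (c : ι → ℝ) (s : ℝ) (i : κ) (a : ι) :
    ∫ h, gsm β e (c + s • h) i * h a ∂μ =
      ∫ h, s * β * (gsm β e (c + s • h) i *
        (gcov μ (e i) a - ∑ j, gsm β e (c + s • h) j * gcov μ (e j) a)) ∂μ := by
  have hd : ∀ h, HasFDerivAt (fun h : ι → ℝ => gsm β e (c + s • h) i)
      (s • gsmD β e (c + s • h) i) h := by
    intro h
    have h1 : HasFDerivAt (fun h : ι → ℝ => c + s • h)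
        (s • ContinuousLinearMap.id ℝ (ι → ℝ)) h :=
      ((hasFDerivAt_id h).const_smul s).const_add c
    refine ((gsm_hasFDerivAt β e (c + s • h) i).comp h h1).congr_fderiv ?_
    ext k
    simp
  obtain ⟨hI, hE⟩ := ge_ibp μ h0 (fun h => gsm β e (c + s • h) i)
    (fun h => s • gsmD β e (c + s • h) i) hd (max 1 (|s| * (2 * |β|)))
    (fun x => by
      rw [abs_of_pos (gsm_pos _ _ _ _)]
      exact (gsm_le_one _ _ _ _).trans (le_max_left _ _))
    (fun x => by
      rw [norm_smul]
      exact (mul_le_mul_of_nonneg_left (gsmD_norm _ _ _ _) (norm_nonneg _)).trans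
        (le_max_right _ _))
    (by
      have := gsmD_cont β e i
      exact (this.comp (by fun_prop : Continuous fun h : ι → ℝ => c + s • h)).const_smul s) a
  rw [hE, integral_prod _ hI]
  refine integral_congr_ae (Filter.Eventually.of_forall fun h => ?_)
  simp only [smul_apply, gsmD_apply, smul_eq_mul]
  set p := gsm β e (c + s • h) with hp
  have h1 : ∀ k : ι → ℝ, s * (β * p i * (k (e i) - ∑ j, p j * k (e j))) * k a =
      s * β * p i * (k (e i) * k a - ∑ j, p j * (k (e j) * k a)) := by
    intro k
    have : ∑ j, p j * (k (e j) * k a) = (∑ j, p j * k (e j)) * k a := by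
      rw [Finset.sum_mul]; exact Finset.sum_congr rfl fun j _ => by ring
    rw [this]; ring
  simp only [h1]
  rw [integral_const_mul, integral_sub (ge_int_mul μ _ _)
    (integrable_finsetSum _ fun j _ => (ge_int_mul μ _ _).const_mul _), integral_finsetSum _
      fun j _ => (ge_int_mul μ _ _).const_mul _]
  simp only [integral_const_mul, gcov]
  ring

/-- variance functional -/
def gvar (β : ℝ) (e : κ → ι) (x : ι → ℝ) : ℝ :=
  ∑ i, gsm β e x i * (gcov μ (e i) (e i) - ∑ j, gsm β e x j * gcov μ (e j) (e i))

@[fun_prop]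
lemma gvar_cont {α : Type*} [TopologicalSpace α] (β : ℝ) (e : κ → ι) (f : α → ι → ℝ)
    (hf : Continuous f) : Continuous (fun a => gvar μ β e (f a)) := by
  unfold gvar
  fun_prop

lemma ge_exists_hilbert : ∃ u : ι → Lp ℝ 2 μ, ∀ a b, gcov μ a b = inner ℝ (u a) (u b) := by
  have hm : ∀ a : ι, MemLp (fun x : ι → ℝ => x a) 2 μ := fun a =>
    IsGaussian.memLp_dual μ (ContinuousLinearMap.proj a) 2 (by simp)
  refine ⟨fun a => (hm a).toLp, fun a b => ?_⟩
  rw [L2.inner_def, gcov]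
  refine integral_congr_ae ?_
  filter_upwards [(hm a).coeFn_toLp, (hm b).coeFn_toLp] with x h1 h2
  rw [h1, h2]
  simp [mul_comm]

def gdist (a b : ι) : ℝ := Real.sqrt (∫ x, (x a - x b) ^ 2 ∂μ)

lemma gdist_eq {u : ι → Lp ℝ 2 μ} (hu : ∀ a b, gcov μ a b = inner ℝ (u a) (u b)) (a b : ι) :
    gdist μ a b = ‖u a - u b‖ := by
  have h : ∫ x, (x a - x b) ^ 2 ∂μ = ‖u a - u b‖ ^ 2 := by
    rw [@norm_sub_sq_real, ← real_inner_self_eq_norm_sq, ← real_inner_self_eq_norm_sq,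
      ← hu, ← hu, ← hu]
    have : ∀ x : ι → ℝ, (x a - x b) ^ 2 = x a * x a - 2 * (x a * x b) + x b * x b := fun x => by
      ring
    simp only [this]
    have hi : Integrable (fun x : ι → ℝ => x a * x a - 2 * (x a * x b)) μ :=
      (ge_int_mul μ _ _).sub ((ge_int_mul μ _ _).const_mul _)
    rw [integral_add hi (ge_int_mul μ _ _), integral_sub (ge_int_mul μ _ _) ((ge_int_mul μ _ _).const_mul _),
      integral_const_mul]
    rfl
  rw [gdist, h, Real.sqrt_sq (norm_nonneg _)]

lemma gdist_triangle (a b c : ι) : gdist μ a c ≤ gdist μ a b + gdist μ b c := by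
  obtain ⟨u, hu⟩ := ge_exists_hilbert μ
  rw [gdist_eq μ hu, gdist_eq μ hu, gdist_eq μ hu]
  exact norm_sub_le_norm_sub_add_norm_sub _ _ _

lemma gdist_comm (a b : ι) : gdist μ a b = gdist μ b a := by
  obtain ⟨u, hu⟩ := ge_exists_hilbert μ
  rw [gdist_eq μ hu, gdist_eq μ hu, norm_sub_rev]

/-- variance lower bound from separation -/
lemma gvar_ge (β : ℝ) (e : κ → ι) (r : ℝ) (hr : 0 ≤ r)
    (hsep : ∀ i j, i ≠ j → r ≤ gdist μ (e i) (e j)) (x : ι → ℝ) :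
    r ^ 2 / 2 * (1 - ∑ i, gsm β e x i ^ 2) ≤ gvar μ β e x := by
  classical
  obtain ⟨u, hu⟩ := ge_exists_hilbert μ
  set p := gsm β e x with hp
  have hs : ∑ i, p i = 1 := gsm_sum β e x
  have hpp : ∀ i, 0 < p i := gsm_pos β e x
  have h1 : gvar μ β e x = ∑ i, ∑ j, p i * p j * (‖u (e i) - u (e j)‖ ^ 2 / 2) := by
    have e1 : ∑ i, ∑ j, p i * p j * (‖u (e i) - u (e j)‖ ^ 2 / 2) =
        ∑ i, ∑ j, (p i * p j * (gcov μ (e i) (e i) / 2) + p i * p j * (gcov μ (e j) (e j) / 2)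
          - p i * (p j * gcov μ (e j) (e i))) := by
      refine Finset.sum_congr rfl fun i _ => Finset.sum_congr rfl fun j _ => ?_
      rw [@norm_sub_sq_real, hu, hu, hu, real_inner_self_eq_norm_sq, real_inner_self_eq_norm_sq,
        real_inner_comm (u (e i))]
      ring
    rw [e1]
    simp only [Finset.sum_sub_distrib, Finset.sum_add_distrib]
    rw [Finset.sum_comm (f := fun i j => p i * p j * (gcov μ (e j) (e j) / 2))]
    have e2 : ∀ i, ∑ j, p i * p j * (gcov μ (e i) (e i) / 2) = p i * (gcov μ (e i) (e i) / 2) := by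
      intro i
      rw [← Finset.sum_mul, ← Finset.mul_sum, hs, mul_one]
    have e3 : ∀ i, ∑ j, p j * p i * (gcov μ (e i) (e i) / 2) = p i * (gcov μ (e i) (e i) / 2) := by
      intro i
      rw [← Finset.sum_mul, ← Finset.sum_mul, hs, one_mul]
    simp only [e2, e3]
    rw [gvar, ← Finset.sum_add_distrib, ← Finset.sum_sub_distrib]
    refine Finset.sum_congr rfl fun i _ => ?_
    rw [← Finset.mul_sum, ← hp]
    ring
  have h2 : 1 - ∑ i, p i ^ 2 = ∑ i, ∑ j, p i * p j * (if i = j then 0 else 1) := by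
    have : ∀ i j, p i * p j * (if i = j then (0 : ℝ) else 1) =
        p i * p j - (if i = j then p i * p j else 0) := by
      intro i j; split_ifs <;> ring
    simp only [this, Finset.sum_sub_distrib, ← Finset.mul_sum, hs, mul_one]
    simp [pow_two]
  rw [h1, h2, Finset.mul_sum]
  refine Finset.sum_le_sum fun i _ => ?_
  rw [Finset.mul_sum]
  refine Finset.sum_le_sum fun j _ => ?_
  by_cases hij : i = j
  · simp [hij]
  · have h3 := hsep i j hij
    rw [gdist_eq μ hu] at h3
    have h4 : r ^ 2 ≤ ‖u (e i) - u (e j)‖ ^ 2 := pow_le_pow_left₀ hr h3 2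
    have h5 : 0 ≤ p i * p j := (mul_pos (hpp i) (hpp j)).le
    simp only [hij, if_false]
    nlinarith

/-- inner product lower bound at perturbed points -/
lemma gvar_perturb (β : ℝ) (e : κ → ι) (σ : ℝ) (a : κ → ι)
    (ha : ∀ i, gdist μ (e i) (a i) ≤ σ) (x : ι → ℝ) :
    gvar μ β e x / 2 - σ ^ 2 / 2 ≤
      ∑ i, gsm β e x i * (gcov μ (e i) (a i) - ∑ j, gsm β e x j * gcov μ (e j) (a i)) := by
  obtain ⟨u, hu⟩ := ge_exists_hilbert μ
  rw [gvar]
  set p := gsm β e x with hp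
  have hs : ∑ i, p i = 1 := gsm_sum β e x
  have hpp : ∀ i, 0 < p i := gsm_pos β e x
  set w : Lp ℝ 2 μ := ∑ j, p j • u (e j) with hw
  have hc : ∀ b i, gcov μ (e i) b - ∑ j, p j * gcov μ (e j) b = inner ℝ (u (e i) - w) (u b) := by
    intro b i
    rw [inner_sub_left, hw, sum_inner, hu]
    congr 1
    refine Finset.sum_congr rfl fun j _ => ?_
    rw [real_inner_smul_left, hu]
  simp only [hc]
  have hz : ∑ i, p i * inner ℝ (u (e i) - w) w = 0 := by
    have : ∀ i, p i * inner ℝ (u (e i) - w) w = inner ℝ (p i • u (e i)) w - p i * inner ℝ w w := by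
      intro i
      rw [inner_sub_left, real_inner_smul_left]; ring
    simp only [this, Finset.sum_sub_distrib, ← Finset.sum_mul, hs, ← sum_inner, ← hw]
    ring
  have hv : ∑ i, p i * inner ℝ (u (e i) - w) (u (e i)) = ∑ i, p i * ‖u (e i) - w‖ ^ 2 := by
    have : ∀ i, p i * ‖u (e i) - w‖ ^ 2 =
        p i * inner ℝ (u (e i) - w) (u (e i)) - p i * inner ℝ (u (e i) - w) w := by
      intro i
      rw [← mul_sub, ← inner_sub_right, real_inner_self_eq_norm_sq]
    simp only [this, Finset.sum_sub_distrib, hz, sub_zero]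
  have ht : ∀ i, p i * inner ℝ (u (e i) - w) (u (e i)) - p i * ‖u (e i) - w‖ ^ 2 / 2
      - p i * (σ ^ 2 / 2) ≤ p i * inner ℝ (u (e i) - w) (u (a i)) := by
    intro i
    have h1 : inner ℝ (u (e i) - w) (u (a i)) =
      inner ℝ (u (e i) - w) (u (e i)) - inner ℝ (u (e i) - w) (u (e i) - u (a i)) := by
      rw [inner_sub_right]; ring
    have h2 := real_inner_le_norm (u (e i) - w) (u (e i) - u (a i))
    have h3 := ha i
    rw [gdist_eq μ hu] at h3
    have h4 : ‖u (e i) - u (a i)‖ ^ 2 ≤ σ ^ 2 := pow_le_pow_left₀ (norm_nonneg _) h3 2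
    have h5 : inner ℝ (u (e i) - w) (u (e i) - u (a i)) ≤ ‖u (e i) - w‖ ^ 2 / 2 + σ ^ 2 / 2 := by
      nlinarith [sq_nonneg (‖u (e i) - w‖ - ‖u (e i) - u (a i)‖)]
    rw [h1]
    nlinarith [hpp i]
  have := Finset.sum_le_sum fun i (_ : i ∈ Finset.univ) => ht i
  simp only [Finset.sum_sub_distrib, ← Finset.sum_mul, ← Finset.sum_div, hs] at this
  linarith

lemma ge_integrable_bdd {ν : Measure (ι → ℝ)} [IsProbabilityMeasure ν] (f : (ι → ℝ) → ℝ)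
    (hf : Continuous f) (B : ℝ) (hB : ∀ x, |f x| ≤ B) : Integrable f ν :=
  (integrable_const B).mono' (by fun_prop) (Filter.Eventually.of_forall hB)

lemma gvar_bdd (β : ℝ) (e : κ → ι) :
    ∃ B, ∀ x, |gvar μ β e x| ≤ B := by
  refine ⟨∑ i : κ, (|gcov μ (e i) (e i)| + ∑ j, |gcov μ (e j) (e i)|), fun x => ?_⟩
  refine (Finset.abs_sum_le_sum_abs _ _).trans (Finset.sum_le_sum fun i _ => ?_)
  have key : ∀ i y, |gsm β e x i * y| ≤ |y| := by
    intro i y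
    rw [abs_mul, abs_of_pos (gsm_pos β e x i)]
    exact mul_le_of_le_one_left (abs_nonneg _) (gsm_le_one β e x i)
  refine (key _ _).trans ((abs_sub _ _).trans (add_le_add le_rfl ?_))
  exact (Finset.abs_sum_le_sum_abs _ _).trans (Finset.sum_le_sum fun j _ => key _ _)

lemma gvar_integrable (β : ℝ) (e : κ → ι) : Integrable (gvar μ β e) μ := by
  obtain ⟨B, hB⟩ := gvar_bdd μ β e
  exact ge_integrable_bdd _ (gvar_cont μ β e _ continuous_id) B hB

lemma ge_int_gsm_mul (β : ℝ) (e : κ → ι) (i : κ) (a : ι) :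
    Integrable (fun x => gsm β e x i * x a) μ := by
  refine (ge_int_norm μ).mono' (by fun_prop) (Filter.Eventually.of_forall fun x => ?_)
  rw [norm_mul, Real.norm_of_nonneg (gsm_pos β e x i).le]
  exact (mul_le_of_le_one_left (norm_nonneg _) (gsm_le_one β e x i)).trans (norm_le_pi_norm x a)

/-- Lower bound on the expected variance. -/
lemma gvar_int_ge (h0 : ∀ L : StrongDual ℝ (ι → ℝ), μ[L] = 0)
    (hm : (2 : ℝ) ≤ Fintype.card κ) (e : κ → ι) (r : ℝ) (hr : 0 < r)
    (hsep : ∀ i j, i ≠ j → r ≤ gdist μ (e i) (e j)) :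
    r ^ 2 / 100 ≤ ∫ x, gvar μ (Real.sqrt (Real.log (Fintype.card κ)) / r) e x ∂μ := by
  set L := Real.log (Fintype.card κ) with hL
  have hLpos : 0 < L := Real.log_pos (by linarith)
  set β := Real.sqrt L / r with hβ
  have hβ2 : β ^ 2 = L / r ^ 2 := by rw [hβ, div_pow, Real.sq_sqrt hLpos.le]
  have hx : ∫ x, ∑ i, gsm β e x i * x (e i) ∂μ = β * ∫ x, gvar μ β e x ∂μ := by
    rw [integral_finsetSum _ fun i _ => ge_int_gsm_mul μ β e i _]
    have : ∀ i, ∫ x, gsm β e x i * x (e i) ∂μ = ∫ x, β * (gsm β e x i *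
        (gcov μ (e i) (e i) - ∑ j, gsm β e x j * gcov μ (e j) (e i))) ∂μ := by
      intro i
      have := ge_gsm_ibp μ h0 β e 0 1 i (e i)
      simpa using this
    simp only [this]
    rw [← integral_finsetSum, ← integral_const_mul]
    · simp only [gvar, Finset.mul_sum]
    · intro i _
      refine (ge_integrable_bdd _ (by fun_prop)
        (|gcov μ (e i) (e i)| + ∑ j, |gcov μ (e j) (e i)|) fun x => ?_).const_mul _
      have key : ∀ i y, |gsm β e x i * y| ≤ |y| := by
        intro i y
        rw [abs_mul, abs_of_pos (gsm_pos β e x i)]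
        exact mul_le_of_le_one_left (abs_nonneg _) (gsm_le_one β e x i)
      refine (key _ _).trans ((abs_sub _ _).trans (add_le_add le_rfl ?_))
      exact (Finset.abs_sum_le_sum_abs _ _).trans (Finset.sum_le_sum fun j _ => key _ _)
  have hsum0 : ∫ x, ∑ i, x (e i) ∂μ = 0 := by
    rw [integral_finsetSum _ fun i _ => ge_int_coord μ _]
    exact Finset.sum_eq_zero fun i _ => h0 (ContinuousLinearMap.proj (e i))
  have hpt : ∀ x, L + β / (Fintype.card κ) * ∑ i, x (e i) ≤
      L / 2 + 32 * L / r ^ 2 * gvar μ β e x + β * ∑ i, gsm β e x i * x (e i) := by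
    intro x
    have h1 := ge_pointwise hm β e x
    have h2 := gvar_ge μ β e r hr.le hsep x
    rw [← hL] at h1
    have h3 : 32 * L / r ^ 2 * (r ^ 2 / 2 * (1 - ∑ i, gsm β e x i ^ 2)) =
        16 * L * (1 - ∑ i, gsm β e x i ^ 2) := by
      field_simp; ring
    have h4 : 32 * L / r ^ 2 * (r ^ 2 / 2 * (1 - ∑ i, gsm β e x i ^ 2)) ≤
        32 * L / r ^ 2 * gvar μ β e x := mul_le_mul_of_nonneg_left h2 (by positivity)
    rw [h3] at h4
    nlinarith
  have hi1 : Integrable (fun x : ι → ℝ => β / (Fintype.card κ) * ∑ i, x (e i)) μ :=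
    (integrable_finsetSum _ fun i _ => ge_int_coord μ _).const_mul _
  have hi2 : Integrable (fun x : ι → ℝ => 32 * L / r ^ 2 * gvar μ β e x) μ :=
    (gvar_integrable μ β e).const_mul _
  have hi3 : Integrable (fun x : ι → ℝ => β * ∑ i, gsm β e x i * x (e i)) μ :=
    (integrable_finsetSum _ fun i _ => ge_int_gsm_mul μ β e i _).const_mul _
  have hi4 : Integrable (fun x : ι → ℝ => L / 2 + 32 * L / r ^ 2 * gvar μ β e x) μ :=
    (integrable_const (L / 2)).add hi2
  have hI := integral_mono ((integrable_const L).add hi1)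
    (hi4.add hi3) hpt
  simp only [Pi.add_apply] at hI
  rw [integral_add (integrable_const L) hi1, integral_add hi4 hi3,
    integral_add (integrable_const _) hi2, integral_const_mul, integral_const_mul,
    integral_const_mul, hsum0, hx] at hI
  simp only [integral_const, probReal_univ, smul_eq_mul, one_mul, mul_zero, add_zero] at hI
  set V := ∫ x, gvar μ β e x ∂μ with hV
  have h5 : β * (β * V) = L / r ^ 2 * V := by rw [← mul_assoc, ← pow_two, hβ2]
  rw [h5] at hI
  have h6 : L * (1 / 2) ≤ L * (33 * V / r ^ 2) := by
    have : L * (33 * V / r ^ 2) = 32 * L / r ^ 2 * V + L / r ^ 2 * V := by ring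
    rw [this]; linarith
  have h7 := le_of_mul_le_mul_left h6 hLpos
  rw [le_div_iff₀ (by positivity)] at h7
  nlinarith [sq_nonneg r]

end Cov
section Super

variable {ι : Type v} [Fintype ι] {κ : Type v} [Fintype κ] [Nonempty κ]
  (μ : Measure (ι → ℝ)) [IsGaussian μ]

def gsup (A : Set ι) (x : ι → ℝ) : ℝ := sSup (x '' A)

lemma le_gsup {A : Set ι} {a : ι} (ha : a ∈ A) (x : ι → ℝ) : x a ≤ gsup A x :=
  le_csSup ((Set.toFinite A).image x).bddAbove (mem_image_of_mem x ha)

lemma gsup_att {A : Set ι} (hA : A.Nonempty) (x : ι → ℝ) : ∃ a ∈ A, gsup A x = x a := by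
  obtain ⟨a, ha, h⟩ := (hA.image x).csSup_mem ((Set.toFinite A).image x)
  exact ⟨a, ha, h.symm⟩

lemma gsup_lip {A : Set ι} (hA : A.Nonempty) (x y : ι → ℝ) : gsup A x ≤ gsup A y + ‖x - y‖ := by
  obtain ⟨a, ha, h⟩ := gsup_att hA x
  have h1 := le_gsup ha y
  have h2 := (le_abs_self _).trans (norm_le_pi_norm (x - y) a)
  rw [h]
  simp only [Pi.sub_apply] at h2
  linarith

lemma gsup_cont {A : Set ι} (hA : A.Nonempty) : Continuous (gsup A) := by
  have : LipschitzWith 1 (gsup A) := LipschitzWith.of_le_add fun x y => by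
    rw [dist_eq_norm]; exact gsup_lip hA x y
  exact this.continuous

lemma gsup_abs {A : Set ι} (hA : A.Nonempty) (x : ι → ℝ) : |gsup A x| ≤ ‖x‖ := by
  obtain ⟨a, ha, h⟩ := gsup_att hA x
  rw [h]
  exact norm_le_pi_norm x a

lemma gsup_int {A : Set ι} (hA : A.Nonempty) : Integrable (gsup A) μ :=
  (ge_int_norm μ).mono' (gsup_cont hA).aestronglyMeasurable
    (Filter.Eventually.of_forall fun x => gsup_abs hA x)

lemma ge_avg_le (β : ℝ) (e : κ → ι) (x : ι → ℝ) (y : κ → ℝ) (B : ℝ) (h : ∀ i, y i ≤ B) :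
    ∑ i, gsm β e x i * y i ≤ B := by
  calc ∑ i, gsm β e x i * y i ≤ ∑ i, gsm β e x i * B :=
        Finset.sum_le_sum fun i _ => mul_le_mul_of_nonneg_left (h i) (gsm_pos β e x i).le
    _ = B := by rw [← Finset.sum_mul, gsm_sum, one_mul]

lemma ge_avg_abs (β : ℝ) (e : κ → ι) (x : ι → ℝ) (y : κ → ℝ) (B : ℝ) (h : ∀ i, |y i| ≤ B) :
    |∑ i, gsm β e x i * y i| ≤ B := by
  rw [abs_le]
  constructor
  · have := ge_avg_le β e x (fun i => - y i) B fun i => (neg_le_abs _).trans (h i)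
    simp only [mul_neg, Finset.sum_neg_distrib] at this
    linarith
  · exact ge_avg_le β e x y B fun i => (le_abs_self _).trans (h i)

def gF (β : ℝ) (e : κ → ι) (A : κ → Set ι) (θ : ℝ) : ℝ :=
  ∫ z, ∑ i, gsm β e z.1 i * gsup (A i) (Real.cos θ • z.1 + Real.sin θ • z.2) ∂(μ.prod μ)

lemma gF_rot (h0 : ∀ L : StrongDual ℝ (ι → ℝ), μ[L] = 0) (β : ℝ) (e : κ → ι) (A : κ → Set ι)
    (hA : ∀ i, (A i).Nonempty) (φ δ : ℝ) :
    gF μ β e A (φ - δ) = ∫ z, ∑ i, gsm β e (Real.cos φ • z.1 + (-Real.sin φ) • z.2) i *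
      gsup (A i) (Real.cos δ • z.1 + (-Real.sin δ) • z.2) ∂(μ.prod μ) := by
  rw [gF, ← ge_rot μ h0 (-φ)]
  · refine integral_congr_ae (Filter.Eventually.of_forall fun z => ?_)
    simp only [Real.cos_neg, Real.sin_neg, neg_neg]
    have : Real.cos (φ - δ) • (Real.cos φ • z.1 + -Real.sin φ • z.2) +
        Real.sin (φ - δ) • (Real.sin φ • z.1 + Real.cos φ • z.2) =
        Real.cos δ • z.1 + (-Real.sin δ) • z.2 := by
      have e1 : Real.cos δ = Real.cos (φ - δ) * Real.cos φ + Real.sin (φ - δ) * Real.sin φ := by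
        rw [← Real.cos_sub, show φ - δ - φ = -δ by ring, Real.cos_neg]
      have e2 : Real.sin δ = Real.cos (φ - δ) * Real.sin φ - Real.sin (φ - δ) * Real.cos φ := by
        have : Real.sin (φ - (φ - δ)) = Real.sin δ := by ring_nf
        rw [← this, Real.sin_sub]; ring
      rw [e1, e2]
      module
    rw [this]
  · refine continuous_finsetSum _ fun i _ => Continuous.mul (by fun_prop) ?_
    exact (gsup_cont (hA i)).comp (by fun_prop)

lemma gF_step (h0 : ∀ L : StrongDual ℝ (ι → ℝ), μ[L] = 0) (β : ℝ) (hβ : 0 ≤ β)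
    (e : κ → ι) (A : κ → Set ι)
    (hA : ∀ i, (A i).Nonempty) (σ : ℝ) (hσ : ∀ i, ∀ a ∈ A i, gdist μ (e i) a ≤ σ)
    (φ δ : ℝ) (hφ : 0 ≤ Real.sin φ) (hδ : 0 ≤ Real.sin δ) :
    Real.sin δ * Real.sin φ * β * ((∫ x, gvar μ β e x ∂μ) / 2 - σ ^ 2 / 2)
      - (1 - Real.cos δ) * ∫ x, ‖x‖ ∂μ ≤ gF μ β e A (φ - δ) - gF μ β e A φ := by
  have hn1 : Integrable (fun z : (ι → ℝ) × (ι → ℝ) => ‖z.1‖) (μ.prod μ) :=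
    (ge_int_norm μ).comp_fst μ
  have hn2 : Integrable (fun z : (ι → ℝ) × (ι → ℝ) => ‖z.2‖) (μ.prod μ) :=
    (ge_int_norm μ).comp_snd μ
  have hcd : 0 ≤ 1 - Real.cos δ := by linarith [Real.cos_le_one δ]
  have hint : ∀ c d : ℝ, Integrable (fun z : (ι → ℝ) × (ι → ℝ) =>
      ∑ i, gsm β e (Real.cos φ • z.1 + (-Real.sin φ) • z.2) i *
      gsup (A i) (c • z.1 + d • z.2)) (μ.prod μ) := by
    intro c d
    refine ((hn1.const_mul |c|).add (hn2.const_mul |d|)).mono' ?_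
      (Filter.Eventually.of_forall fun z => ?_)
    · refine Continuous.aestronglyMeasurable ?_
      refine continuous_finsetSum _ fun i _ => Continuous.mul (by fun_prop) ?_
      exact (gsup_cont (hA i)).comp (by fun_prop)
    · rw [Real.norm_eq_abs]
      refine ge_avg_abs β e _ _ _ fun i => (gsup_abs (hA i) _).trans ?_
      refine (norm_add_le _ _).trans (le_of_eq ?_)
      simp [norm_smul]
  have hF1 := gF_rot μ h0 β e A hA φ δ
  have hF2 := gF_rot μ h0 β e A hA φ 0
  rw [sub_zero] at hF2
  rw [hF1, hF2, ← integral_sub (hint _ _) (hint _ _)]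
  have hV : ∫ z : (ι → ℝ) × (ι → ℝ), gvar μ β e (Real.cos φ • z.1 + (-Real.sin φ) • z.2)
      ∂(μ.prod μ) = ∫ x, gvar μ β e x ∂μ := by
    have h1 := ge_rot μ h0 (-φ) (fun z => gvar μ β e z.1) (by fun_prop)
    simp only [Real.cos_neg, Real.sin_neg] at h1
    rw [h1]
    have := integral_fun_fst (μ := μ) (ν := μ) (gvar μ β e)
    simpa using this
  have hVi : Integrable (fun z : (ι → ℝ) × (ι → ℝ) =>
      gvar μ β e (Real.cos φ • z.1 + (-Real.sin φ) • z.2)) (μ.prod μ) := by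
    obtain ⟨B, hB⟩ := gvar_bdd μ β e
    exact (integrable_const B).mono' (Continuous.aestronglyMeasurable (by fun_prop))
      (Filter.Eventually.of_forall fun z => hB _)
  have hVi2 : ∀ g, Integrable (fun h : ι → ℝ =>
      gvar μ β e (Real.cos φ • g + (-Real.sin φ) • h)) μ := by
    intro g
    obtain ⟨B, hB⟩ := gvar_bdd μ β e
    exact (integrable_const B).mono' (Continuous.aestronglyMeasurable (by fun_prop))
      (Filter.Eventually.of_forall fun z => hB _)
  set S := Real.sin δ * Real.sin φ * β with hS
  have hS0 : 0 ≤ S := mul_nonneg (mul_nonneg hδ hφ) hβ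
  have hJ : Integrable (fun z : (ι → ℝ) × (ι → ℝ) =>
      gvar μ β e (Real.cos φ • z.1 + (-Real.sin φ) • z.2) / 2 - σ ^ 2 / 2) (μ.prod μ) :=
    (hVi.div_const 2).sub (integrable_const _)
  have hR : Integrable (fun z : (ι → ℝ) × (ι → ℝ) =>
      S * (gvar μ β e (Real.cos φ • z.1 + (-Real.sin φ) • z.2) / 2 - σ ^ 2 / 2)
        - (1 - Real.cos δ) * ‖z.1‖) (μ.prod μ) :=
    (hJ.const_mul S).sub (hn1.const_mul _)
  have hleft : S * ((∫ x, gvar μ β e x ∂μ) / 2 - σ ^ 2 / 2)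
      - (1 - Real.cos δ) * ∫ x, ‖x‖ ∂μ = ∫ z : (ι → ℝ) × (ι → ℝ),
      (S * (gvar μ β e (Real.cos φ • z.1 + (-Real.sin φ) • z.2) / 2 - σ ^ 2 / 2)
        - (1 - Real.cos δ) * ‖z.1‖) ∂(μ.prod μ) := by
    rw [integral_sub (hJ.const_mul S) (hn1.const_mul _), integral_const_mul, integral_const_mul,
      integral_sub (hVi.div_const 2) (integrable_const _), integral_div, hV]
    have := integral_fun_fst (μ := μ) (ν := μ) (fun x : ι → ℝ => ‖x‖)
    rw [this]
    simp
  have hFi : Integrable (fun z : (ι → ℝ) × (ι → ℝ) =>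
      ∑ i, gsm β e (Real.cos φ • z.1 + (-Real.sin φ) • z.2) i *
        gsup (A i) (Real.cos δ • z.1 + (-Real.sin δ) • z.2) -
      ∑ i, gsm β e (Real.cos φ • z.1 + (-Real.sin φ) • z.2) i *
        gsup (A i) (Real.cos 0 • z.1 + (-Real.sin 0) • z.2)) (μ.prod μ) :=
    (hint _ _).sub (hint _ _)
  rw [hleft, integral_prod _ hR, integral_prod _ hFi]
  refine integral_mono hR.integral_prod_left hFi.integral_prod_left fun g => ?_
  simp only [Real.cos_zero, Real.sin_zero, neg_zero, zero_smul, add_zero, one_smul]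
  choose a ha hag using fun i => gsup_att (hA i) g
  set q : (ι → ℝ) → κ → ℝ := fun h => gsm β e (Real.cos φ • g + (-Real.sin φ) • h) with hq
  have hqa : ∀ i (b : ι), Integrable (fun h : ι → ℝ => q h i * h b) μ := by
    intro i b
    refine (ge_int_norm μ).mono' (Continuous.aestronglyMeasurable (by fun_prop))
      (Filter.Eventually.of_forall fun x => ?_)
    rw [norm_mul, Real.norm_of_nonneg (gsm_pos β e _ i).le]
    exact (mul_le_of_le_one_left (norm_nonneg _) (gsm_le_one β e _ i)).trans (norm_le_pi_norm x b)
  have hcb : ∀ i, Integrable (fun h : ι → ℝ =>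
      q h i * (gcov μ (e i) (a i) - ∑ j, q h j * gcov μ (e j) (a i))) μ := by
    intro i
    refine ge_integrable_bdd _ (by fun_prop)
      (|gcov μ (e i) (a i)| + ∑ j, |gcov μ (e j) (a i)|) fun x => ?_
    have key : ∀ i y, |q x i * y| ≤ |y| := by
      intro i y
      rw [abs_mul, abs_of_pos (gsm_pos β e _ i)]
      exact mul_le_of_le_one_left (abs_nonneg _) (gsm_le_one β e _ i)
    refine (key _ _).trans ((abs_sub _ _).trans (add_le_add le_rfl ?_))
    exact (Finset.abs_sum_le_sum_abs _ _).trans (Finset.sum_le_sum fun j _ => key _ _)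
  have hibp : ∫ h, ∑ i, q h i * h (a i) ∂μ = ∫ h, (-Real.sin φ * β) *
      ∑ i, q h i * (gcov μ (e i) (a i) - ∑ j, q h j * gcov μ (e j) (a i)) ∂μ := by
    rw [integral_finsetSum _ fun i _ => hqa i _, integral_const_mul,
      integral_finsetSum _ fun i _ => hcb i, Finset.mul_sum]
    refine Finset.sum_congr rfl fun i _ => ?_
    rw [ge_gsm_ibp μ h0, integral_const_mul]
  have hsumcb : Integrable (fun h : ι → ℝ => ∑ i,
      q h i * (gcov μ (e i) (a i) - ∑ j, q h j * gcov μ (e j) (a i))) μ :=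
    integrable_finsetSum _ fun i _ => hcb i
  have hsumqa : Integrable (fun h : ι → ℝ => ∑ i, q h i * h (a i)) μ :=
    integrable_finsetSum _ fun i _ => hqa i _
  have hJg : Integrable (fun h : ι → ℝ =>
      gvar μ β e (Real.cos φ • g + (-Real.sin φ) • h) / 2 - σ ^ 2 / 2) μ :=
    ((hVi2 g).div_const 2).sub (integrable_const _)
  have hmid : ∫ h, (S * (gvar μ β e (Real.cos φ • g + (-Real.sin φ) • h) / 2 - σ ^ 2 / 2)
        - (1 - Real.cos δ) * ‖g‖) ∂μ ≤
      ∫ h, (-Real.sin δ * ∑ i, q h i * h (a i) - (1 - Real.cos δ) * ‖g‖) ∂μ := by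
    rw [integral_sub (hJg.const_mul S) (integrable_const _),
      integral_sub (hsumqa.const_mul _) (integrable_const _), integral_const_mul,
      integral_const_mul, integral_const_mul, hibp, integral_const_mul]
    have h1 := integral_mono hJg hsumcb fun h => gvar_perturb μ β e σ a
      (fun i => hσ i _ (ha i)) (Real.cos φ • g + (-Real.sin φ) • h)
    have h2 := mul_le_mul_of_nonneg_left h1 hS0
    have h3 : ∀ y : ℝ, -Real.sin δ * (-Real.sin φ * β * y) = S * y := fun y => by rw [hS]; ring
    rw [h3]
    linarith
  refine hmid.trans ?_
  refine integral_mono ((hsumqa.const_mul _).sub (integrable_const _)) ?_ fun h => ?_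
  · refine (((ge_int_norm μ).const_mul 1).add (integrable_const (2 * ‖g‖))).mono' ?_
      (Filter.Eventually.of_forall fun h => ?_)
    · refine Continuous.aestronglyMeasurable (Continuous.sub ?_ ?_)
      · refine continuous_finsetSum _ fun i _ => Continuous.mul (by fun_prop) ?_
        exact (gsup_cont (hA i)).comp (by fun_prop)
      · fun_prop
    · rw [← Finset.sum_sub_distrib]
      simp only [← mul_sub]
      rw [Real.norm_eq_abs]
      refine ge_avg_abs β e _ _ _ fun i => ?_
      refine (abs_sub _ _).trans ?_
      have h1 := gsup_abs (hA i) g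
      have h2 := gsup_abs (hA i) (Real.cos δ • g + -Real.sin δ • h)
      have h3 := norm_add_le (Real.cos δ • g) (-Real.sin δ • h)
      rw [norm_smul, norm_smul, norm_neg, Real.norm_eq_abs, Real.norm_eq_abs] at h3
      have h4 := mul_le_of_le_one_left (norm_nonneg g) (Real.abs_cos_le_one δ)
      have h5 := mul_le_of_le_one_left (norm_nonneg h) (Real.abs_sin_le_one δ)
      simp only [Pi.add_apply]
      linarith
  · simp only []
    rw [← Finset.sum_sub_distrib]
    simp only [← mul_sub]
    have h1 : ∀ i, -Real.sin δ * h (a i) - (1 - Real.cos δ) * ‖g‖ ≤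
        gsup (A i) (Real.cos δ • g + -Real.sin δ • h) - gsup (A i) g := by
      intro i
      have h2 := le_gsup (ha i) (Real.cos δ • g + -Real.sin δ • h)
      rw [hag i]
      have h3 := (le_abs_self _).trans (norm_le_pi_norm g (a i))
      have h4 := mul_le_mul_of_nonneg_left h3 hcd
      simp only [Pi.add_apply, Pi.smul_apply, smul_eq_mul] at h2
      linarith
    have h2 := Finset.sum_le_sum fun i (_ : i ∈ Finset.univ) =>
      mul_le_mul_of_nonneg_left (h1 i) (gsm_pos β e (Real.cos φ • g + (-Real.sin φ) • h) i).le
    refine le_trans (le_of_eq ?_) h2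
    simp only [mul_sub, Finset.sum_sub_distrib]
    rw [← Finset.sum_mul, gsm_sum, one_mul, Finset.mul_sum]
    have : ∀ i, q h i * (-Real.sin δ * h (a i)) = -Real.sin δ * (q h i * h (a i)) :=
      fun i => by ring
    simp only [hq] at this ⊢
    simp only [this]

lemma gF_total (h0 : ∀ L : StrongDual ℝ (ι → ℝ), μ[L] = 0) (β : ℝ) (hβ : 0 ≤ β)
    (e : κ → ι) (A : κ → Set ι)
    (hA : ∀ i, (A i).Nonempty) (σ : ℝ) (hσ : ∀ i, ∀ a ∈ A i, gdist μ (e i) a ≤ σ)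
    (hV : 0 ≤ (∫ x, gvar μ β e x ∂μ) / 2 - σ ^ 2 / 2) :
    β * ((∫ x, gvar μ β e x ∂μ) / 2 - σ ^ 2 / 2) ≤ gF μ β e A 0 - gF μ β e A (Real.pi / 2) := by
  set K := β * ((∫ x, gvar μ β e x ∂μ) / 2 - σ ^ 2 / 2) with hK
  have hK0 : 0 ≤ K := mul_nonneg hβ hV
  set M := ∫ x, ‖x‖ ∂μ with hM
  have hM0 : 0 ≤ M := integral_nonneg fun x => norm_nonneg x
  have hpi := Real.pi_pos
  have hN : ∀ N : ℕ, 0 < N → K - Real.pi ^ 2 * M / 8 / N ≤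
      gF μ β e A 0 - gF μ β e A (Real.pi / 2) := by
    intro N hN
    have hNr : (0 : ℝ) < N := by exact_mod_cast hN
    have hN1 : (1 : ℝ) ≤ N := by exact_mod_cast hN
    set δ := Real.pi / 2 / N with hδ
    have hNδ : N * δ = Real.pi / 2 := by rw [hδ]; field_simp
    have hδ0 : 0 < δ := by positivity
    have hδ1 : δ ≤ Real.pi / 2 := by nlinarith
    have hsδ : 0 ≤ Real.sin δ := Real.sin_nonneg_of_nonneg_of_le_pi hδ0.le (by linarith)
    have hcδ : 1 - Real.cos δ ≤ δ ^ 2 / 2 := by linarith [Real.one_sub_sq_div_two_le_cos (x := δ)]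
    have hstep : ∀ k ∈ Finset.range N,
        K * (Real.cos (k * δ) - Real.cos ((k + 1 : ℕ) * δ)) - δ ^ 2 / 2 * M ≤
        gF μ β e A (k * δ) - gF μ β e A ((k + 1 : ℕ) * δ) := by
      intro k hk
      have hkN : ((k + 1 : ℕ) : ℝ) ≤ N := by exact_mod_cast Finset.mem_range.1 hk
      set φ := ((k + 1 : ℕ) : ℝ) * δ with hφ
      have hφ0 : 0 ≤ φ := by positivity
      have hφ1 : φ ≤ Real.pi / 2 := by rw [← hNδ]; exact mul_le_mul_of_nonneg_right hkN hδ0.le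
      have hkφ : (k : ℝ) * δ = φ - δ := by rw [hφ]; push_cast; ring
      rw [hkφ]
      have h1 := gF_step μ h0 β hβ e A hA σ hσ φ δ
        (Real.sin_nonneg_of_nonneg_of_le_pi hφ0 (by linarith)) hsδ
      have hcφ : 0 ≤ Real.cos φ := Real.cos_nonneg_of_neg_pi_div_two_le_of_le (by linarith) hφ1
      have h2 : Real.cos (φ - δ) - Real.cos φ ≤ Real.sin δ * Real.sin φ := by
        rw [Real.cos_sub]
        nlinarith [Real.cos_le_one δ]
      have h3 := mul_le_mul_of_nonneg_left h2 hK0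
      have h4 := mul_le_mul_of_nonneg_right hcδ hM0
      have h5 : Real.sin δ * Real.sin φ * β * ((∫ x, gvar μ β e x ∂μ) / 2 - σ ^ 2 / 2) =
        K * (Real.sin δ * Real.sin φ) := by rw [hK]; ring
      rw [h5] at h1
      linarith
    have hsum := Finset.sum_le_sum hstep
    rw [Finset.sum_sub_distrib, ← Finset.mul_sum,
      Finset.sum_range_sub' (fun k : ℕ => Real.cos (k * δ)),
      Finset.sum_range_sub' (fun k : ℕ => gF μ β e A (k * δ)), hNδ] at hsum
    simp only [Nat.cast_zero, zero_mul, Real.cos_zero, Real.cos_pi_div_two, Finset.sum_const,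
      Finset.card_range, nsmul_eq_mul] at hsum
    have h6 : (N : ℝ) * (δ ^ 2 / 2 * M) = Real.pi ^ 2 * M / 8 / N := by
      rw [hδ]; field_simp; ring
    rw [h6] at hsum
    linarith
  refine le_of_forall_pos_le_add fun ε hε => ?_
  obtain ⟨N, hN'⟩ := exists_nat_gt (Real.pi ^ 2 * M / 8 / ε)
  have hNr : (0 : ℝ) < N := lt_of_le_of_lt (by positivity) hN'
  have h1 := hN N (by exact_mod_cast hNr)
  rw [div_lt_iff₀ hε] at hN'
  have h2 : Real.pi ^ 2 * M / 8 / N ≤ ε := by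
    rw [div_le_iff₀ hNr]; linarith
  linarith

/-- Talagrand's improved Sudakov minoration. -/
lemma ge_super_sudakov (h0 : ∀ L : StrongDual ℝ (ι → ℝ), μ[L] = 0)
    (hm : (2 : ℝ) ≤ Fintype.card κ) (e : κ → ι) (A : κ → Set ι) (U : Set ι)
    (hA : ∀ i, (A i).Nonempty) (hAU : ∀ i, A i ⊆ U) (r σ : ℝ) (hr : 0 < r)
    (hσ0 : 0 ≤ σ) (hrσ : 10 * σ ≤ r)
    (hσ : ∀ i, ∀ a ∈ A i, gdist μ (e i) a ≤ σ)
    (hsep : ∀ i j, i ≠ j → r ≤ gdist μ (e i) (e j)) (G : ℝ)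
    (hG : ∀ i, G ≤ ∫ x, gsup (A i) x ∂μ) :
    G + Real.sqrt (Real.log (Fintype.card κ)) / 20 * (r / 10 - σ) ≤ ∫ x, gsup U x ∂μ := by
  have hU : U.Nonempty := (hA (Classical.arbitrary κ)).mono (hAU _)
  have hVge := gvar_int_ge μ h0 hm e r hr hsep
  set sL := Real.sqrt (Real.log (Fintype.card κ)) with hsL
  have hsL0 : 0 ≤ sL := Real.sqrt_nonneg _
  set β := sL / r with hβ
  have hβ0 : 0 ≤ β := by positivity
  have hsq : σ ^ 2 ≤ r ^ 2 / 100 := by nlinarith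
  have h1 := gF_total μ h0 β hβ0 e A hA σ hσ (by linarith)
  have hF0 : gF μ β e A 0 ≤ ∫ x, gsup U x ∂μ := by
    have hfst := integral_fun_fst (μ := μ) (ν := μ) (gsup U)
    simp only [probReal_univ, one_smul] at hfst
    rw [← hfst, gF]
    simp only [Real.cos_zero, Real.sin_zero, one_smul, zero_smul, add_zero]
    refine integral_mono ?_ ((gsup_int μ hU).comp_fst μ) fun z => ?_
    · refine ((ge_int_norm μ).comp_fst μ).mono' ?_ (Filter.Eventually.of_forall fun z => ?_)
      · refine Continuous.aestronglyMeasurable ?_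
        refine continuous_finsetSum _ fun i _ => Continuous.mul (by fun_prop) ?_
        exact (gsup_cont (hA i)).comp (by fun_prop)
      · rw [Real.norm_eq_abs]
        exact ge_avg_abs β e _ _ _ fun i => gsup_abs (hA i) _
    · refine ge_avg_le β e _ _ _ fun i => ?_
      obtain ⟨a, ha, h⟩ := gsup_att (hA i) z.1
      rw [h]
      exact le_gsup (hAU i ha) _
  have hF1 : G ≤ gF μ β e A (Real.pi / 2) := by
    rw [gF]
    simp only [Real.cos_pi_div_two, Real.sin_pi_div_two, one_smul, zero_smul, zero_add]
    have hgi : ∀ i, Integrable (fun x => gsm β e x i) μ := fun i =>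
      ge_integrable_bdd _ (by fun_prop) 1 fun x => by
        rw [abs_of_pos (gsm_pos β e x i)]; exact gsm_le_one β e x i
    rw [integral_finsetSum _ fun i _ => (hgi i).mul_prod (gsup_int μ (hA i))]
    have h2 : ∀ i, ∫ z : (ι → ℝ) × (ι → ℝ), gsm β e z.1 i * gsup (A i) z.2 ∂(μ.prod μ) =
        (∫ x, gsm β e x i ∂μ) * ∫ x, gsup (A i) x ∂μ := fun i =>
      integral_prod_mul (fun x => gsm β e x i) (gsup (A i))
    simp only [h2]
    have h3 : ∑ i, ∫ x, gsm β e x i ∂μ = 1 := by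
      rw [← integral_finsetSum _ fun i _ => hgi i]
      simp [gsm_sum]
    calc G = ∑ i, (∫ x, gsm β e x i ∂μ) * G := by rw [← Finset.sum_mul, h3, one_mul]
      _ ≤ _ := Finset.sum_le_sum fun i _ => mul_le_mul_of_nonneg_left (hG i)
          (integral_nonneg fun x => (gsm_pos β e x i).le)
  have h4 : sL / 20 * (r / 10 - σ) ≤ β * ((∫ x, gvar μ β e x ∂μ) / 2 - σ ^ 2 / 2) := by
    have h5 : β * (r ^ 2 / 100 / 2 - σ ^ 2 / 2) ≤
        β * ((∫ x, gvar μ β e x ∂μ) / 2 - σ ^ 2 / 2) :=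
      mul_le_mul_of_nonneg_left (by linarith) hβ0
    refine le_trans ?_ h5
    have h6 : sL / 20 * (r / 10 - σ) = β * (r / 20 * (r / 10 - σ)) := by
      rw [hβ]; field_simp
    rw [h6]
    refine mul_le_mul_of_nonneg_left ?_ hβ0
    nlinarith
  linarith

end Super
section Final

variable {Ω : Type u} {ι : Type v} [MeasureSpace Ω] [Fintype ι]

def gLaw (X : ι → Ω → ℝ) : Measure (ι → ℝ) := Measure.map (fun ω x => X x ω) ℙ

lemma gLaw_aux (X : ι → Ω → ℝ) (hX : IsCenteredGaussianProcess X) (L : StrongDual ℝ (ι → ℝ)) :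
    ∃ v : ℝ≥0, (gLaw X).map L = gaussianReal 0 v := by
  classical
  obtain ⟨v, hv⟩ := hX.2 (fun x => L (Pi.single x 1))
  refine ⟨v, ?_⟩
  rw [← hv, gLaw, Measure.map_map (by fun_prop) (measurable_pi_lambda _ hX.1)]
  congr 1
  funext ω
  simp only [Function.comp]
  have h1 : (fun x => X x ω) = ∑ x, X x ω • (Pi.single x (1 : ℝ) : ι → ℝ) := by
    ext y
    simp [Finset.sum_apply, Pi.single_apply]
  conv_lhs => rw [h1]
  rw [map_sum]
  exact Finset.sum_congr rfl fun x _ => by rw [map_smul, smul_eq_mul, mul_comm]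

lemma gLaw_gaussian (X : ι → Ω → ℝ) (hX : IsCenteredGaussianProcess X) : IsGaussian (gLaw X) :=
  isGaussian_of_map_eq_gaussianReal fun L => ⟨0, gLaw_aux X hX L⟩

lemma gLaw_mean (X : ι → Ω → ℝ) (hX : IsCenteredGaussianProcess X) (L : StrongDual ℝ (ι → ℝ)) :
    (gLaw X)[L] = 0 := by
  obtain ⟨v, hv⟩ := gLaw_aux X hX L
  have h : ∫ y, y ∂((gLaw X).map L) = ∫ x, L x ∂(gLaw X) :=
    integral_map (by fun_prop) (by fun_prop)
  rw [← h, hv]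
  exact integral_id_gaussianReal

lemma gLaw_dist (X : ι → Ω → ℝ) (hX : IsCenteredGaussianProcess X) (a b : ι) :
    natDist X a b = gdist (gLaw X) a b := by
  rw [natDist, gdist, gLaw, integral_map (measurable_pi_lambda _ hX.1).aemeasurable
    (Continuous.aestronglyMeasurable (by fun_prop))]

lemma gLaw_width (X : ι → Ω → ℝ) (hX : IsCenteredGaussianProcess X) (A : Set ι)
    (hA : A.Nonempty) : gWidth X A = ∫ x, gsup A x ∂(gLaw X) := by
  rw [gWidth, gLaw, integral_map (measurable_pi_lambda _ hX.1).aemeasurable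
    (gsup_cont hA).aestronglyMeasurable]
  rfl

lemma ge_separated {ι : Type v} (d : ι → ι → ℝ) (hd : ∀ x, d x x = 0) (hsymm : ∀ x y, d x y = d y x)
    (n : ℕ) (A : Set ι) (r : ℝ)
    (hr : ENNReal.ofReal r < entN (fun x y => ENNReal.ofReal (d x y)) n A) (k : ℕ)
    (hk : k ≤ 2 ^ 2 ^ n) :
    ∃ S : Finset ι, S.card = k ∧ (∀ x ∈ S, x ∈ A) ∧ ∀ x ∈ S, ∀ y ∈ S, x ≠ y → r ≤ d x y := by
  classical
  induction k with
  | zero => exact ⟨∅, by simp⟩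
  | succ k ih =>
    obtain ⟨S, hc, hSA, hS⟩ := ih (by omega)
    have h1 : entN (fun x y => ENNReal.ofReal (d x y)) n A ≤
        ⨆ x ∈ A, ⨅ y ∈ S, ENNReal.ofReal (d x y) :=
      iInf₂_le S (by omega)
    obtain ⟨x, hx⟩ := lt_iSup_iff.1 (hr.trans_le h1)
    obtain ⟨hxA, hx⟩ := lt_iSup_iff.1 hx
    have h2 : ∀ y ∈ S, ENNReal.ofReal r < ENNReal.ofReal (d x y) := fun y hy =>
      hx.trans_le (iInf₂_le y hy)
    have h3 : ∀ y ∈ S, r ≤ d x y := fun y hy => by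
      by_contra hcon
      exact absurd (h2 y hy) (not_lt.2 (ENNReal.ofReal_le_ofReal (not_le.1 hcon).le))
    have hxS : x ∉ S := by
      intro h
      have := h2 x h
      rw [hd] at this
      simp at this
    refine ⟨insert x S, by rw [Finset.card_insert_of_notMem hxS, hc], ?_, ?_⟩
    · intro y hy
      rcases Finset.mem_insert.1 hy with rfl | hy
      · exact hxA
      · exact hSA y hy
    · intro y hy z hz hyz
      rw [Finset.mem_insert] at hy hz
      rcases hy with rfl | hy1
      · rcases hz with h | hz1
        · exact absurd h.symm hyz
        · exact h3 z hz1
      · rcases hz with h | hz1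
        · rw [h, hsymm]; exact h3 y hy1
        · exact hS y hy1 z hz1 hyz

end Final

/-- **Entropy bound from Gaussian interpolation** (Lemma 6.6). With `s(t,x)` a
minimizer of `s ↦ t·s + G(T) − G(B(x,s))` over `s ≥ 0`, there is a universal
constant `C` such that for all `n ≥ 0`, `A ⊆ T`, `a > 0`:
`e_n(A) ≤ C (a·diam(A) + (a+1)·sup_{x∈A} s(a·2^{n/2}, x))`. -/
theorem gaussian_entropy_bound :
    ∃ C : ℝ, 0 < C ∧
      ∀ (Ω : Type u) (ι : Type v) [MeasureSpace Ω] [Fintype ι],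
        ∀ _ : IsProbabilityMeasure (ℙ : Measure Ω),
        ∀ X : ι → Ω → ℝ, IsCenteredGaussianProcess X →
        ∀ s : ℝ → ι → ℝ,
          (∀ t : ℝ, 0 ≤ t → ∀ x : ι, 0 ≤ s t x ∧
            ∀ σ : ℝ, 0 ≤ σ →
              t * s t x + gWidth X univ - gWidth X {y | natDist X x y ≤ s t x} ≤
                t * σ + gWidth X univ - gWidth X {y | natDist X x y ≤ σ}) →
        ∀ (n : ℕ) (A : Set ι) (a : ℝ), 0 < a →
          entN (fun x y => ENNReal.ofReal (natDist X x y)) n A ≤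
            ENNReal.ofReal C *
              (ENNReal.ofReal a * eDiam (fun x y => ENNReal.ofReal (natDist X x y)) A +
                (ENNReal.ofReal a + 1) *
                  ⨆ x ∈ A, ENNReal.ofReal (s (a * (2 : ℝ) ^ ((n : ℝ) / 2)) x)) := by
  classical
  refine ⟨300, by norm_num, ?_⟩
  intro Ω ι _ _ hP X hX s hs n A a ha
  have hGauss : IsGaussian (gLaw X) := gLaw_gaussian X hX
  set μ := gLaw X with hμ
  have h0 := gLaw_mean X hX
  have hself : ∀ x, natDist X x x = 0 := fun x => by simp [natDist]
  have hsymm : ∀ x y, natDist X x y = natDist X y x := fun x y => by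
    rw [gLaw_dist X hX, gLaw_dist X hX, gdist_comm]
  have htri : ∀ x y z, natDist X x z ≤ natDist X x y + natDist X y z := fun x y z => by
    rw [gLaw_dist X hX, gLaw_dist X hX, gLaw_dist X hX]
    exact gdist_triangle _ _ _ _
  by_contra hcon
  rw [not_le] at hcon
  set P : ℝ := (2 : ℝ) ^ ((n : ℝ) / 2) with hP
  have hP0 : 0 < P := Real.rpow_pos_of_pos (by norm_num) _
  have hP2 : P ^ 2 = 2 ^ n := by
    rw [hP, ← Real.rpow_natCast, ← Real.rpow_mul (by norm_num)]
    simp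
  set t := a * P with ht
  have ht0 : 0 ≤ t := by positivity
  set Se : ℝ≥0∞ := ⨆ x ∈ A, ENNReal.ofReal (s t x) with hSe
  set De : ℝ≥0∞ := eDiam (fun x y => ENNReal.ofReal (natDist X x y)) A with hDe
  have hfin := (lt_top_of_lt hcon).ne
  have hSfin : Se ≠ ⊤ := by
    intro h
    apply hfin
    rw [h, ENNReal.mul_top (by simp), add_top, ENNReal.mul_top (by simp)]
  have hDfin : De ≠ ⊤ := by
    intro h
    apply hfin
    rw [h, ENNReal.mul_top (by simpa using ha), top_add, ENNReal.mul_top (by simp)]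
  set σ := Se.toReal with hσdef
  set D := De.toReal with hDdef
  have hσ0 : 0 ≤ σ := ENNReal.toReal_nonneg
  have hD0 : 0 ≤ D := ENNReal.toReal_nonneg
  have hsσ : ∀ x ∈ A, s t x ≤ σ := by
    intro x hx
    have : ENNReal.ofReal (s t x) ≤ Se := le_iSup₂ (f := fun x (_ : x ∈ A) =>
      ENNReal.ofReal (s t x)) x hx
    exact (ENNReal.ofReal_le_iff_le_toReal hSfin).1 this
  have hdD : ∀ x ∈ A, ∀ y ∈ A, natDist X x y ≤ D := by
    intro x hx y hy
    have h1 : ENNReal.ofReal (natDist X x y) ≤ De := by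
      rw [hDe, eDiam]
      refine le_trans ?_ (le_iSup₂ (f := fun x (_ : x ∈ A) =>
        ⨆ y ∈ A, ENNReal.ofReal (natDist X x y)) x hx)
      exact le_iSup₂ (f := fun y (_ : y ∈ A) => ENNReal.ofReal (natDist X x y)) y hy
    exact (ENNReal.ofReal_le_iff_le_toReal hDfin).1 h1
  obtain ⟨r, hr1, hr2⟩ := ENNReal.lt_iff_exists_nnreal_btwn.1 hcon
  have hr1' : 300 * (a * D + (a + 1) * σ) < (r : ℝ) := by
    rw [← ENNReal.ofReal_toReal hSfin, ← ENNReal.ofReal_toReal hDfin, ← hσdef, ← hDdef,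
      ← ENNReal.ofReal_one, ← ENNReal.ofReal_add ha.le zero_le_one, ← ENNReal.ofReal_mul ha.le,
      ← ENNReal.ofReal_mul (by linarith), ← ENNReal.ofReal_add (by positivity) (by positivity),
      ← ENNReal.ofReal_mul (by norm_num)] at hr1
    have := (ENNReal.toReal_lt_toReal ENNReal.ofReal_ne_top ENNReal.coe_ne_top).2 hr1
    rwa [ENNReal.toReal_ofReal (by positivity), ENNReal.coe_toReal] at this
  rw [← ENNReal.ofReal_coe_nnreal] at hr2
  obtain ⟨I, hIc, hIA, hIsep⟩ := ge_separated (natDist X) hself hsymm n A r hr2 _ le_rfl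
  have hrpos : (0 : ℝ) < r := lt_of_le_of_lt (by positivity) hr1'
  have hcardI : Fintype.card I = 2 ^ 2 ^ n := by rw [Fintype.card_coe, hIc]
  have hne : Nonempty I := by
    rw [← Fintype.card_pos_iff, hcardI]; positivity
  have hcard2 : (2 : ℝ) ≤ Fintype.card I := by
    rw [hcardI]
    have : 2 ^ 1 ≤ 2 ^ 2 ^ n := Nat.pow_le_pow_right (by norm_num) Nat.one_le_two_pow
    exact_mod_cast this
  set B : I → Set ι := fun i => {y | natDist X i y ≤ s t i} with hB
  have hBne : ∀ i, (B i).Nonempty := fun i => ⟨i, by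
    simp only [hB, mem_setOf_eq, hself]; exact (hs t ht0 i).1⟩
  obtain ⟨j, hj⟩ := Finite.exists_min (fun i : I => gWidth X (B i))
  set U : Set ι := {y | natDist X j y ≤ D + σ} with hU
  have hBU : ∀ i, B i ⊆ U := by
    intro i y hy
    simp only [hB, hU, mem_setOf_eq] at hy ⊢
    have h1 := htri j i y
    have h2 := hdD j (hIA j j.2) i (hIA i i.2)
    have h3 := hsσ i (hIA i i.2)
    linarith
  have hUne : U.Nonempty := (hBne j).mono (hBU j)
  have hmain := ge_super_sudakov μ h0 hcard2 (fun i : I => (i : ι)) B U hBne hBU r σ hrpos hσ0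
    (by nlinarith [mul_nonneg ha.le hD0, mul_nonneg ha.le hσ0])
    (fun i y hy => by
      rw [← gLaw_dist X hX]
      exact le_trans hy (hsσ i (hIA i i.2)))
    (fun i k hik => by
      rw [← gLaw_dist X hX]
      exact hIsep i i.2 k k.2 fun h => hik (Subtype.ext h))
    (gWidth X (B j))
    (fun i => by rw [← gLaw_width X hX _ (hBne i)]; exact hj i)
  rw [← gLaw_width X hX _ hUne] at hmain
  obtain ⟨hs0, hs1⟩ := hs t ht0 j
  have hs2 := hs1 (D + σ) (by positivity)
  have hs3 : gWidth X U ≤ t * (D + σ) + gWidth X (B j) := by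
    have := mul_nonneg ht0 hs0
    simp only [hU, hB]
    linarith
  have hlog : 0.8 * P ≤ Real.sqrt (Real.log (Fintype.card I)) := by
    apply Real.le_sqrt_of_sq_le
    rw [hcardI]
    push_cast
    rw [Real.log_pow]
    push_cast
    rw [mul_pow, hP2]
    have : (0 : ℝ) < 2 ^ n := by positivity
    nlinarith [Real.log_two_gt_d9]
  have hrσ : 0 ≤ (r : ℝ) / 10 - σ := by
    nlinarith [mul_nonneg ha.le hD0, mul_nonneg ha.le hσ0]
  have h1 := mul_le_mul_of_nonneg_right hlog hrσ
  have h2 : P * (0.04 * (r / 10 - σ)) ≤ P * (a * (D + σ)) := by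
    rw [ht] at hs3
    linarith
  have h3 := le_of_mul_le_mul_left h2 hP0
  have h4 := mul_nonneg ha.le hD0
  have h5 := mul_nonneg ha.le hσ0
  nlinarith
end
end

section
/- (Lower bound in the majorizing measure theorem.) Let T be a finite set and (X_x)_{x∈T} a centered Gaussian process with natural metric d(x,y) := (E|X_x − X_y|²)^{1/2}. Then there is a universal constant C such that γ₂(T,d) ≤ C · E[ sup_{x∈T} X_x ]. -/
open scoped ENNReal NNReal ProbabilityTheory
open MeasureTheory ProbabilityTheory Set

noncomputable section

universe u v

/-- An admissible sequence of a set `T`: an increasing (refining) sequence of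
partitions of `T`, the `n`-th one having fewer than `2^(2^n)` pieces. -/
structure Admissible {ι : Type v} (T : Set ι) where
  piece : ℕ → ι → Set ι
  self_mem : ∀ n, ∀ x ∈ T, x ∈ piece n x
  subset_base : ∀ n, ∀ x ∈ T, piece n x ⊆ T
  partition : ∀ n, ∀ x ∈ T, ∀ y ∈ T, y ∈ piece n x → piece n y = piece n x
  finite_pieces : ∀ n, {A : Set ι | ∃ x ∈ T, piece n x = A}.Finite
  card_pieces : ∀ n, {A : Set ι | ∃ x ∈ T, piece n x = A}.ncard < 2 ^ 2 ^ n
  nested : ∀ n, ∀ x ∈ T, piece (n + 1) x ⊆ piece n x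

/-- The chaining functional `γ₂(T,d)` with respect to the extended distance `D`. -/
def gammaTwo {ι : Type v} (D : ι → ι → ℝ≥0∞) (T : Set ι) : ℝ≥0∞ :=
  ⨅ P : Admissible T,
    ⨆ x ∈ T, ∑' n : ℕ, (2 : ℝ≥0∞) ^ ((n : ℝ) / 2) * eDiam D (P.piece n x)

section MMPartA

/-- One-dimensional Gaussian integration by parts. -/
lemma mm_stein (v : ℝ≥0) (f f' : ℝ → ℝ) (hf : ∀ x, HasDerivAt f (f' x) x)
    (hf'c : Continuous f') (C : ℝ) (hfb : ∀ x, |f x| ≤ C) (hf'b : ∀ x, |f' x| ≤ C) :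
    ∫ x, x * f x ∂(gaussianReal 0 v) = v * ∫ x, f' x ∂(gaussianReal 0 v) := by
  by_cases hv : v = 0
  · subst hv
    simp [gaussianReal_zero_var]
  have hfc : Continuous f := continuous_iff_continuousAt.2 fun x => (hf x).continuousAt
  have hv' : (v : ℝ) ≠ 0 := by exact_mod_cast hv
  rw [integral_gaussianReal_eq_integral_smul hv, integral_gaussianReal_eq_integral_smul hv]
  have hpd : ∀ x, HasDerivAt (gaussianPDFReal 0 v) (-(x / v) * gaussianPDFReal 0 v x) x := by
    intro x
    unfold gaussianPDFReal
    have h1 : HasDerivAt (fun x : ℝ => -(x - 0) ^ 2 / (2 * (v : ℝ))) (-(x / v)) x := by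
      have := (((hasDerivAt_id x).sub_const 0).pow 2).neg.div_const (2 * (v : ℝ))
      refine this.congr_deriv ?_
      simp
      field_simp
    exact (h1.exp.const_mul _).congr_deriv (by ring)
  have hIntg0 := integrable_gaussianPDFReal 0 v
  have hIntg1 : Integrable (fun x => x * gaussianPDFReal 0 v x) := by
    have h := (memLp_id_gaussianReal' (μ := 0) (v := v) 1 (by simp)).integrable le_rfl
    rw [gaussianReal_of_var_ne_zero _ hv] at h
    unfold gaussianPDF at h
    rw [integrable_withDensity_iff (by fun_prop) (by simp)] at h
    refine h.congr (Filter.Eventually.of_forall fun x => ?_)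
    simp [ENNReal.toReal_ofReal (gaussianPDFReal_nonneg 0 v x)]
  have key := integral_mul_deriv_eq_deriv_mul_of_integrable (u := f) (u' := f')
    (v := gaussianPDFReal 0 v) (v' := fun x => -(x / v) * gaussianPDFReal 0 v x)
    (fun x _ => hf x) (fun x _ => hpd x) ?_ ?_ ?_
  · have e1 : ∀ x, gaussianPDFReal 0 v x • (x * f x)
        = -(v * (f x * (-(x / v) * gaussianPDFReal 0 v x))) := by
      intro x
      simp only [smul_eq_mul]
      field_simp
    simp_rw [e1]
    rw [integral_neg, integral_const_mul, key]
    simp only [smul_eq_mul, mul_neg, neg_neg]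
    congr 2
    ext x; ring
  · have : Integrable (fun x => f x * (-(1 / v) * (x * gaussianPDFReal 0 v x))) :=
      (hIntg1.const_mul _).bdd_mul (c := C) hfc.aestronglyMeasurable
        (Filter.Eventually.of_forall hfb)
    refine this.congr (Filter.Eventually.of_forall fun x => ?_)
    simp only [Pi.mul_apply]; ring
  · exact hIntg0.bdd_mul (c := C) hf'c.aestronglyMeasurable (Filter.Eventually.of_forall hf'b)
  · exact hIntg0.bdd_mul (c := C) hfc.aestronglyMeasurable (Filter.Eventually.of_forall hfb)

/-- Gaussian integration by parts for jointly Gaussian `(U, W)`. -/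
lemma mm_ibp {Ω ι : Type*} [Fintype ι] {mΩ : MeasurableSpace Ω} {P : Measure Ω}
    (U : Ω → ℝ) (W : ι → Ω → ℝ)
    (h : HasGaussianLaw (fun ω => (U ω, fun i => W i ω)) P) (hU : ∫ ω, U ω ∂P = 0)
    (f : (ι → ℝ) → ℝ) (g : ι → (ι → ℝ) → ℝ)
    (hf : ∀ z d : ι → ℝ, ∀ t : ℝ, HasDerivAt (fun s : ℝ => f (z + s • d))
      (∑ j, d j * g j (z + t • d)) t)
    (hfc : Continuous f) (hg : ∀ j, Continuous (g j)) (C : ℝ) (hfb : ∀ z, |f z| ≤ C)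
    (hgb : ∀ j z, |g j z| ≤ C) :
    ∫ ω, U ω * f (fun i => W i ω) ∂P
      = ∑ j, cov[U, W j; P] * ∫ ω, g j (fun i => W i ω) ∂P := by
  have hP := h.isProbabilityMeasure
  have hUg : HasGaussianLaw U P := h.fst
  have hWg : HasGaussianLaw (fun ω i => W i ω) P := h.snd
  have hWi : ∀ i, HasGaussianLaw (W i) P := fun i => hWg.eval i
  set v : ℝ := Var[U; P] with hv
  have hlaw : P.map U = gaussianReal 0 v.toNNReal := by
    rw [hUg.map_eq_gaussianReal, hU]
  by_cases hv0 : v = 0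
  · have hU0 : ∀ᵐ ω ∂P, U ω = 0 := by
      filter_upwards [ae_eq_integral_of_variance_eq_zero hUg.memLp_two hv0] with ω h0
      rw [h0, hU]
    have hcov : ∀ j, cov[U, W j; P] = 0 := by
      intro j
      rw [covariance, integral_congr_ae (g := fun _ => 0)]
      · simp
      · filter_upwards [hU0] with ω h0
        simp [h0, hU]
    rw [integral_congr_ae (g := fun _ => 0)]
    · simp [hcov]
    · filter_upwards [hU0] with ω h0
      simp [h0]
  set a : ι → ℝ := fun j => cov[U, W j; P] / v with ha
  set W' : ι → Ω → ℝ := fun j ω => W j ω - a j * U ω with hW'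
  have hjoint : HasGaussianLaw (fun ω => (U ω, fun i => W' i ω)) P := by
    have := h.map ((ContinuousLinearMap.fst ℝ ℝ (ι → ℝ)).prod
      (ContinuousLinearMap.pi fun i =>
        (ContinuousLinearMap.proj i).comp (ContinuousLinearMap.snd ℝ ℝ (ι → ℝ))
          - a i • (ContinuousLinearMap.fst ℝ ℝ (ι → ℝ))))
    exact this
  have hind : IndepFun U (fun ω i => W' i ω) P := by
    have h1 : HasGaussianLaw (fun ω => (fun _ : Unit => U ω, fun i => W' i ω)) P := by
      have := hjoint.map (((ContinuousLinearMap.pi fun _ : Unit =>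
        (ContinuousLinearMap.fst ℝ ℝ (ι → ℝ)))).prod (ContinuousLinearMap.snd ℝ ℝ (ι → ℝ)))
      exact this
    have h2 := HasGaussianLaw.indepFun_of_covariance_eval (X := fun _ : Unit => U) (Y := W') h1 ?_
    · exact h2.comp (measurable_pi_apply ()) measurable_id
    · intro _ j
      have e : W' j = W j - (fun ω => a j * U ω) := rfl
      rw [e, covariance_sub_right hUg.memLp_two (hWi j).memLp_two (hUg.memLp_two.const_mul _),
        covariance_const_mul_right, covariance_self hUg.aemeasurable]
      simp only [ha]
      field_simp
      ring
  have hW'm : AEMeasurable (fun ω i => W' i ω) P := hjoint.snd.aemeasurable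
  have hprod := (indepFun_iff_map_prod_eq_prod_map_map hUg.aemeasurable hW'm).1 hind
  have hPU : IsProbabilityMeasure (P.map U) := Measure.isProbabilityMeasure_map hUg.aemeasurable
  have hPW : IsProbabilityMeasure (P.map (fun ω i => W' i ω)) :=
    Measure.isProbabilityMeasure_map hW'm
  have hWW : ∀ ω, (fun i => W i ω) = (fun i => W' i ω) + U ω • a := by
    intro ω; ext i; simp [hW']; ring
  have hC : 0 ≤ C := (abs_nonneg _).trans (hfb 0)
  have idU : Integrable (fun u : ℝ => u) (P.map U) := by
    rw [hlaw]
    exact (memLp_id_gaussianReal' (μ := 0) 1 (by simp)).integrable le_rfl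
  -- left side
  have hL : ∫ ω, U ω * f (fun i => W i ω) ∂P
      = ∫ w, (∫ u, u * f (w + u • a) ∂(P.map U)) ∂(P.map (fun ω i => W' i ω)) := by
    simp_rw [hWW]
    have hm : Continuous (fun q : ℝ × (ι → ℝ) => q.1 * f (q.2 + q.1 • a)) := by fun_prop
    rw [← integral_map (φ := fun ω => (U ω, fun i => W' i ω)) hjoint.aemeasurable
      (f := fun q : ℝ × (ι → ℝ) => q.1 * f (q.2 + q.1 • a)) hm.aestronglyMeasurable, hprod,
      integral_prod_symm]
    have : Integrable (fun q : ℝ × (ι → ℝ) => q.1) ((P.map U).prod (P.map (fun ω i => W' i ω))) :=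
      idU.comp_fst _
    refine this.mul_bdd (c := C) (by fun_prop) (Filter.Eventually.of_forall fun q => hfb _)
  have hR : ∀ j, ∫ ω, g j (fun i => W i ω) ∂P
      = ∫ w, (∫ u, g j (w + u • a) ∂(P.map U)) ∂(P.map (fun ω i => W' i ω)) := by
    intro j
    simp_rw [hWW]
    have hm : Continuous (fun q : ℝ × (ι → ℝ) => g j (q.2 + q.1 • a)) := by
      have := hg j
      fun_prop
    rw [← integral_map (φ := fun ω => (U ω, fun i => W' i ω)) hjoint.aemeasurable
      (f := fun q : ℝ × (ι → ℝ) => g j (q.2 + q.1 • a)) hm.aestronglyMeasurable, hprod,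
      integral_prod_symm]
    exact Integrable.of_bound hm.aestronglyMeasurable C (Filter.Eventually.of_forall fun q => hgb _ _)
  rw [hL]
  simp_rw [hR]
  have hinner : ∀ w, ∫ u, u * f (w + u • a) ∂(P.map U)
      = ∑ j, cov[U, W j; P] * ∫ u, g j (w + u • a) ∂(P.map U) := by
    intro w
    have hfa : ∀ u : ℝ, |∑ j, a j * g j (w + u • a)| ≤ C + ∑ j, |a j| * C := by
      intro u
      refine (Finset.abs_sum_le_sum_abs _ _).trans ?_
      have : ∑ j, |a j * g j (w + u • a)| ≤ ∑ j, |a j| * C := by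
        refine Finset.sum_le_sum fun j _ => ?_
        rw [abs_mul]
        exact mul_le_mul_of_nonneg_left (hgb _ _) (abs_nonneg _)
      linarith
    have hS : 0 ≤ ∑ j, |a j| * C :=
      Finset.sum_nonneg fun j _ => mul_nonneg (abs_nonneg _) hC
    have := mm_stein v.toNNReal (fun u => f (w + u • a)) (fun u => ∑ j, a j * g j (w + u • a))
      (fun u => hf w a u) (by fun_prop) (C + ∑ j, |a j| * C)
      (fun u => (hfb _).trans (by linarith)) hfa
    rw [← hlaw, Real.coe_toNNReal v (variance_nonneg _ _)] at this
    rw [this, integral_finsetSum, Finset.mul_sum]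
    · refine Finset.sum_congr rfl fun j _ => ?_
      rw [integral_const_mul, ha]
      field_simp
    · intro j _
      refine Integrable.const_mul ?_ _
      refine Integrable.of_bound ?_ C (Filter.Eventually.of_forall fun q => hgb _ _)
      have := hg j
      exact Continuous.aestronglyMeasurable (by fun_prop)
  simp_rw [hinner]
  rw [integral_finsetSum]
  · simp_rw [integral_const_mul]
  · intro j _
    refine Integrable.const_mul ?_ _
    have hm : Continuous (fun q : (ι → ℝ) × ℝ => g j (q.1 + q.2 • a)) := by
      have := hg j
      fun_prop
    refine Integrable.integral_prod_left (f := fun q : (ι → ℝ) × ℝ => g j (q.1 + q.2 • a)) ?_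
    exact Integrable.of_bound hm.aestronglyMeasurable C (Filter.Eventually.of_forall fun q => hgb _ _)

end MMPartA

section MMPartB

/-- Partition function. -/
noncomputable def mmS {ι : Type*} [Fintype ι] (β : ℝ) (z : ι → ℝ) : ℝ := ∑ i, Real.exp (β * z i)

/-- Soft maximum. -/
noncomputable def mmF {ι : Type*} [Fintype ι] (β : ℝ) (z : ι → ℝ) : ℝ := Real.log (mmS β z) / β

/-- Gibbs weights. -/
noncomputable def mmp {ι : Type*} [Fintype ι] (β : ℝ) (i : ι) (z : ι → ℝ) : ℝ :=
  Real.exp (β * z i) / mmS β z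

lemma mmS_pos {ι : Type*} [Fintype ι] [Nonempty ι] (β : ℝ) (z : ι → ℝ) : 0 < mmS β z :=
  Finset.sum_pos (fun _ _ => Real.exp_pos _) Finset.univ_nonempty

lemma mmp_nonneg {ι : Type*} [Fintype ι] [Nonempty ι] (β : ℝ) (i : ι) (z : ι → ℝ) :
    0 ≤ mmp β i z := div_nonneg (Real.exp_pos _).le (mmS_pos β z).le

lemma mmp_sum {ι : Type*} [Fintype ι] [Nonempty ι] (β : ℝ) (z : ι → ℝ) :
    ∑ i, mmp β i z = 1 := by
  unfold mmp
  rw [← Finset.sum_div]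
  exact div_self (mmS_pos β z).ne'

lemma mmp_le_one {ι : Type*} [Fintype ι] [Nonempty ι] (β : ℝ) (i : ι) (z : ι → ℝ) :
    mmp β i z ≤ 1 := by
  rw [← mmp_sum β z]
  exact Finset.single_le_sum (f := fun i => mmp β i z) (fun j _ => mmp_nonneg β j z)
    (Finset.mem_univ i)

lemma mmp_abs_le {ι : Type*} [Fintype ι] [Nonempty ι] (β : ℝ) (i : ι) (z : ι → ℝ) :
    |mmp β i z| ≤ 1 := by
  rw [abs_of_nonneg (mmp_nonneg β i z)]; exact mmp_le_one β i z

lemma mmS_cont {ι : Type*} [Fintype ι] (β : ℝ) : Continuous (mmS (ι := ι) β) := by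
  unfold mmS; fun_prop

lemma mmp_cont {ι : Type*} [Fintype ι] [Nonempty ι] (β : ℝ) (i : ι) : Continuous (mmp β i) := by
  unfold mmp
  exact Continuous.div (by fun_prop) (mmS_cont β) fun z => (mmS_pos β z).ne'

lemma mmF_cont {ι : Type*} [Fintype ι] [Nonempty ι] (β : ℝ) : Continuous (mmF (ι := ι) β) := by
  unfold mmF
  exact ((mmS_cont β).log fun z => (mmS_pos β z).ne').div_const _

lemma mmS_deriv {ι : Type*} [Fintype ι] (β : ℝ) (ζ : ℝ → ι → ℝ) (ζ' : ι → ℝ) (t : ℝ)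
    (h : ∀ i, HasDerivAt (fun s => ζ s i) (ζ' i) t) :
    HasDerivAt (fun s => mmS β (ζ s)) (∑ i, β * ζ' i * Real.exp (β * ζ t i)) t := by
  unfold mmS
  refine HasDerivAt.fun_sum fun i _ => ?_
  exact ((h i).const_mul β).exp.congr_deriv (by ring)

lemma mmF_deriv {ι : Type*} [Fintype ι] [Nonempty ι] {β : ℝ} (hβ : 0 < β) (ζ : ℝ → ι → ℝ)
    (ζ' : ι → ℝ) (t : ℝ) (h : ∀ i, HasDerivAt (fun s => ζ s i) (ζ' i) t) :
    HasDerivAt (fun s => mmF β (ζ s)) (∑ i, ζ' i * mmp β i (ζ t)) t := by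
  unfold mmF
  refine (((mmS_deriv β ζ ζ' t h).log (mmS_pos β _).ne').div_const β).congr_deriv ?_
  rw [Finset.sum_div, Finset.sum_div]
  refine Finset.sum_congr rfl fun i _ => ?_
  have := (mmS_pos β (ζ t)).ne'
  unfold mmp
  field_simp

open Classical in
lemma mmp_deriv {ι : Type*} [Fintype ι] [Nonempty ι] (β : ℝ) (i : ι) (ζ : ℝ → ι → ℝ)
    (ζ' : ι → ℝ) (t : ℝ) (h : ∀ i, HasDerivAt (fun s => ζ s i) (ζ' i) t) :
    HasDerivAt (fun s => mmp β i (ζ s))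
      (∑ j, ζ' j * (β * ((if i = j then mmp β i (ζ t) else 0) - mmp β i (ζ t) * mmp β j (ζ t)))) t
    := by
  have hS := (mmS_pos β (ζ t)).ne'
  have h1 := (((h i).const_mul β).exp).div (mmS_deriv β ζ ζ' t h) hS
  refine h1.congr_deriv ?_
  have e : ∑ j, ζ' j * (β * ((if i = j then mmp β i (ζ t) else 0) - mmp β i (ζ t) * mmp β j (ζ t)))
      = ζ' i * β * mmp β i (ζ t) - mmp β i (ζ t) * ∑ j, β * ζ' j * mmp β j (ζ t) := by
    rw [Finset.mul_sum]
    have : ∀ j, ζ' j * (β * ((if i = j then mmp β i (ζ t) else 0) - mmp β i (ζ t) * mmp β j (ζ t)))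
      = (if i = j then ζ' j * β * mmp β i (ζ t) else 0)
        - mmp β i (ζ t) * (β * ζ' j * mmp β j (ζ t)) := by
      intro j
      split_ifs <;> ring
    simp_rw [this]
    rw [Finset.sum_sub_distrib]
    simp
  rw [e]
  have e2 : ∑ j, β * ζ' j * mmp β j (ζ t) = (∑ j, β * ζ' j * Real.exp (β * ζ t j)) / mmS β (ζ t) := by
    rw [Finset.sum_div]
    refine Finset.sum_congr rfl fun j _ => ?_
    unfold mmp; ring
  rw [e2]
  unfold mmp
  field_simp

lemma mm_le_F {ι : Type*} [Fintype ι] [Nonempty ι] {β : ℝ} (hβ : 0 < β) (z : ι → ℝ) :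
    ⨆ i, z i ≤ mmF β z := by
  refine ciSup_le fun i => ?_
  unfold mmF
  rw [le_div_iff₀ hβ, Real.le_log_iff_exp_le (mmS_pos β z), mul_comm]
  exact Finset.single_le_sum (f := fun i => Real.exp (β * z i)) (fun j _ => (Real.exp_pos _).le)
    (Finset.mem_univ i)

lemma mm_F_le {ι : Type*} [Fintype ι] [Nonempty ι] {β : ℝ} (hβ : 0 < β) (z : ι → ℝ) :
    mmF β z ≤ (⨆ i, z i) + Real.log (Fintype.card ι) / β := by
  unfold mmF
  have hc : (0:ℝ) < Fintype.card ι := by exact_mod_cast Fintype.card_pos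
  rw [div_le_iff₀ hβ, add_mul, div_mul_cancel₀ _ hβ.ne', Real.log_le_iff_le_exp (mmS_pos β z),
    Real.exp_add, Real.exp_log hc, mul_comm]
  unfold mmS
  rw [← nsmul_eq_mul, ← Finset.card_univ]
  refine Finset.sum_le_card_nsmul _ _ _ fun i _ => ?_
  rw [Real.exp_le_exp, mul_comm]
  exact mul_le_mul_of_nonneg_right (le_ciSup (Set.finite_range z).bddAbove i) hβ.le

lemma mm_sup_abs {ι : Type*} [Fintype ι] [Nonempty ι] (z : ι → ℝ) : |⨆ i, z i| ≤ ∑ i, |z i| := by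
  obtain ⟨i, hi⟩ := exists_eq_ciSup_of_finite (f := z)
  rw [← hi]
  exact Finset.single_le_sum (f := fun i => |z i|) (fun j _ => abs_nonneg _) (Finset.mem_univ i)

lemma mm_integrable_sup {Ω ι : Type*} [Finite ι] {mΩ : MeasurableSpace Ω} {P : Measure Ω}
    (X : ι → Ω → ℝ) (hX : ∀ i, Integrable (X i) P) : Integrable (fun ω => ⨆ i, X i ω) P := by
  cases nonempty_fintype ι
  rcases isEmpty_or_nonempty ι with h | h
  · simp
  refine (integrable_finsetSum Finset.univ fun i _ => (hX i).abs).mono' ?_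
    (Filter.Eventually.of_forall fun ω => mm_sup_abs _)
  exact (AEMeasurable.iSup fun i => (hX i).aemeasurable).aestronglyMeasurable

lemma mm_integrable_F {Ω ι : Type*} [Fintype ι] [Nonempty ι] {mΩ : MeasurableSpace Ω}
    {P : Measure Ω} [IsFiniteMeasure P] {β : ℝ} (hβ : 0 < β)
    (X : ι → Ω → ℝ) (hX : ∀ i, Integrable (X i) P) :
    Integrable (fun ω => mmF β (fun i => X i ω)) P := by
  have h1 := mm_integrable_sup X hX
  refine (h1.abs.add (integrable_const |Real.log (Fintype.card ι) / β|)).mono' ?_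
    (Filter.Eventually.of_forall fun ω => ?_)
  · exact ((mmF_cont β).measurable.comp_aemeasurable
      (aemeasurable_pi_lambda _ fun i => (hX i).aemeasurable)).aestronglyMeasurable
  · have a1 := mm_le_F hβ (fun i => X i ω)
    have a2 := mm_F_le hβ (fun i => X i ω)
    simp only [Pi.add_apply, Real.norm_eq_abs]
    rw [abs_le]
    constructor
    · have := neg_abs_le (⨆ i, X i ω)
      have := abs_nonneg (Real.log (Fintype.card ι) / β)
      linarith
    · have := le_abs_self (⨆ i, X i ω)
      have := le_abs_self (Real.log (Fintype.card ι) / β)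
      linarith

/-- the algebraic positivity behind Sudakov–Fernique -/
lemma mm_alg {ι : Type*} [Fintype ι] [DecidableEq ι] (p : ι → ℝ) (hp : ∀ i, 0 ≤ p i)
    (hs : ∑ i, p i = 1)
    (D : ι → ι → ℝ) (hD : ∀ i j, 0 ≤ D i i + D j j - 2 * D i j) :
    0 ≤ ∑ i, ∑ j, D i j * ((if i = j then p i else 0) - p i * p j) := by
  have e1 : ∑ i, ∑ j, D i j * ((if i = j then p i else 0) - p i * p j)
      = ∑ i, D i i * p i - ∑ i, ∑ j, D i j * p i * p j := by
    rw [← Finset.sum_sub_distrib]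
    refine Finset.sum_congr rfl fun i _ => ?_
    simp only [mul_sub, Finset.sum_sub_distrib, mul_ite, mul_zero, Finset.sum_ite_eq,
      Finset.mem_univ, if_true]
    congr 1
    exact Finset.sum_congr rfl fun j _ => by ring
  have e2 : ∑ i, ∑ j, D i i * p i * p j = ∑ i, D i i * p i := by
    simp_rw [← Finset.mul_sum, hs, mul_one]
  have e3 : ∑ i, ∑ j, D j j * p i * p j = ∑ i, D i i * p i := by
    rw [Finset.sum_comm]
    rw [← e2]
    exact Finset.sum_congr rfl fun i _ => Finset.sum_congr rfl fun j _ => by ring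
  have e4 : 0 ≤ ∑ i, ∑ j, (D i i + D j j - 2 * D i j) * p i * p j :=
    Finset.sum_nonneg fun i _ => Finset.sum_nonneg fun j _ =>
      mul_nonneg (mul_nonneg (hD i j) (hp i)) (hp j)
  have e5 : ∑ i, ∑ j, (D i i + D j j - 2 * D i j) * p i * p j
      = ∑ i, ∑ j, D i i * p i * p j + ∑ i, ∑ j, D j j * p i * p j
        - 2 * ∑ i, ∑ j, D i j * p i * p j := by
    rw [Finset.mul_sum, ← Finset.sum_add_distrib, ← Finset.sum_sub_distrib]
    refine Finset.sum_congr rfl fun i _ => ?_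
    rw [Finset.mul_sum, ← Finset.sum_add_distrib, ← Finset.sum_sub_distrib]
    exact Finset.sum_congr rfl fun j _ => by ring
  rw [e1]
  linarith

end MMPartB

section MMPartC

open Classical in
lemma mm_sf_same {Ω ι : Type*} [Fintype ι] [Nonempty ι] {mΩ : MeasurableSpace Ω}
    {P : Measure Ω} (X Y : ι → Ω → ℝ)
    (h : HasGaussianLaw (fun ω => (fun i => X i ω, fun i => Y i ω)) P)
    (hX0 : ∀ i, ∫ ω, X i ω ∂P = 0) (hY0 : ∀ i, ∫ ω, Y i ω ∂P = 0)
    (hcov : ∀ i j, cov[X i, Y j; P] = 0)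
    (hd : ∀ i j, cov[X i, X i; P] + cov[X j, X j; P] - 2 * cov[X i, X j; P]
      ≤ cov[Y i, Y i; P] + cov[Y j, Y j; P] - 2 * cov[Y i, Y j; P]) :
    ∫ ω, ⨆ i, X i ω ∂P ≤ ∫ ω, ⨆ i, Y i ω ∂P := by
  have hP := h.isProbabilityMeasure
  have hXg : ∀ i, HasGaussianLaw (X i) P := fun i => h.fst.eval i
  have hYg : ∀ i, HasGaussianLaw (Y i) P := fun i => h.snd.eval i
  have hXi : ∀ i, Integrable (X i) P := fun i => (hXg i).integrable
  have hYi : ∀ i, Integrable (Y i) P := fun i => (hYg i).integrable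
  have hX2 : ∀ i, MemLp (X i) 2 P := fun i => (hXg i).memLp_two
  have hY2 : ∀ i, MemLp (Y i) 2 P := fun i => (hYg i).memLp_two
  -- main step : smooth version
  have main : ∀ β : ℝ, 0 < β → ∫ ω, mmF β (fun i => X i ω) ∂P ≤ ∫ ω, mmF β (fun i => Y i ω) ∂P := by
    intro β hβ
    set Z : ℝ → ι → Ω → ℝ := fun θ i ω => Real.cos θ * X i ω + Real.sin θ * Y i ω with hZ
    set Z' : ℝ → ι → Ω → ℝ := fun θ i ω => -Real.sin θ * X i ω + Real.cos θ * Y i ω with hZ'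
    have hZi : ∀ θ i, Integrable (Z θ i) P := fun θ i =>
      ((hXi i).const_mul _).add ((hYi i).const_mul _)
    have hZi' : ∀ θ i, Integrable (Z' θ i) P := fun θ i =>
      ((hXi i).const_mul _).add ((hYi i).const_mul _)
    have hZm : ∀ θ, AEMeasurable (fun ω i => Z θ i ω) P := fun θ =>
      aemeasurable_pi_lambda _ fun i => (hZi θ i).aemeasurable
    have hder : ∀ θ, HasDerivAt (fun θ => ∫ ω, mmF β (fun i => Z θ i ω) ∂P)
        (∫ ω, ∑ i, Z' θ i ω * mmp β i (fun i => Z θ i ω) ∂P) θ := by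
      intro θ
      have := hasDerivAt_integral_of_dominated_loc_of_deriv_le (μ := P)
        (F := fun θ ω => mmF β (fun i => Z θ i ω))
        (F' := fun θ ω => ∑ i, Z' θ i ω * mmp β i (fun i => Z θ i ω))
        (x₀ := θ) (s := univ) (bound := fun ω => ∑ i, (|X i ω| + |Y i ω|)) Filter.univ_mem
        (Filter.Eventually.of_forall fun θ => (mm_integrable_F hβ _ (hZi θ)).aestronglyMeasurable)
        (mm_integrable_F hβ _ (hZi θ)) ?_ ?_ ?_ ?_
      · exact this.2
      · refine AEMeasurable.aestronglyMeasurable ?_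
        refine Finset.aemeasurable_fun_sum _ fun i _ => ?_
        exact (hZi' θ i).aemeasurable.mul ((mmp_cont β i).measurable.comp_aemeasurable (hZm θ))
      · refine Filter.Eventually.of_forall fun ω θ _ => ?_
        rw [Real.norm_eq_abs]
        refine (Finset.abs_sum_le_sum_abs _ _).trans (Finset.sum_le_sum fun i _ => ?_)
        rw [abs_mul]
        refine (mul_le_of_le_one_right (abs_nonneg _) (mmp_abs_le β i _)).trans ?_
        refine (abs_add_le _ _).trans ?_
        rw [abs_mul, abs_mul, abs_neg]
        exact add_le_add (mul_le_of_le_one_left (abs_nonneg _) (Real.abs_sin_le_one _))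
          (mul_le_of_le_one_left (abs_nonneg _) (Real.abs_cos_le_one _))
      · exact integrable_finsetSum _ fun i _ => (hXi i).abs.add (hYi i).abs
      · refine Filter.Eventually.of_forall fun ω θ _ => ?_
        refine mmF_deriv hβ (fun θ i => Z θ i ω) (fun i => Z' θ i ω) θ fun i => ?_
        exact ((Real.hasDerivAt_cos θ).mul_const _).add ((Real.hasDerivAt_sin θ).mul_const _)
    have hnn : ∀ θ ∈ Icc (0:ℝ) (Real.pi / 2),
        0 ≤ ∫ ω, ∑ i, Z' θ i ω * mmp β i (fun i => Z θ i ω) ∂P := by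
      intro θ hθ
      set D : ι → ι → ℝ := fun i j => cov[Y i, Y j; P] - cov[X i, X j; P] with hD
      have hc : ∀ i j, cov[Z' θ i, Z θ j; P] = Real.sin θ * Real.cos θ * D i j := by
        intro i j
        have e1 : Z' θ i = (fun ω => -Real.sin θ * X i ω) + (fun ω => Real.cos θ * Y i ω) := rfl
        have e2 : Z θ j = (fun ω => Real.cos θ * X j ω) + (fun ω => Real.sin θ * Y j ω) := rfl
        rw [e1, e2, covariance_add_left ((hX2 i).const_mul _) ((hY2 i).const_mul _)
          (((hX2 j).const_mul _).add ((hY2 j).const_mul _)),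
          covariance_add_right ((hX2 i).const_mul _) ((hX2 j).const_mul _) ((hY2 j).const_mul _),
          covariance_add_right ((hY2 i).const_mul _) ((hX2 j).const_mul _) ((hY2 j).const_mul _)]
        simp only [covariance_const_mul_left, covariance_const_mul_right, hcov,
          covariance_comm (Y i) (X j), hD]
        ring
      have hib : ∀ i, ∫ ω, Z' θ i ω * mmp β i (fun i => Z θ i ω) ∂P
          = ∑ j, cov[Z' θ i, Z θ j; P] * ∫ ω, β * ((if i = j then mmp β i (fun i => Z θ i ω) else 0)
            - mmp β i (fun i => Z θ i ω) * mmp β j (fun i => Z θ i ω)) ∂P := by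
        intro i
        refine mm_ibp (Z' θ i) (Z θ) ?_ ?_ (mmp β i)
          (fun j z => β * ((if i = j then mmp β i z else 0) - mmp β i z * mmp β j z))
          ?_ (mmp_cont β i) ?_ (1 + 2 * β) ?_ ?_
        · have := h.map
            (((-Real.sin θ) • (ContinuousLinearMap.proj i).comp
                (ContinuousLinearMap.fst ℝ (ι → ℝ) (ι → ℝ))
              + Real.cos θ • (ContinuousLinearMap.proj i).comp
                (ContinuousLinearMap.snd ℝ (ι → ℝ) (ι → ℝ))).prod
              (Real.cos θ • (ContinuousLinearMap.fst ℝ (ι → ℝ) (ι → ℝ))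
              + Real.sin θ • (ContinuousLinearMap.snd ℝ (ι → ℝ) (ι → ℝ))))
          exact this
        · rw [integral_add ((hXi i).const_mul _) ((hYi i).const_mul _), integral_const_mul,
            integral_const_mul, hX0, hY0]
          simp
        · intro z d t
          refine mmp_deriv β i (fun s => z + s • d) d t fun j => ?_
          simp only [Pi.add_apply, Pi.smul_apply, smul_eq_mul]
          exact (((hasDerivAt_id t).mul_const (d j)).const_add (z j)).congr_deriv (by simp)
        · intro j
          have := mmp_cont β i
          have := mmp_cont β j
          by_cases hij : i = j
          · simp only [hij, if_true]; fun_prop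
          · simp only [hij, if_false]; fun_prop
        · intro z
          have := mmp_abs_le β i z
          linarith
        · intro j z
          have a1 := mmp_nonneg β i z
          have a2 := mmp_le_one β i z
          have a3 := mmp_nonneg β j z
          have a4 := mmp_le_one β j z
          have a5 : mmp β i z * mmp β j z ≤ 1 := mul_le_one₀ a2 a3 a4
          have a6 := mul_nonneg a1 a3
          rw [abs_mul, abs_of_pos hβ]
          have : |(if i = j then mmp β i z else 0) - mmp β i z * mmp β j z| ≤ 2 := by
            rw [abs_le]; split_ifs <;> constructor <;> linarith
          nlinarith
      have hIntg : ∀ i j, Integrable (fun ω => (β * ((if i = j then mmp β i (fun i => Z θ i ω) else 0)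
            - mmp β i (fun i => Z θ i ω) * mmp β j (fun i => Z θ i ω)))) P := by
        intro i j
        have hi : ∀ i, Integrable (fun ω => mmp β i (fun i => Z θ i ω)) P := fun i =>
          Integrable.of_bound ((mmp_cont β i).measurable.comp_aemeasurable
            (hZm θ)).aestronglyMeasurable 1 (Filter.Eventually.of_forall fun ω => mmp_abs_le β i _)
        refine Integrable.const_mul (Integrable.sub ?_ ?_) _
        · by_cases hij : i = j
          · simpa [hij] using hi j
          · simp [hij]
        · exact (hi i).mul_bdd (c := 1) (hi j).aestronglyMeasurable
            (Filter.Eventually.of_forall fun ω => mmp_abs_le β j _)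
      rw [integral_finsetSum]
      · simp_rw [hib, hc, ← integral_const_mul]
        simp_rw [← integral_finsetSum _ fun j _ => (hIntg _ j).const_mul _]
        rw [← integral_finsetSum _ fun i _ => integrable_finsetSum _ fun j _ =>
          (hIntg i j).const_mul _]
        refine integral_nonneg fun ω => ?_
        have ha := mm_alg (fun i => mmp β i (fun i => Z θ i ω)) (fun i => mmp_nonneg β i _)
          (mmp_sum β _) D (by intro i j; simp only [hD]; linarith [hd i j])
        have hsc : 0 ≤ Real.sin θ * Real.cos θ * β := by
          refine mul_nonneg (mul_nonneg ?_ ?_) hβ.le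
          · exact Real.sin_nonneg_of_nonneg_of_le_pi hθ.1 (by linarith [hθ.2, Real.pi_pos])
          · exact Real.cos_nonneg_of_neg_pi_div_two_le_of_le (by linarith [hθ.1, Real.pi_pos]) hθ.2
        have hb := mul_nonneg hsc ha
        simp only [Pi.zero_apply]
        refine hb.trans_eq ?_
        rw [Finset.mul_sum]
        refine Finset.sum_congr rfl fun i _ => ?_
        rw [Finset.mul_sum]
        exact Finset.sum_congr rfl fun j _ => by ring
      · intro i _
        exact (hZi' θ i).mul_bdd (c := 1) ((mmp_cont β i).measurable.comp_aemeasurable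
            (hZm θ)).aestronglyMeasurable (Filter.Eventually.of_forall fun ω => mmp_abs_le β i _)
    have hmono : MonotoneOn (fun θ => ∫ ω, mmF β (fun i => Z θ i ω) ∂P) (Icc 0 (Real.pi / 2)) := by
      refine monotoneOn_of_hasDerivWithinAt_nonneg (convex_Icc _ _) 
        (fun θ _ => (hder θ).continuousAt.continuousWithinAt)
        (fun θ _ => (hder θ).hasDerivWithinAt) fun θ hθ => hnn θ (interior_subset hθ)
    have hpi : (0:ℝ) ≤ Real.pi / 2 := by positivity
    have := hmono (left_mem_Icc.2 hpi) (right_mem_Icc.2 hpi) hpi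
    simpa [hZ] using this
  refine le_of_forall_pos_le_add fun ε hε => ?_
  have hc : (1:ℝ) ≤ Fintype.card ι := by exact_mod_cast Fintype.card_pos
  have hlog := Real.log_nonneg hc
  set β : ℝ := (Real.log (Fintype.card ι) + 1) / ε with hβd
  have hβ : 0 < β := by positivity
  have h1 : ∫ ω, ⨆ i, X i ω ∂P ≤ ∫ ω, mmF β (fun i => X i ω) ∂P :=
    integral_mono (mm_integrable_sup X hXi) (mm_integrable_F hβ X hXi) fun ω => mm_le_F hβ _
  have h2 : ∫ ω, mmF β (fun i => Y i ω) ∂P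
      ≤ ∫ ω, ((⨆ i, Y i ω) + Real.log (Fintype.card ι) / β) ∂P :=
    integral_mono (mm_integrable_F hβ Y hYi) ((mm_integrable_sup Y hYi).add (integrable_const _))
      fun ω => mm_F_le hβ _
  rw [integral_add (mm_integrable_sup Y hYi) (integrable_const _)] at h2
  simp only [integral_const, probReal_univ, smul_eq_mul, one_mul] at h2
  have h3 : Real.log (Fintype.card ι) / β ≤ ε := by
    rw [div_le_iff₀ hβ, hβd, mul_div_cancel₀ _ hε.ne']
    linarith
  linarith [main β hβ]

end MMPartC

section MMPartD

/-- L2 norm of a random variable. -/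
noncomputable def mmn {Ω : Type*} {mΩ : MeasurableSpace Ω} (P : Measure Ω) (U : Ω → ℝ) : ℝ :=
  Real.sqrt (∫ ω, (U ω) ^ 2 ∂P)

lemma mmn_nonneg {Ω : Type*} {mΩ : MeasurableSpace Ω} (P : Measure Ω) (U : Ω → ℝ) : 0 ≤ mmn P U :=
  Real.sqrt_nonneg _

lemma mmn_sq {Ω : Type*} {mΩ : MeasurableSpace Ω} (P : Measure Ω) (U : Ω → ℝ) :
    (mmn P U) ^ 2 = ∫ ω, (U ω) ^ 2 ∂P :=
  Real.sq_sqrt (integral_nonneg fun _ => sq_nonneg _)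

lemma mmn_eq {Ω : Type*} {mΩ : MeasurableSpace Ω} {P : Measure Ω} {U : Ω → ℝ} (hU : MemLp U 2 P) :
    eLpNorm U 2 P = ENNReal.ofReal (mmn P U) := by
  rw [hU.eLpNorm_eq_integral_rpow_norm (by simp) (by simp)]
  unfold mmn
  rw [Real.sqrt_eq_rpow]
  simp

lemma mmn_add_le {Ω : Type*} {mΩ : MeasurableSpace Ω} {P : Measure Ω} {U V : Ω → ℝ}
    (hU : MemLp U 2 P) (hV : MemLp V 2 P) :
    mmn P (fun ω => U ω + V ω) ≤ mmn P U + mmn P V := by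
  have h := eLpNorm_add_le hU.aestronglyMeasurable hV.aestronglyMeasurable
    (p := 2) (by norm_num)
  rw [mmn_eq hU, mmn_eq hV, mmn_eq (hU.add hV),
    ← ENNReal.ofReal_add (mmn_nonneg _ _) (mmn_nonneg _ _), 
    ENNReal.ofReal_le_ofReal_iff (add_nonneg (mmn_nonneg _ _) (mmn_nonneg _ _))] at h
  exact h

lemma mmn_sub_comm {Ω : Type*} {mΩ : MeasurableSpace Ω} {P : Measure Ω} (U V : Ω → ℝ) :
    mmn P (fun ω => U ω - V ω) = mmn P (fun ω => V ω - U ω) := by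
  unfold mmn
  congr 2
  ext ω; ring

lemma mmn_tri {Ω : Type*} {mΩ : MeasurableSpace Ω} {P : Measure Ω} {U V W : Ω → ℝ}
    (hU : MemLp U 2 P) (hV : MemLp V 2 P) (hW : MemLp W 2 P) :
    mmn P (fun ω => U ω - W ω) ≤ mmn P (fun ω => U ω - V ω) + mmn P (fun ω => V ω - W ω) := by
  have := mmn_add_le (U := fun ω => U ω - V ω) (V := fun ω => V ω - W ω) (hU.sub hV) (hV.sub hW)
  simpa using this

lemma mm_mp_int {Ω Ω' : Type*} {mΩ : MeasurableSpace Ω} {mΩ' : MeasurableSpace Ω'} {P : Measure Ω}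
    {P' : Measure Ω'} {f : Ω → Ω'} (hf : MeasurePreserving f P P') {g : Ω' → ℝ}
    (hg : AEStronglyMeasurable g P') : ∫ ω, g (f ω) ∂P = ∫ ω, g ω ∂P' := by
  have hg' := hg
  rw [← hf.map_eq] at hg' ⊢
  rw [integral_map hf.aemeasurable hg']

lemma mm_mp_gauss {Ω Ω' E : Type*} {mΩ : MeasurableSpace Ω} {mΩ' : MeasurableSpace Ω'}
    {P : Measure Ω} {P' : Measure Ω'} {f : Ω → Ω'} (hf : MeasurePreserving f P P')
    [NormedAddCommGroup E] [NormedSpace ℝ E] [MeasurableSpace E] [BorelSpace E]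
    {X : Ω' → E} (hX : HasGaussianLaw X P') : HasGaussianLaw (fun ω => X (f ω)) P := by
  constructor
  have h1 := hX.aemeasurable
  have h2 := hX.isGaussian_map
  rw [← hf.map_eq] at h1 h2
  rw [AEMeasurable.map_map_of_aemeasurable h1 hf.aemeasurable] at h2
  exact h2

lemma mm_cov_sq {Ω : Type*} {mΩ : MeasurableSpace Ω} {P : Measure Ω} [IsProbabilityMeasure P]
    {U V : Ω → ℝ} (hU : MemLp U 2 P) (hV : MemLp V 2 P) (hU0 : ∫ ω, U ω ∂P = 0)
    (hV0 : ∫ ω, V ω ∂P = 0) :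
    ∫ ω, (U ω - V ω) ^ 2 ∂P = cov[U, U; P] + cov[V, V; P] - 2 * cov[U, V; P] := by
  rw [covariance_eq_sub hU hU, covariance_eq_sub hV hV, covariance_eq_sub hU hV, hU0, hV0]
  have e : ∀ ω, (U ω - V ω) ^ 2 = (U * U) ω + (V * V) ω - 2 * (U * V) ω := by
    intro ω; simp only [Pi.mul_apply]; ring
  simp_rw [e]
  rw [integral_sub, integral_add, integral_const_mul]
  · ring
  · exact hU.integrable_mul hU
  · exact hV.integrable_mul hV
  · exact (hU.integrable_mul hU).add (hV.integrable_mul hV)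
  · exact (hU.integrable_mul hV).const_mul 2

/-- Sudakov–Fernique inequality. -/
lemma mm_sf {Ω Ω' ι : Type*} [Fintype ι] [Nonempty ι] {mΩ : MeasurableSpace Ω}
    {mΩ' : MeasurableSpace Ω'} {P : Measure Ω} {P' : Measure Ω'} (X : ι → Ω → ℝ) (Y : ι → Ω' → ℝ)
    (hX : HasGaussianLaw (fun ω i => X i ω) P) (hY : HasGaussianLaw (fun ω i => Y i ω) P')
    (hX0 : ∀ i, ∫ ω, X i ω ∂P = 0) (hY0 : ∀ i, ∫ ω, Y i ω ∂P' = 0)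
    (hd : ∀ i j, mmn P (fun ω => X i ω - X j ω) ≤ mmn P' (fun ω => Y i ω - Y j ω)) :
    ∫ ω, ⨆ i, X i ω ∂P ≤ ∫ ω, ⨆ i, Y i ω ∂P' := by
  have hP := hX.isProbabilityMeasure
  have hP' := hY.isProbabilityMeasure
  have hXg : ∀ i, HasGaussianLaw (X i) P := fun i => hX.eval i
  have hYg : ∀ i, HasGaussianLaw (Y i) P' := fun i => hY.eval i
  have m1 : MeasurePreserving (Prod.fst : Ω × Ω' → Ω) (P.prod P') P := measurePreserving_fst
  have m2 : MeasurePreserving (Prod.snd : Ω × Ω' → Ω') (P.prod P') P' := measurePreserving_snd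
  have gX := mm_mp_gauss m1 hX
  have gY := mm_mp_gauss m2 hY
  have hind := indepFun_prod₀ (μ := P) (ν := P') hX.aemeasurable hY.aemeasurable
  have hj := hind.hasGaussianLaw gX gY
  have gX2 : ∀ i, MemLp (fun q : Ω × Ω' => X i q.1) 2 (P.prod P') := fun i => (gX.eval i).memLp_two
  have gY2 : ∀ i, MemLp (fun q : Ω × Ω' => Y i q.2) 2 (P.prod P') := fun i => (gY.eval i).memLp_two
  have zX : ∀ i, ∫ q, X i q.1 ∂(P.prod P') = 0 := fun i => by
    rw [mm_mp_int m1 (hXg i).integrable.aestronglyMeasurable, hX0]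
  have zY : ∀ i, ∫ q, Y i q.2 ∂(P.prod P') = 0 := fun i => by
    rw [mm_mp_int m2 (hYg i).integrable.aestronglyMeasurable, hY0]
  have key := mm_sf_same (fun i (q : Ω × Ω') => X i q.1) (fun i (q : Ω × Ω') => Y i q.2) hj zX zY ?_ ?_
  · rw [mm_mp_int m1 (g := fun ω => ⨆ i, X i ω)
      (mm_integrable_sup X fun i => (hXg i).integrable).aestronglyMeasurable,
      mm_mp_int m2 (g := fun ω => ⨆ i, Y i ω)
      (mm_integrable_sup Y fun i => (hYg i).integrable).aestronglyMeasurable] at key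
    exact key
  · intro i j
    exact (hind.comp (measurable_pi_apply i) (measurable_pi_apply j)).covariance_eq_zero
      (gX2 i) (gY2 j)
  · intro i j
    rw [← mm_cov_sq (gX2 i) (gX2 j) (zX i) (zX j), ← mm_cov_sq (gY2 i) (gY2 j) (zY i) (zY j),
      mm_mp_int m1 (g := fun ω => (X i ω - X j ω) ^ 2)
        (((hXg i).integrable.aestronglyMeasurable.sub
          (hXg j).integrable.aestronglyMeasurable).pow 2),
      mm_mp_int m2 (g := fun ω => (Y i ω - Y j ω) ^ 2)
        (((hYg i).integrable.aestronglyMeasurable.sub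
          (hYg j).integrable.aestronglyMeasurable).pow 2)]
    rw [← mmn_sq P (fun ω => X i ω - X j ω), ← mmn_sq P' (fun ω => Y i ω - Y j ω)]
    exact pow_le_pow_left₀ (mmn_nonneg _ _) (hd i j) 2

/-- first absolute moment of a standard Gaussian -/
noncomputable def mmk : ℝ := ∫ x, |x| ∂(gaussianReal 0 1)

lemma mmk_pos : 0 < mmk := by
  unfold mmk
  have hi : Integrable (fun x : ℝ => |x|) (gaussianReal 0 1) :=
    ((memLp_id_gaussianReal' (μ := 0) (v := 1) 1 (by simp)).integrable le_rfl).abs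
  refine lt_of_le_of_ne (integral_nonneg fun _ => abs_nonneg _) fun h0 => ?_
  have h1 := (integral_eq_zero_iff_of_nonneg (fun _ => abs_nonneg _) hi).1 h0.symm
  have h2 : Var[fun x => x; gaussianReal 0 1] = ((1 : ℝ≥0) : ℝ) := variance_fun_id_gaussianReal
  have h3 : (fun x : ℝ => x) =ᵐ[gaussianReal 0 1] fun _ => 0 := by
    filter_upwards [h1] with x hx
    simpa using hx
  rw [variance_congr h3] at h2
  simp [variance_eq_integral measurable_const.aemeasurable] at h2

/-- Gaussian width of a set -/
noncomputable def mmG {Ω ι : Type*} {mΩ : MeasurableSpace Ω} (P : Measure Ω) (X : ι → Ω → ℝ)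
    (A : Set ι) : ℝ := ∫ ω, ⨆ y : A, X y ω ∂P

lemma mmG_mono {Ω ι : Type*} [Finite ι] {mΩ : MeasurableSpace Ω} {P : Measure Ω} {X : ι → Ω → ℝ}
    (hX : ∀ i, Integrable (X i) P) {A B : Set ι} (hA : A.Nonempty) (hAB : A ⊆ B) :
    mmG P X A ≤ mmG P X B := by
  refine integral_mono (mm_integrable_sup (fun y : A => X y) fun y => hX y)
    (mm_integrable_sup (fun y : B => X y) fun y => hX y) fun ω => ?_
  have := hA.to_subtype
  refine ciSup_le fun y => ?_
  exact le_ciSup (f := fun y : B => X y ω) (Set.finite_range _).bddAbove ⟨y, hAB y.2⟩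

lemma mmG_nonneg {Ω ι : Type*} [Finite ι] {mΩ : MeasurableSpace Ω} {P : Measure Ω} {X : ι → Ω → ℝ}
    (hX : ∀ i, Integrable (X i) P) (hX0 : ∀ i, ∫ ω, X i ω ∂P = 0) {A : Set ι} (hA : A.Nonempty) :
    0 ≤ mmG P X A := by
  obtain ⟨y, hy⟩ := hA
  rw [← hX0 y]
  refine integral_mono (hX y) (mm_integrable_sup (fun y : A => X y) fun y => hX y) fun ω => ?_
  exact le_ciSup (f := fun y : A => X y ω) (Set.finite_range _).bddAbove ⟨y, hy⟩

end MMPartD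

section MMPartE

lemma mmn_mp {Ω Ω' : Type*} {mΩ : MeasurableSpace Ω} {mΩ' : MeasurableSpace Ω'} {P : Measure Ω}
    {P' : Measure Ω'} {f : Ω → Ω'} (hf : MeasurePreserving f P P') {g : Ω' → ℝ}
    (hg : AEStronglyMeasurable g P') : mmn P (fun ω => g (f ω)) = mmn P' g := by
  unfold mmn
  rw [mm_mp_int hf (g := fun ω => g ω ^ 2) (hg.pow 2)]

lemma mm_gauss_id : HasGaussianLaw (fun x : ℝ => x) (gaussianReal 0 1) :=
  IsGaussian.hasGaussianLaw_id

lemma mm_std_gauss (k : ℕ) : HasGaussianLaw (fun h : Fin k → ℝ => h)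
    (Measure.pi fun _ : Fin k => gaussianReal 0 1) := by
  have h1 : ∀ l, HasGaussianLaw (fun h : Fin k → ℝ => h l)
      (Measure.pi fun _ : Fin k => gaussianReal 0 1) := fun l =>
    mm_mp_gauss (measurePreserving_eval (fun _ : Fin k => gaussianReal 0 1) l) mm_gauss_id
  have h2 : iIndepFun (fun (l : Fin k) (h : Fin k → ℝ) => h l)
      (Measure.pi fun _ : Fin k => gaussianReal 0 1) :=
    iIndepFun_pi (X := fun _ x => x) fun _ => aemeasurable_id
  exact h2.hasGaussianLaw h1

lemma mm_std_zero (k : ℕ) (l : Fin k) :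
    ∫ h, h l ∂(Measure.pi fun _ : Fin k => gaussianReal 0 1) = 0 := by
  rw [mm_mp_int (measurePreserving_eval (fun _ : Fin k => gaussianReal 0 1) l)
    (g := fun x => x) (by fun_prop)]
  simp

lemma mm_std_sq (k : ℕ) (a : Fin k → ℝ) :
    ∫ h, (∑ l, a l * h l) ^ 2 ∂(Measure.pi fun _ : Fin k => gaussianReal 0 1) = ∑ l, a l ^ 2 := by
  have h0 : ∫ h, (∑ l, a l * h l) ∂(Measure.pi fun _ : Fin k => gaussianReal 0 1) = 0 := by
    rw [integral_finsetSum]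
    · simp_rw [integral_const_mul, mm_std_zero]; simp
    · intro l _
      exact ((mm_std_gauss k).eval l).integrable.const_mul _
  have h1 := variance_sum_pi (μ := fun _ : Fin k => gaussianReal 0 1) (X := fun l x => a l * x)
    (fun l => mm_gauss_id.memLp_two.const_mul _)
  have e : (∑ i, fun ω : Fin k → ℝ => a i * ω i) = fun ω => ∑ i, a i * ω i := by
    ext ω; simp
  rw [e, variance_of_integral_eq_zero (Continuous.aemeasurable (by fun_prop)) h0] at h1
  rw [h1]
  refine Finset.sum_congr rfl fun l _ => ?_
  rw [variance_const_mul, variance_fun_id_gaussianReal]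
  simp

/-- sign of a boolean -/
def mms (b : Bool) : ℝ := if b then 1 else -1

lemma mm_growth {Ω ι : Type*} [Fintype ι] {mΩ : MeasurableSpace Ω} {P : Measure Ω}
    (X : ι → Ω → ℝ) (hX : HasGaussianLaw (fun ω i => X i ω) P) (hX0 : ∀ i, ∫ ω, X i ω ∂P = 0)
    (k : ℕ) (hk : 0 < k) (x : (Fin k → Bool) → ι) (A : (Fin k → Bool) → Set ι)
    (hA : ∀ e, (A e).Nonempty) (σ : ℝ) (hσ : 0 ≤ σ)
    (hsep : ∀ e e', e ≠ e' → σ ≤ mmn P (fun ω => X (x e) ω - X (x e') ω))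
    (hball : ∀ e, ∀ y ∈ A e, mmn P (fun ω => X y ω - X (x e) ω) ≤ σ / 8)
    (G' : ℝ) (hG : ∀ e, G' ≤ mmG P X (A e)) (B : Set ι) (hB : ∀ e, A e ⊆ B) :
    G' + σ / 4 * Real.sqrt k * mmk ≤ mmG P X B := by
  classical
  have hP := hX.isProbabilityMeasure
  have hXg : ∀ i, HasGaussianLaw (X i) P := fun i => hX.eval i
  have hXi : ∀ i, Integrable (X i) P := fun i => (hXg i).integrable
  have hX2 : ∀ i, MemLp (X i) 2 P := fun i => (hXg i).memLp_two
  have hXm : ∀ i, AEStronglyMeasurable (X i) P := fun i => (hXi i).aestronglyMeasurable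
  have hk' : (0:ℝ) < Real.sqrt k := Real.sqrt_pos.2 (by exact_mod_cast hk)
  have hkk : Real.sqrt k * Real.sqrt k = k := Real.mul_self_sqrt (by positivity)
  set c : ℝ := σ / (4 * Real.sqrt k) with hc
  have hc0 : 0 ≤ c := by positivity
  let P1 : Measure ((Fin k → Bool) → Ω) := Measure.pi fun _ => P
  let P2 : Measure (Fin k → ℝ) := Measure.pi fun _ => gaussianReal 0 1
  let J := {q : (Fin k → Bool) × ι // q.2 ∈ A q.1}
  letI : Fintype J := Fintype.ofFinite J
  haveI : Nonempty J := ⟨⟨(fun _ => true, (hA _).some), (hA _).some_mem⟩⟩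
  let Z : J → ((Fin k → Bool) → Ω) × (Fin k → ℝ) → ℝ := fun q w =>
    X q.1.2 (w.1 q.1.1) - X (x q.1.1) (w.1 q.1.1) + ∑ l, (c * mms (q.1.1 l)) * w.2 l
  have mE : ∀ e, MeasurePreserving (fun ω : (Fin k → Bool) → Ω => ω e) P1 P := fun e =>
    measurePreserving_eval (fun _ => P) e
  have mF : ∀ l, MeasurePreserving (fun h : Fin k → ℝ => h l) P2 (gaussianReal 0 1) := fun l =>
    measurePreserving_eval (fun _ => gaussianReal 0 1) l
  have m1 : MeasurePreserving Prod.fst (P1.prod P2) P1 := measurePreserving_fst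
  have m2 : MeasurePreserving Prod.snd (P1.prod P2) P2 := measurePreserving_snd
  have mE1 : ∀ e, MeasurePreserving
      (fun w : ((Fin k → Bool) → Ω) × (Fin k → ℝ) => w.1 e) (P1.prod P2) P :=
    fun e => (mE e).comp m1
  have g1 : HasGaussianLaw (fun (ω : (Fin k → Bool) → Ω) e i => X i (ω e)) P1 := by
    have h1 : ∀ e, HasGaussianLaw (fun (ω : (Fin k → Bool) → Ω) i => X i (ω e)) P1 := fun e =>
      mm_mp_gauss (mE e) hX
    have h2 : iIndepFun (fun (e : Fin k → Bool) (ω : (Fin k → Bool) → Ω) i => X i (ω e)) P1 :=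
      iIndepFun_pi (X := fun _ ω i => X i ω) fun _ => hX.aemeasurable
    exact h2.hasGaussianLaw h1
  have g2 : HasGaussianLaw (fun h : Fin k → ℝ => h) P2 := mm_std_gauss k
  have gj : HasGaussianLaw (fun w : ((Fin k → Bool) → Ω) × (Fin k → ℝ) =>
      ((fun e i => X i (w.1 e)), w.2)) (P1.prod P2) :=
    (indepFun_prod₀ g1.aemeasurable g2.aemeasurable).hasGaussianLaw
      (mm_mp_gauss m1 g1) (mm_mp_gauss m2 g2)
  have gZ : HasGaussianLaw (fun w q => Z q w) (P1.prod P2) := by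
    have := gj.map (ContinuousLinearMap.pi fun q : J =>
      (((ContinuousLinearMap.proj q.1.2 : (ι → ℝ) →L[ℝ] ℝ)
        - (ContinuousLinearMap.proj (x q.1.1) : (ι → ℝ) →L[ℝ] ℝ)).comp ((ContinuousLinearMap.proj q.1.1 :
          ((Fin k → Bool) → ι → ℝ) →L[ℝ] (ι → ℝ)).comp
          (ContinuousLinearMap.fst ℝ ((Fin k → Bool) → ι → ℝ) (Fin k → ℝ))))
      + (∑ l, (c * mms (q.1.1 l)) • (ContinuousLinearMap.proj l : (Fin k → ℝ) →L[ℝ] ℝ)).comp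
          (ContinuousLinearMap.snd ℝ ((Fin k → Bool) → ι → ℝ) (Fin k → ℝ)))
    convert! this using 1
    ext w q
    simp [Z]
  have gX : HasGaussianLaw (fun ω (q : J) => X q.1.2 ω) P :=
    hX.map (ContinuousLinearMap.pi fun q : J => (ContinuousLinearMap.proj q.1.2 :
      (ι → ℝ) →L[ℝ] ℝ))
  have iZ : ∀ q, Integrable (Z q) (P1.prod P2) := fun q => (gZ.eval q).integrable
  have iE : ∀ i e, Integrable (fun w : ((Fin k → Bool) → Ω) × (Fin k → ℝ) => X i (w.1 e))
      (P1.prod P2) := fun i e => (mE1 e).integrable_comp_of_integrable (hXi i)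
  have L2E : ∀ i e, MemLp (fun w : ((Fin k → Bool) → Ω) × (Fin k → ℝ) => X i (w.1 e)) 2
      (P1.prod P2) := fun i e => (hX2 i).comp_measurePreserving (mE1 e)
  have iF : ∀ l, Integrable (fun w : ((Fin k → Bool) → Ω) × (Fin k → ℝ) => w.2 l)
      (P1.prod P2) := fun l => m2.integrable_comp_of_integrable (g2.eval l).integrable
  have L2F : ∀ l, MemLp (fun w : ((Fin k → Bool) → Ω) × (Fin k → ℝ) => w.2 l) 2
      (P1.prod P2) := fun l => (g2.eval l).memLp_two.comp_measurePreserving m2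
  have zE : ∀ i e, ∫ w, X i (w.1 e) ∂(P1.prod P2) = 0 := fun i e => by
    rw [mm_mp_int (mE1 e) (hXm i), hX0]
  have zF : ∀ l, ∫ w, w.2 l ∂(P1.prod P2) = 0 := fun l => by
    rw [mm_mp_int m2 (g := fun h => h l) (g2.eval l).integrable.aestronglyMeasurable]
    exact mm_std_zero k l
  have zZ : ∀ q, ∫ w, Z q w ∂(P1.prod P2) = 0 := by
    intro q
    simp only [Z]
    have i1 : Integrable (fun w : ((Fin k → Bool) → Ω) × (Fin k → ℝ) =>
        X q.1.2 (w.1 q.1.1) - X (x q.1.1) (w.1 q.1.1)) (P1.prod P2) := (iE _ _).sub (iE _ _)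
    rw [integral_add i1 (integrable_finsetSum _ fun l _ => (iF l).const_mul _),
      integral_sub (iE _ _) (iE _ _), integral_finsetSum _ fun l _ => (iF l).const_mul _]
    simp_rw [integral_const_mul, zF, zE]
    simp
  -- comparison
  have hcmp : ∫ w, ⨆ q, Z q w ∂(P1.prod P2) ≤ ∫ ω, ⨆ q : J, X q.1.2 ω ∂P := by
    refine mm_sf Z (fun q : J => X q.1.2) gZ gX zZ (fun q => hX0 _) fun q q' => ?_
    obtain ⟨⟨e, y⟩, hy⟩ := q
    obtain ⟨⟨e', y'⟩, hy'⟩ := q'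
    simp only at hy hy'
    by_cases hee : e = e'
    · subst hee
      have : (fun w => Z ⟨⟨e, y⟩, hy⟩ w - Z ⟨⟨e, y'⟩, hy'⟩ w)
          = fun w => (fun ω => X y ω - X y' ω) (w.1 e) := by
        ext w; simp [Z]
      rw [this, mmn_mp (mE1 e) (g := fun ω => X y ω - X y' ω) ((hXm _).sub (hXm _))]
    · have lower : 3 * σ / 4 ≤ mmn P (fun ω => X y ω - X y' ω) := by
        have t1 := mmn_tri (hX2 (x e)) (hX2 y) (hX2 (x e'))
        have t2 := mmn_tri (hX2 y) (hX2 y') (hX2 (x e'))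
        have t3 := hball e y hy
        have t4 := hball e' y' hy'
        rw [mmn_sub_comm] at t3
        linarith [hsep e e' hee]
      refine le_trans ?_ lower
      have : (fun w => Z ⟨⟨e, y⟩, hy⟩ w - Z ⟨⟨e', y'⟩, hy'⟩ w)
          = fun w => (X y (w.1 e) - X (x e) (w.1 e)) + ((X (x e') (w.1 e') - X y' (w.1 e'))
            + ∑ l, (c * (mms (e l) - mms (e' l))) * w.2 l) := by
        ext w
        simp only [Z, mul_sub, sub_mul, Finset.sum_sub_distrib]
        ring
      rw [this]
      have LW : MemLp (fun w : ((Fin k → Bool) → Ω) × (Fin k → ℝ) =>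
          ∑ l, (c * (mms (e l) - mms (e' l))) * w.2 l) 2 (P1.prod P2) :=
        memLp_finsetSum _ fun l _ => (L2F l).const_mul _
      have s1 := mmn_add_le ((L2E y e).sub (L2E (x e) e))
        (((L2E (x e') e').sub (L2E y' e')).add LW)
      have s2 := mmn_add_le ((L2E (x e') e').sub (L2E y' e')) LW
      have s3 : mmn (P1.prod P2) ((fun w => X y (w.1 e)) - fun w => X (x e) (w.1 e)) ≤ σ / 8 :=
        (mmn_mp (mE1 e) (g := fun ω => X y ω - X (x e) ω) ((hXm _).sub (hXm _))).trans_le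
          (hball e y hy)
      have s4 : mmn (P1.prod P2) ((fun w => X (x e') (w.1 e')) - fun w => X y' (w.1 e')) ≤ σ / 8 :=
        (mmn_mp (mE1 e') (g := fun ω => X (x e') ω - X y' ω) ((hXm _).sub (hXm _))).trans_le
          ((mmn_sub_comm _ _).trans_le (hball e' y' hy'))
      have s5 : mmn (P1.prod P2) (fun w => ∑ l, (c * (mms (e l) - mms (e' l))) * w.2 l)
          ≤ σ / 2 := by
        rw [mmn_mp m2 (g := fun h => ∑ l, (c * (mms (e l) - mms (e' l))) * h l)
          (Continuous.aestronglyMeasurable (by fun_prop))]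
        unfold mmn
        simp only [P2]
        rw [mm_std_sq]
        refine Real.sqrt_le_iff.2 ⟨by positivity, ?_⟩
        have : ∑ l : Fin k, (c * (mms (e l) - mms (e' l))) ^ 2 ≤ ∑ l : Fin k, 4 * c ^ 2 := by
          refine Finset.sum_le_sum fun l _ => ?_
          have : (mms (e l) - mms (e' l)) ^ 2 ≤ 4 := by
            unfold mms
            split_ifs <;> norm_num
          nlinarith [sq_nonneg c]
        refine this.trans_eq ?_
        simp only [Finset.sum_const, Finset.card_univ, Fintype.card_fin, nsmul_eq_mul, hc]
        rw [← hkk]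
        have hk2 : Real.sqrt k ^ 2 = k := by rw [sq, hkk]
        rw [hkk, div_pow, mul_pow, hk2]
        have hk3 : (0:ℝ) < k := by exact_mod_cast hk
        field_simp
        ring
      have s1' : mmn (P1.prod P2) (fun w => (X y (w.1 e) - X (x e) (w.1 e)) +
          ((X (x e') (w.1 e') - X y' (w.1 e')) + ∑ l, (c * (mms (e l) - mms (e' l))) * w.2 l)) ≤ _ :=
        s1
      refine s1'.trans ?_
      have s2' := add_le_add_right (s2.trans (add_le_add s4 s5)) (σ / 8)
      refine (add_le_add s3 (s2.trans (add_le_add s4 s5))).trans ?_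
      linarith
  -- upper bound by the width of `B`
  have hup : ∫ ω, ⨆ q : J, X q.1.2 ω ∂P ≤ mmG P X B := by
    refine integral_mono (mm_integrable_sup (fun q : J => X q.1.2) fun q => hXi _)
      (mm_integrable_sup (fun y : B => X y) fun y => hXi y) fun ω => ?_
    refine ciSup_le fun q => ?_
    exact le_ciSup (f := fun y : B => X y ω) (Set.finite_range _).bddAbove
      ⟨q.1.2, hB _ q.2⟩
  -- lower bound
  have hlow : G' + σ / 4 * Real.sqrt k * mmk ≤ ∫ w, ⨆ q, Z q w ∂(P1.prod P2) := by
    have isup := mm_integrable_sup Z iZ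
    rw [integral_prod_symm _ isup]
    have hsum : ∫ h, (G' + ∑ l, c * |h l|) ∂P2 = G' + σ / 4 * Real.sqrt k * mmk := by
      rw [integral_add (integrable_const _)
        (integrable_finsetSum _ fun l _ => ((g2.eval l).integrable.abs).const_mul _),
        integral_finsetSum _ fun l _ => ((g2.eval l).integrable.abs).const_mul _]
      have : ∀ l, ∫ h, c * |h l| ∂P2 = c * mmk := by
        intro l
        rw [integral_const_mul, mm_mp_int (mF l) (g := fun x => |x|) (by fun_prop)]
        rfl
      simp_rw [this]
      simp only [integral_const, probReal_univ, smul_eq_mul, one_mul, Finset.sum_const,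
        Finset.card_univ, Fintype.card_fin, nsmul_eq_mul, hc]
      have hk4 : (k:ℝ) * (σ / (4 * Real.sqrt k)) = σ / 4 * Real.sqrt k := by
        rw [mul_div_assoc', div_eq_iff (by positivity)]
        linear_combination (- σ) * hkk
      rw [← hk4]
      ring
    rw [← hsum]
    refine integral_mono_ae ((integrable_const _).add
        (integrable_finsetSum _ fun l _ => ((g2.eval l).integrable.abs).const_mul _))
      isup.integral_prod_right ?_
    filter_upwards [isup.prod_left_ae] with h hh
    let e : Fin k → Bool := fun l => decide (0 ≤ h l)
    have hsgn : ∑ l, (c * mms (e l)) * h l = ∑ l, c * |h l| := by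
      refine Finset.sum_congr rfl fun l _ => ?_
      by_cases hl : 0 ≤ h l
      · simp [e, mms, hl, abs_of_nonneg hl]
      · simp [e, mms, hl, abs_of_neg (not_le.1 hl)]
    have hne := (hA e).to_subtype
    have isA : Integrable (fun ω => ⨆ y : A e, X y ω) P :=
      mm_integrable_sup (fun y : A e => X y) fun y => hXi y
    have hI : Integrable (fun ω => (⨆ y : A e, X y ω) - X (x e) ω) P := isA.sub (hXi _)
    have hIe : Integrable (fun ω : (Fin k → Bool) → Ω =>
        (⨆ y : A e, X y (ω e)) - X (x e) (ω e)) P1 := (mE e).integrable_comp_of_integrable hI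
    have e1 : ∫ ω : (Fin k → Bool) → Ω, (((⨆ y : A e, X y (ω e)) - X (x e) (ω e))
        + ∑ l, c * |h l|) ∂P1 = mmG P X (A e) + ∑ l, c * |h l| := by
      rw [integral_add hIe (integrable_const _),
        mm_mp_int (mE e) (g := fun ω => (⨆ y : A e, X y ω) - X (x e) ω) hI.aestronglyMeasurable,
        integral_sub isA (hXi _), hX0]
      simp [mmG]
    refine (add_le_add_left (hG e) _).trans ?_
    rw [← e1]
    refine integral_mono (hIe.add (integrable_const _)) hh
      fun ω => ?_
    simp only
    obtain ⟨y, hy⟩ := exists_eq_ciSup_of_finite (f := fun y : A e => X y (ω e))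
    rw [← hy, ← hsgn]
    exact le_ciSup (f := fun q : J => Z q (ω, h)) (Set.finite_range _).bddAbove ⟨(e, y), y.2⟩
  exact hlow.trans (hcmp.trans hup)

end MMPartE

section MMPartF

/-- closed ball -/
def mmB {ι : Type*} (d : ι → ι → ℝ) (x : ι) (r : ℝ) : Set ι := {y | d y x ≤ r}

/-- the metric data used in the deterministic part of the proof -/
structure MMData {ι : Type*} (d : ι → ι → ℝ) (G : Set ι → ℝ) (κ : ℝ) : Prop where
  pos : 0 < κ
  self : ∀ x, d x x = 0
  symm : ∀ x y, d x y = d y x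
  tri : ∀ x y z, d x z ≤ d x y + d y z
  nonneg : ∀ x y, 0 ≤ d x y
  gmono : ∀ A B : Set ι, A.Nonempty → A ⊆ B → G A ≤ G B
  gnonneg : ∀ A : Set ι, A.Nonempty → 0 ≤ G A
  growth : ∀ (n : ℕ) (x : (Fin (2 ^ n) → Bool) → ι) (A : (Fin (2 ^ n) → Bool) → Set ι)
    (σ : ℝ) (G' : ℝ) (B : Set ι), (∀ e, (A e).Nonempty) → 0 ≤ σ →
    (∀ e e', e ≠ e' → σ ≤ d (x e) (x e')) → (∀ e, ∀ y ∈ A e, d y (x e) ≤ σ / 8) →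
    (∀ e, G' ≤ G (A e)) → (∀ e, A e ⊆ B) → G' + κ * σ * Real.sqrt 2 ^ n ≤ G B

variable {ι : Type*} [Finite ι] {d : ι → ι → ℝ} {G : Set ι → ℝ} {κ : ℝ}

lemma MMData.diam (h : MMData d G κ) (x y : ι) : d x y ≤ G univ / κ := by
  rw [le_div_iff₀ h.pos]
  have := h.growth 0 (fun e => if e 0 then x else y) (fun e => {if e 0 then x else y}) (d x y) 0
    univ (fun e => singleton_nonempty _) (h.nonneg _ _) ?_ ?_ (fun e => h.gnonneg _ (singleton_nonempty _))
    (fun e => subset_univ _)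
  · simp at this; linarith
  · intro e e' hee
    have : e 0 ≠ e' 0 := by
      intro h0; apply hee; funext i
      have hi : i = 0 := Fin.ext (by have := i.2; simp at this ⊢)
      rw [hi, h0]
    rcases h1 : e 0 <;> rcases h2 : e' 0 <;> simp_all [h.symm x y]
  · intro e z hz
    rw [mem_singleton_iff.1 hz, h.self]
    have := h.nonneg x y
    positivity

lemma mm_exists_s [Nonempty ι] (h : MMData d G κ) (a : ℝ) (ha : 0 < a) :
    ∃ s : ℕ → ι → ℝ, (∀ n x, 0 ≤ s n x) ∧ (∀ n x, s n x ≤ G univ / κ) ∧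
      (∀ n x t, 0 ≤ t → a * Real.sqrt 2 ^ n * s n x - G (mmB d x (s n x))
        ≤ a * Real.sqrt 2 ^ n * t - G (mmB d x t)) ∧
      ∀ x N, ∑ n ∈ Finset.range N, Real.sqrt 2 ^ (n + 1) * s (n + 1) x ≤ 4 * G univ / a := by
  have ex : ∀ (n : ℕ) (x : ι), ∃ y, ∀ z, a * Real.sqrt 2 ^ n * d y x - G (mmB d x (d y x))
      ≤ a * Real.sqrt 2 ^ n * d z x - G (mmB d x (d z x)) := fun n x =>
    Finite.exists_min fun y => a * Real.sqrt 2 ^ n * d y x - G (mmB d x (d y x))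
  choose y hy using ex
  have hB : ∀ x t, 0 ≤ t → (mmB d x t).Nonempty := fun x t ht => ⟨x, by simp [mmB, h.self, ht]⟩
  have hopt : ∀ n x t, 0 ≤ t → a * Real.sqrt 2 ^ n * d (y n x) x - G (mmB d x (d (y n x) x))
        ≤ a * Real.sqrt 2 ^ n * t - G (mmB d x t) := by
    intro n x t ht
    obtain ⟨z, hz, hz'⟩ := (Set.toFinite (mmB d x t)).exists_maximalFor (fun z => d z x) _ (hB x t ht)
    have hz2 : ∀ w ∈ mmB d x t, d w x ≤ d z x := fun w hw => by
      rcases le_total (d w x) (d z x) with h1 | h1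
      · exact h1
      · exact hz' hw h1
    have e : mmB d x (d z x) = mmB d x t :=
      Subset.antisymm (fun w hw => le_trans (show d w x ≤ d z x from hw) hz) fun w hw => hz2 w hw
    refine (hy n x z).trans ?_
    rw [e]
    have : d z x ≤ t := hz
    gcongr
  refine ⟨fun n x => d (y n x) x, fun n x => h.nonneg _ _, fun n x => h.diam _ _, hopt, fun x N => ?_⟩
  set K : ℕ → ℝ := fun n => a * Real.sqrt 2 ^ n * d (y n x) x - G (mmB d x (d (y n x) x)) with hK
  have h2 : (4:ℝ) / 3 ≤ Real.sqrt 2 := Real.le_sqrt_of_sq_le (by norm_num)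
  have step : ∀ n, a / 4 * (Real.sqrt 2 ^ (n + 1) * d (y (n + 1) x) x) ≤ K (n + 1) - K n := by
    intro n
    have h1 := hopt n x (d (y (n + 1) x) x) (h.nonneg _ _)
    have h0 := h.nonneg (y (n + 1) x) x
    have h3 : 0 ≤ a * Real.sqrt 2 ^ n * d (y (n + 1) x) x := by positivity
    have h4 : K (n + 1) - K n ≥ (Real.sqrt 2 - 1) * (a * Real.sqrt 2 ^ n * d (y (n + 1) x) x) := by
      simp only [hK, pow_succ]
      linarith
    refine le_trans ?_ h4
    rw [pow_succ]
    nlinarith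
  have hsum : a / 4 * ∑ n ∈ Finset.range N, Real.sqrt 2 ^ (n + 1) * d (y (n + 1) x) x ≤ K N - K 0 := by
    rw [← Finset.sum_range_sub, Finset.mul_sum]
    exact Finset.sum_le_sum fun n _ => step n
  have hKN : K N ≤ 0 := by
    have := hopt N x 0 le_rfl
    have h5 := h.gnonneg _ (hB x 0 le_rfl)
    simp only [hK]; linarith
  have hK0 : - G univ ≤ K 0 := by
    have h5 := h.gmono _ univ (hB x (d (y 0 x) x) (h.nonneg _ _)) (subset_univ _)
    have h6 : 0 ≤ a * Real.sqrt 2 ^ 0 * d (y 0 x) x := by have := h.nonneg (y 0 x) x; positivity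
    simp only [hK]; linarith
  rw [le_div_iff₀ ha]
  linarith

lemma mm_cover (h : MMData d G κ) (s : ι → ℝ) (n : ℕ) (hs0 : ∀ x, 0 ≤ s x)
    (hs : ∀ x t, 0 ≤ t → κ / 32 * Real.sqrt 2 ^ n * s x - G (mmB d x (s x))
        ≤ κ / 32 * Real.sqrt 2 ^ n * t - G (mmB d x t))
    (A : Set ι) (D σ : ℝ) (hD : ∀ x ∈ A, ∀ y ∈ A, d x y ≤ D) (hsσ : ∀ x ∈ A, 8 * s x ≤ σ)
    (hσ : 0 ≤ σ) (hDσ : D ≤ 16 * σ) :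
    ∃ l : ι → Fin (2 ^ 2 ^ n), ∀ x ∈ A, ∀ y ∈ A, l x = l y → d x y ≤ 2 * σ := by
  classical
  have := Fintype.ofFinite ι
  let F : Set (Finset ι) := {S | (∀ x ∈ S, x ∈ A) ∧ ∀ x ∈ S, ∀ y ∈ S, x ≠ y → σ < d x y}
  obtain ⟨S, hSF, hSmax⟩ := (Set.toFinite F).exists_maximal ⟨∅, by simp [F]⟩
  obtain ⟨hSA, hSsep⟩ := hSF
  have hnear : ∀ x ∈ A, ∃ p ∈ S, d x p ≤ σ := by
    intro x hx
    by_contra hcon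
    push Not at hcon
    have hxS : x ∉ S := fun hxS => by
      have := hcon x hxS; rw [h.self] at this; linarith
    have : insert x S ∈ F := by
      refine ⟨?_, ?_⟩
      · intro y hy
        rcases Finset.mem_insert.1 hy with rfl | hy
        · exact hx
        · exact hSA y hy
      · intro y hy z hz hyz
        rcases Finset.mem_insert.1 hy with rfl | hy1 <;> rcases Finset.mem_insert.1 hz with rfl | hz1
        · exact absurd rfl hyz
        · exact hcon z hz1
        · rw [h.symm]; exact hcon y hy1
        · exact hSsep y hy1 z hz1 hyz
    exact hxS (hSmax this (Finset.subset_insert x S) (Finset.mem_insert_self x S))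
  have hcard : S.card < 2 ^ 2 ^ n := by
    by_contra hc
    push Not at hc
    have hc' : Fintype.card (Fin (2 ^ n) → Bool) ≤ Fintype.card S := by simpa using hc
    obtain ⟨f⟩ := Function.Embedding.nonempty_of_card_le hc'
    let x : (Fin (2 ^ n) → Bool) → ι := fun e => f e
    have hxA : ∀ e, x e ∈ A := fun e => hSA _ (f e).2
    have hxsep : ∀ e e', e ≠ e' → σ < d (x e) (x e') := fun e e' hee =>
      hSsep _ (f e).2 _ (f e').2 fun h' => hee (f.injective (Subtype.ext h'))
    let I := {q : (Fin (2 ^ n) → Bool) × (Fin (2 ^ n) → Bool) // q.1 ≠ q.2}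
    haveI : Nonempty I := ⟨⟨(fun _ => true, fun _ => false), fun h' => by
      have := congrFun h' ⟨0, by positivity⟩; simp at this⟩⟩
    obtain ⟨q, hq⟩ := Finite.exists_min fun q : I => d (x q.1.1) (x q.1.2)
    set σ' := d (x q.1.1) (x q.1.2) with hσ'
    have hσσ : σ < σ' := hxsep _ _ q.2
    obtain ⟨j, hj⟩ := Finite.exists_min fun e => G (mmB d (x e) (s (x e)))
    have hg := h.growth n x (fun e => mmB d (x e) (s (x e))) σ' (G (mmB d (x j) (s (x j))))
      (mmB d (x j) (D + σ' / 8)) (fun e => ⟨x e, by simp [mmB, h.self, hs0]⟩) (by linarith)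
      (fun e e' hee => hq ⟨(e, e'), hee⟩) ?_ hj ?_
    · have h0 : 0 ≤ D := by
        have := hD _ (hxA j) _ (hxA j); rwa [h.self] at this
      have ho := hs (x j) (D + σ' / 8) (by linarith)
      have hr : 0 < Real.sqrt 2 ^ n := by positivity
      have h1 : κ * Real.sqrt 2 ^ n * σ' ≤ κ * Real.sqrt 2 ^ n * ((D + σ' / 8) / 32) := by
        have : 0 ≤ κ / 32 * Real.sqrt 2 ^ n * s (x j) := by
          have := hs0 (x j); have := h.pos; positivity
        linarith
      have h2 := le_of_mul_le_mul_left h1 (mul_pos h.pos hr)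
      linarith
    · intro e y hy
      have : d y (x e) ≤ s (x e) := hy
      have := hsσ _ (hxA e)
      linarith
    · intro e y hy
      have h1 : d y (x e) ≤ s (x e) := hy
      have h2 := hsσ _ (hxA e)
      have h3 := h.tri y (x e) (x j)
      have h4 := hD _ (hxA e) _ (hxA j)
      show d y (x j) ≤ _
      linarith
  have hemb : Fintype.card S ≤ Fintype.card (Fin (2 ^ 2 ^ n)) := by simpa using hcard.le
  obtain ⟨g⟩ := Function.Embedding.nonempty_of_card_le hemb
  choose! p hp hp' using hnear
  refine ⟨fun x => if hx : x ∈ A then g ⟨p x, hp x hx⟩ else ⟨0, by positivity⟩, ?_⟩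
  intro x hx y hy hxy
  simp only [hx, hy, dif_pos] at hxy
  have e : p x = p y := by simpa using g.injective hxy
  have h1 := hp' x hx
  have h2 := hp' y hy
  have h3 := h.tri x (p x) y
  rw [e] at h1 h3
  rw [h.symm] at h2
  linarith

end MMPartF

section MMPartG

variable {ι : Type*} [Finite ι] {d : ι → ι → ℝ} {G : Set ι → ℝ} {κ : ℝ}

lemma mm_eDiam_le {A : Set ι} {b : ℝ} (h : ∀ x ∈ A, ∀ y ∈ A, d x y ≤ b) :
    eDiam (fun x y => ENNReal.ofReal (d x y)) A ≤ ENNReal.ofReal b :=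
  iSup₂_le fun x hx => iSup₂_le fun y hy => ENNReal.ofReal_le_ofReal (h x hx y hy)

lemma mm_eDiam_ne_top (h : MMData d G κ) (A : Set ι) :
    eDiam (fun x y => ENNReal.ofReal (d x y)) A ≠ ⊤ :=
  ((mm_eDiam_le fun x _ y _ => h.diam x y).trans_lt ENNReal.ofReal_lt_top).ne

lemma mm_le_eDiam (h : MMData d G κ) (A : Set ι) {x y : ι} (hx : x ∈ A) (hy : y ∈ A) :
    d x y ≤ (eDiam (fun x y => ENNReal.ofReal (d x y)) A).toReal := by
  rw [← ENNReal.ofReal_le_iff_le_toReal (mm_eDiam_ne_top h A)]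
  exact (le_iSup₂ (f := fun y (_ : y ∈ A) => ENNReal.ofReal (d x y)) y hy).trans
    (le_iSup₂ (f := fun x (_ : x ∈ A) => ⨆ y ∈ A, ENNReal.ofReal (d x y)) x hx)

/-- the codes used at level `n` -/
abbrev MMCode (n : ℕ) : Type := Fin (2 ^ 2 ^ n) × Fin (n + 1) × Fin (2 ^ 2 ^ n)

lemma mm_code (h : MMData d G κ) (s : ι → ℝ) (n : ℕ) (hs0 : ∀ x, 0 ≤ s x)
    (hs1 : ∀ x, s x ≤ G univ / κ)
    (hs : ∀ x t, 0 ≤ t → κ / 32 * Real.sqrt 2 ^ n * s x - G (mmB d x (s x))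
        ≤ κ / 32 * Real.sqrt 2 ^ n * t - G (mmB d x t)) (P : Admissible (univ : Set ι)) :
    ∃ c : ι → MMCode n, ∀ x y z, c x = c y → c x = c z → d y z ≤ 32 * s x + 16 * (G univ / κ) / 2 ^ n
      + (eDiam (fun x y => ENNReal.ofReal (d x y)) (P.piece n x)).toReal / 8 := by
  classical
  set Δ := G univ / κ with hΔ
  rcases isEmpty_or_nonempty ι with hι | hι
  · exact ⟨fun x => isEmptyElim x, fun x => isEmptyElim x⟩
  have hΔ0 : 0 ≤ Δ := (hs0 (Classical.arbitrary ι)).trans (hs1 _)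
  set E : Set ι → ℝ := fun A => (eDiam (fun x y => ENNReal.ofReal (d x y)) A).toReal with hE
  have hE0 : ∀ A, 0 ≤ E A := fun A => ENNReal.toReal_nonneg
  -- dyadic level
  let j : ι → ℕ := fun x => Nat.findGreatest (fun j => s x ≤ Δ / 2 ^ j) n
  have hj : ∀ x, j x ≤ n := fun x => Nat.findGreatest_le n
  have hj1 : ∀ x, s x ≤ Δ / 2 ^ j x := fun x =>
    Nat.findGreatest_spec (P := fun j => s x ≤ Δ / 2 ^ j) (Nat.zero_le n) (by simpa using hs1 x)
  have hj2 : ∀ x, Δ / 2 ^ j x ≤ 2 * s x + Δ / 2 ^ n := by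
    intro x
    rcases (hj x).lt_or_eq with h1 | h1
    · have := Nat.findGreatest_is_greatest (P := fun j => s x ≤ Δ / 2 ^ j) (n := n) (k := j x + 1)
        (Nat.lt_succ_self _) h1
      push Not at this
      rw [pow_succ, ← div_div] at this
      have : 0 ≤ Δ / 2 ^ n := by positivity
      linarith
    · rw [h1]; linarith [hs0 x]
  have hlab : ∀ (A : Set ι) (i : ℕ), ∃ l : ι → Fin (2 ^ 2 ^ n), ∀ x ∈ A ∩ {y | j y = i},
      ∀ y ∈ A ∩ {y | j y = i}, l x = l y → d x y ≤ 2 * (8 * (Δ / 2 ^ i) + E A / 16) := by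
    intro A i
    have := hE0 A
    refine mm_cover h s n hs0 hs _ (E A) _ (fun x hx y hy => mm_le_eDiam h A hx.1 hy.1) ?_
      (by positivity) ?_
    · rintro x ⟨-, rfl⟩
      have := hj1 x
      linarith
    · have : 0 ≤ Δ / 2 ^ i := by positivity
      linarith
  choose l hl using hlab
  -- piece index
  let F : Set (Set ι) := {A : Set ι | ∃ x ∈ (univ : Set ι), P.piece n x = A}
  have hF := P.finite_pieces n
  have := hF.fintype
  have hc : Fintype.card F ≤ Fintype.card (Fin (2 ^ 2 ^ n)) := by
    have := P.card_pieces n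
    rw [Fintype.card_fin, ← Nat.card_eq_fintype_card]
    exact this.le
  obtain ⟨g⟩ := Function.Embedding.nonempty_of_card_le hc
  refine ⟨fun x => (g ⟨P.piece n x, x, mem_univ x, rfl⟩, ⟨j x, Nat.lt_succ_of_le (hj x)⟩,
    l (P.piece n x) (j x) x), fun x y z hxy hxz => ?_⟩
  simp only [Prod.mk.injEq, Fin.mk.injEq, EmbeddingLike.apply_eq_iff_eq, Subtype.mk.injEq]
    at hxy hxz
  obtain ⟨h5, h6, h7⟩ := hxz
  rw [← h5, ← h6] at h7
  obtain ⟨h1, h2, h3⟩ := hxy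
  rw [← h1, ← h2] at h3
  have := hl (P.piece n x) (j x) y ⟨h1 ▸ P.self_mem n y (mem_univ y), h2.symm⟩ z
    ⟨h5 ▸ P.self_mem n z (mem_univ z), h6.symm⟩ (h3.symm.trans h7)
  have h4 := hj2 x
  rw [mul_div_assoc]
  simp only [hE] at this
  linarith

lemma mm_code_card (m : ℕ) : Fintype.card ((k : Fin m) → MMCode k) * 2 ^ 3 ≤ 2 ^ (3 * 2 ^ m) := by
  rw [Fintype.card_pi, Fin.prod_univ_eq_prod_range (fun k => Fintype.card (MMCode k))]
  induction m with
  | zero => simp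
  | succ m ih =>
    rw [Finset.prod_range_succ]
    have h1 : Fintype.card (MMCode m) ≤ 2 ^ (3 * 2 ^ m) := by
      simp only [MMCode, Fintype.card_prod, Fintype.card_fin]
      have a1 : m + 1 ≤ 2 ^ m := Nat.lt_two_pow_self
      have a2 : 2 ^ m ≤ 2 ^ 2 ^ m := Nat.pow_le_pow_right (by norm_num) Nat.lt_two_pow_self.le
      calc 2 ^ 2 ^ m * ((m + 1) * 2 ^ 2 ^ m) ≤ 2 ^ 2 ^ m * (2 ^ 2 ^ m * 2 ^ 2 ^ m) := by
            gcongr; exact a1.trans a2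
        _ = 2 ^ (3 * 2 ^ m) := by rw [← pow_add, ← pow_add]; congr 1; ring
    calc _ = (∏ k ∈ Finset.range m, Fintype.card (MMCode k)) * 2 ^ 3 * Fintype.card (MMCode m) := by
          ring
      _ ≤ 2 ^ (3 * 2 ^ m) * 2 ^ (3 * 2 ^ m) := Nat.mul_le_mul ih h1
      _ = 2 ^ (3 * 2 ^ (m + 1)) := by rw [← pow_add]; congr 1; ring

lemma mm_code_card' (n : ℕ) : Fintype.card ((k : Fin (n - 3)) → MMCode k) < 2 ^ 2 ^ n := by
  have h1 := mm_code_card (n - 3)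
  rcases Nat.eq_zero_or_pos (n - 3) with h0 | h0
  · rw [h0] at h1 ⊢
    have : Fintype.card ((k : Fin 0) → MMCode k) = 1 := by simp
    rw [this]
    exact Nat.one_lt_two_pow (by positivity)
  · have h2 : 3 * 2 ^ (n - 3) ≤ 2 ^ n := by
      calc 3 * 2 ^ (n - 3) ≤ 2 ^ 3 * 2 ^ (n - 3) := by gcongr; norm_num
        _ = 2 ^ n := by rw [← pow_add]; congr 1; omega
    have h3 : 2 ^ (3 * 2 ^ (n - 3)) ≤ 2 ^ 2 ^ n := Nat.pow_le_pow_right (by norm_num) h2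
    have h4 : 0 < 2 ^ 2 ^ n := by positivity
    omega

/-- the admissible sequence generated by codes -/
def mmQ (c : (n : ℕ) → ι → MMCode n) : Admissible (univ : Set ι) where
  piece n x := {y | ∀ k, k + 4 ≤ n → c k y = c k x}
  self_mem n x _ := fun k _ => rfl
  subset_base n x _ := subset_univ _
  partition n x _ y _ hy := by
    ext z
    refine forall₂_congr fun k hk => ?_
    rw [hy k hk]
  finite_pieces n := Set.toFinite _
  card_pieces n := by
    refine lt_of_le_of_lt ?_ (mm_code_card' n)
    have : {A : Set ι | ∃ x ∈ (univ : Set ι), {y | ∀ k, k + 4 ≤ n → c k y = c k x} = A} ⊆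
        Set.range (fun (e : (k : Fin (n - 3)) → MMCode k) => {y : ι | ∀ k : Fin (n - 3), c k y = e k}) := by
      rintro A ⟨x, -, rfl⟩
      refine ⟨fun k => c k x, ?_⟩
      ext y
      exact ⟨fun hy k hk => hy ⟨k, by omega⟩, fun hy k => hy k (by omega)⟩
    refine (Set.ncard_le_ncard this (Set.toFinite _)).trans ?_
    rw [← Nat.card_coe_set_eq, ← Nat.card_eq_fintype_card]
    exact Finite.card_range_le _
  nested n x _ := fun y hy k hk => hy k (by omega)

end MMPartG

section MMPartH

variable {ι : Type*} [Finite ι] {d : ι → ι → ℝ} {G : Set ι → ℝ} {κ : ℝ}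

lemma mm_weight (n : ℕ) : (2 : ℝ≥0∞) ^ ((n : ℝ) / 2) = ENNReal.ofReal (Real.sqrt 2 ^ n) := by
  have h2 : (2 : ℝ≥0∞) = ENNReal.ofReal 2 := by simp
  rw [h2, ENNReal.ofReal_rpow_of_pos (by norm_num), Real.sqrt_eq_rpow, ← Real.rpow_natCast,
    ← Real.rpow_mul (by norm_num)]
  congr 2
  ring

lemma mm_sqrt2_le : Real.sqrt 2 ≤ 3 / 2 := by
  rw [Real.sqrt_le_left (by norm_num)]; norm_num

lemma mm_tsum_s (s : ℕ → ℝ) (hs0 : ∀ n, 0 ≤ s n) (Δ M : ℝ) (h0 : s 0 ≤ Δ)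
    (hM : ∀ N, ∑ n ∈ Finset.range N, Real.sqrt 2 ^ (n + 1) * s (n + 1) ≤ M) :
    ∑' n, ENNReal.ofReal (Real.sqrt 2 ^ n) * ENNReal.ofReal (s n) ≤ ENNReal.ofReal (Δ + M) := by
  refine ENNReal.tsum_le_of_sum_range_le fun N => ?_
  have h1 : ∑ n ∈ Finset.range N, ENNReal.ofReal (Real.sqrt 2 ^ n) * ENNReal.ofReal (s n)
      ≤ ∑ n ∈ Finset.range (N + 1), ENNReal.ofReal (Real.sqrt 2 ^ n) * ENNReal.ofReal (s n) :=
    Finset.sum_le_sum_of_subset (Finset.range_mono (Nat.le_succ N))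
  refine h1.trans ?_
  simp_rw [← ENNReal.ofReal_mul (pow_nonneg (Real.sqrt_nonneg 2) _)]
  rw [← ENNReal.ofReal_sum_of_nonneg fun n _ => mul_nonneg (by positivity) (hs0 n)]
  refine ENNReal.ofReal_le_ofReal ?_
  rw [Finset.sum_range_succ']
  have := hM N
  simp only [pow_zero, one_mul]
  linarith

lemma mm_tsum_geom (Δ : ℝ) (hΔ : 0 ≤ Δ) :
    ∑' n : ℕ, ENNReal.ofReal (Real.sqrt 2 ^ n) * ENNReal.ofReal (16 * Δ / 2 ^ n)
      ≤ ENNReal.ofReal (64 * Δ) := by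
  refine ENNReal.tsum_le_of_sum_range_le fun N => ?_
  simp_rw [← ENNReal.ofReal_mul (pow_nonneg (Real.sqrt_nonneg 2) _)]
  rw [← ENNReal.ofReal_sum_of_nonneg fun n _ => mul_nonneg (by positivity) (by positivity)]
  refine ENNReal.ofReal_le_ofReal ?_
  have h1 : ∀ n ∈ Finset.range N, Real.sqrt 2 ^ n * (16 * Δ / 2 ^ n) ≤ 16 * Δ * (3 / 4) ^ n := by
    intro n _
    have : (3 / 4 : ℝ) ^ n = (3 / 2) ^ n / 2 ^ n := by rw [← div_pow]; norm_num
    rw [this, mul_comm, div_mul_eq_mul_div, mul_div_assoc]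
    have := pow_le_pow_left₀ (Real.sqrt_nonneg 2) mm_sqrt2_le n
    gcongr
  refine (Finset.sum_le_sum h1).trans ?_
  rw [← Finset.mul_sum, geom_sum_eq (by norm_num)]
  have : (0:ℝ) ≤ (3 / 4) ^ N := by positivity
  have h3 : (((3 / 4 : ℝ)) ^ N - 1) / (3 / 4 - 1) ≤ 4 := by
    rw [div_le_iff_of_neg (by norm_num)]; linarith
  nlinarith

lemma mm_contract [Nonempty ι] (h : MMData d G κ) (P : Admissible (univ : Set ι)) :
    gammaTwo (fun x y => ENNReal.ofReal (d x y)) (univ : Set ι) ≤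
      ENNReal.ofReal (16783 * (G univ / κ)) + 2⁻¹ *
      ⨆ x ∈ (univ : Set ι), ∑' n : ℕ, (2 : ℝ≥0∞) ^ ((n : ℝ) / 2) *
        eDiam (fun x y => ENNReal.ofReal (d x y)) (P.piece n x) := by
  have hκ := h.pos
  obtain ⟨s, hs0, hs1, hs2, hs3⟩ := mm_exists_s h (κ / 32) (by positivity)
  have hc := fun n => mm_code h (s n) n (hs0 n) (hs1 n) (hs2 n) P
  choose c hc using hc
  set Δ := G univ / κ with hΔ
  have hΔ0 : 0 ≤ Δ := (hs0 0 (Classical.arbitrary ι)).trans (hs1 0 _)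
  set E : Set ι → ℝ≥0∞ := eDiam (fun x y => ENNReal.ofReal (d x y)) with hE
  refine (iInf_le _ (mmQ c)).trans (iSup₂_le fun x _ => ?_)
  simp_rw [mm_weight]
  have hF : ∑' n : ℕ, ENNReal.ofReal (Real.sqrt 2 ^ n) * E (P.piece n x) ≤
      ⨆ x ∈ (univ : Set ι), ∑' n : ℕ, ENNReal.ofReal (Real.sqrt 2 ^ n) * E (P.piece n x) :=
    le_iSup₂ (f := fun x (_ : x ∈ (univ : Set ι)) =>
      ∑' n : ℕ, ENNReal.ofReal (Real.sqrt 2 ^ n) * E (P.piece n x)) x (mem_univ x)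
  refine le_trans ?_ (add_le_add_right (mul_le_mul_right hF _) _)
  rw [← Summable.sum_add_tsum_nat_add' (k := 4) ENNReal.summable]
  have first : ∑ n ∈ Finset.range 4, ENNReal.ofReal (Real.sqrt 2 ^ n) * E ((mmQ c).piece n x)
      ≤ ENNReal.ofReal (15 * Δ) := by
    have : ∀ n ∈ Finset.range 4, ENNReal.ofReal (Real.sqrt 2 ^ n) * E ((mmQ c).piece n x)
        ≤ ENNReal.ofReal (2 ^ n * Δ) := by
      intro n _
      rw [ENNReal.ofReal_mul (by positivity)]
      refine mul_le_mul' (ENNReal.ofReal_le_ofReal (pow_le_pow_left₀ (Real.sqrt_nonneg 2)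
        (mm_sqrt2_le.trans (by norm_num)) n)) (mm_eDiam_le fun y _ z _ => h.diam y z)
    refine (Finset.sum_le_sum this).trans ?_
    rw [← ENNReal.ofReal_sum_of_nonneg fun n _ => by positivity]
    refine ENNReal.ofReal_le_ofReal ?_
    norm_num [Finset.sum_range_succ]
    linarith
  have term : ∀ n, ENNReal.ofReal (Real.sqrt 2 ^ (n + 4)) * E ((mmQ c).piece (n + 4) x)
      ≤ 128 * (ENNReal.ofReal (Real.sqrt 2 ^ n) * ENNReal.ofReal (s n x))
        + 4 * (ENNReal.ofReal (Real.sqrt 2 ^ n) * ENNReal.ofReal (16 * Δ / 2 ^ n))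
        + 2⁻¹ * (ENNReal.ofReal (Real.sqrt 2 ^ n) * E (P.piece n x)) := by
    intro n
    have hd : E ((mmQ c).piece (n + 4) x) ≤ ENNReal.ofReal (32 * s n x + 16 * Δ / 2 ^ n
        + (E (P.piece n x)).toReal / 8) :=
      mm_eDiam_le fun y hy z hz => hc n x y z (hy n le_rfl).symm (hz n le_rfl).symm
    have hfin : E (P.piece n x) = ENNReal.ofReal (E (P.piece n x)).toReal :=
      (ENNReal.ofReal_toReal (mm_eDiam_ne_top h _)).symm
    set D := (E (P.piece n x)).toReal with hD
    have hD0 : 0 ≤ D := ENNReal.toReal_nonneg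
    have hsn := hs0 n x
    rw [hfin]
    refine (mul_le_mul_right hd _).trans (le_of_eq ?_)
    have e1 : (128 : ℝ≥0∞) = ENNReal.ofReal 128 := by simp
    have e2 : (4 : ℝ≥0∞) = ENNReal.ofReal 4 := by simp
    have e3 : (2⁻¹ : ℝ≥0∞) = ENNReal.ofReal (1 / 2) := by
      rw [one_div, ENNReal.ofReal_inv_of_pos (by norm_num)]; simp
    rw [e1, e2, e3]
    have hr : 0 ≤ Real.sqrt 2 ^ n := by positivity
    rw [← ENNReal.ofReal_mul (by positivity), ← ENNReal.ofReal_mul (by positivity),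
      ← ENNReal.ofReal_mul (by positivity), ← ENNReal.ofReal_mul (by positivity),
      ← ENNReal.ofReal_mul (by positivity), ← ENNReal.ofReal_mul (by positivity),
      ← ENNReal.ofReal_mul (by positivity), ← ENNReal.ofReal_add (by positivity) (by positivity),
      ← ENNReal.ofReal_add (by positivity) (by positivity)]
    congr 1
    have h4 : Real.sqrt 2 ^ 4 = 4 := by
      have := Real.sq_sqrt (show (0:ℝ) ≤ 2 by norm_num)
      calc Real.sqrt 2 ^ 4 = (Real.sqrt 2 ^ 2) ^ 2 := by ring
        _ = 4 := by rw [this]; norm_num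
    rw [pow_add, h4]
    ring
  refine (add_le_add first (ENNReal.tsum_le_tsum term)).trans ?_
  rw [ENNReal.tsum_add, ENNReal.tsum_add, ENNReal.tsum_mul_left, ENNReal.tsum_mul_left,
    ENNReal.tsum_mul_left, ← add_assoc]
  refine add_le_add_left ?_ _
  have k1 := mm_tsum_s (fun n => s n x) (fun n => hs0 n x) Δ (4 * G univ / (κ / 32)) (hs1 0 x)
    (hs3 x)
  have k2 := mm_tsum_geom Δ hΔ0
  have e1 : (128 : ℝ≥0∞) = ENNReal.ofReal 128 := by simp
  have e2 : (4 : ℝ≥0∞) = ENNReal.ofReal 4 := by simp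
  refine (add_le_add_right (add_le_add (mul_le_mul_right k1 _) (mul_le_mul_right k2 _)) _).trans
    (le_of_eq ?_)
  have hG : 4 * G univ / (κ / 32) = 128 * Δ := by rw [hΔ]; field_simp; ring
  rw [e1, e2, hG, ← ENNReal.ofReal_mul (by positivity), ← ENNReal.ofReal_mul (by positivity),
    ← ENNReal.ofReal_add (by positivity) (by positivity),
    ← ENNReal.ofReal_add (by positivity) (by positivity)]
  congr 1
  ring

/-- an admissible sequence which is eventually made of singletons -/
def mmTriv (ι : Type*) [Finite ι] : Admissible (univ : Set ι) where
  piece n x := {y | Nat.card ι < 2 ^ 2 ^ n → y = x}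
  self_mem n x _ := fun _ => rfl
  subset_base n x _ := subset_univ _
  partition n x _ y _ hy := by
    ext z
    refine forall_congr' fun hk => ?_
    rw [hy hk]
  finite_pieces n := Set.toFinite _
  card_pieces n := by
    by_cases hk : Nat.card ι < 2 ^ 2 ^ n
    · refine lt_of_le_of_lt ?_ hk
      have : {A : Set ι | ∃ x ∈ (univ : Set ι), {y | Nat.card ι < 2 ^ 2 ^ n → y = x} = A} ⊆
          Set.range (fun x : ι => {y : ι | Nat.card ι < 2 ^ 2 ^ n → y = x}) := by
        rintro A ⟨x, -, rfl⟩
        exact ⟨x, rfl⟩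
      refine (Set.ncard_le_ncard this (Set.toFinite _)).trans ?_
      rw [← Nat.card_coe_set_eq]
      exact Finite.card_range_le _
    · have : {A : Set ι | ∃ x ∈ (univ : Set ι), {y | Nat.card ι < 2 ^ 2 ^ n → y = x} = A} ⊆
          {univ} := by
        rintro A ⟨x, -, rfl⟩
        simp [hk]
      refine lt_of_le_of_lt (Set.ncard_le_ncard this (Set.toFinite _)) ?_
      rw [Set.ncard_singleton]
      exact Nat.one_lt_two_pow (by positivity)
  nested n x _ := fun y hy hk => hy (hk.trans_le
    (Nat.pow_le_pow_right (by norm_num) (Nat.pow_le_pow_right (by norm_num) (Nat.le_succ n))))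

lemma mm_gamma_lt_top (h : MMData d G κ) :
    gammaTwo (fun x y => ENNReal.ofReal (d x y)) (univ : Set ι) ≠ ⊤ := by
  set N := Nat.card ι
  have hb : gammaTwo (fun x y => ENNReal.ofReal (d x y)) (univ : Set ι) ≤
      ∑ n ∈ Finset.range N, (2 : ℝ≥0∞) ^ ((n : ℝ) / 2) * ENNReal.ofReal (G univ / κ) := by
    refine (iInf_le _ (mmTriv ι)).trans (iSup₂_le fun x _ => ?_)
    rw [tsum_eq_sum (s := Finset.range N)]
    · exact Finset.sum_le_sum fun n _ => mul_le_mul_right (mm_eDiam_le fun y _ z _ => h.diam y z) _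
    · intro n hn
      have hn' : N ≤ n := by simpa using hn
      have hN : N < 2 ^ 2 ^ n :=
        lt_of_le_of_lt hn' (Nat.lt_two_pow_self.trans Nat.lt_two_pow_self)
      have : eDiam (fun x y => ENNReal.ofReal (d x y)) ((mmTriv ι).piece n x) ≤ ENNReal.ofReal 0 :=
        mm_eDiam_le fun y hy z hz => by
          rw [hy hN, hz hN, h.self]
      rw [ENNReal.ofReal_zero] at this
      rw [nonpos_iff_eq_zero.1 this, mul_zero]
  refine (hb.trans_lt ?_).ne
  refine ENNReal.sum_lt_top.2 fun n _ => ?_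
  rw [mm_weight]
  exact ENNReal.mul_lt_top ENNReal.ofReal_lt_top ENNReal.ofReal_lt_top

lemma mm_abstract [Nonempty ι] (h : MMData d G κ) :
    gammaTwo (fun x y => ENNReal.ofReal (d x y)) (univ : Set ι) ≤
      ENNReal.ofReal (2 * 16783 * (G univ / κ)) := by
  have hΔ0 : 0 ≤ G univ / κ := div_nonneg (h.gnonneg _ univ_nonempty) h.pos.le
  have h1 : gammaTwo (fun x y => ENNReal.ofReal (d x y)) (univ : Set ι) ≤
      ENNReal.ofReal (16783 * (G univ / κ)) + 2⁻¹ *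
        gammaTwo (fun x y => ENNReal.ofReal (d x y)) (univ : Set ι) := by
    conv_rhs => rw [gammaTwo]
    rw [ENNReal.mul_iInf_of_ne (by simp) (by simp), ENNReal.add_iInf]
    exact le_iInf fun P => mm_contract h P
  have hfin := mm_gamma_lt_top h
  set g := gammaTwo (fun x y => ENNReal.ofReal (d x y)) (univ : Set ι)
  rw [← ENNReal.ofReal_toReal hfin] at h1 ⊢
  have e3 : (2⁻¹ : ℝ≥0∞) = ENNReal.ofReal (1 / 2) := by
    rw [one_div, ENNReal.ofReal_inv_of_pos (by norm_num)]; simp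
  rw [e3, ← ENNReal.ofReal_mul (by positivity),
    ← ENNReal.ofReal_add (by positivity) (by positivity),
    ENNReal.ofReal_le_ofReal_iff (by positivity)] at h1
  exact ENNReal.ofReal_le_ofReal (by linarith)

end MMPartH

lemma mm_bridge {Ω : Type u} {ι : Type v} [MeasureSpace Ω] [Fintype ι]
    (hP : IsProbabilityMeasure (ℙ : Measure Ω)) (X : ι → Ω → ℝ) (hX : IsCenteredGaussianProcess X) :
    HasGaussianLaw (fun ω i => X i ω) (ℙ : Measure Ω) ∧ ∀ i, ∫ ω, X i ω = 0 := by
  classical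
  obtain ⟨hm, hg⟩ := hX
  have hm' : Measurable (fun ω i => X i ω) := measurable_pi_lambda _ hm
  have key : ∀ L : StrongDual ℝ (ι → ℝ), ∃ v : ℝ≥0,
      Measure.map L (Measure.map (fun ω i => X i ω) ℙ) = gaussianReal 0 v := by
    intro L
    obtain ⟨v, hv⟩ := hg fun i => L (Pi.single i 1)
    refine ⟨v, ?_⟩
    rw [Measure.map_map L.continuous.measurable hm', ← hv]
    congr 1
    ext ω
    simp only [Function.comp]
    conv_lhs => rw [← Finset.univ_sum_single (fun i => X i ω), map_sum]
    refine Finset.sum_congr rfl fun i _ => ?_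
    have : (Pi.single i (X i ω) : ι → ℝ) = X i ω • Pi.single i 1 := by
      rw [← Pi.single_smul]; simp
    rw [this, map_smul, smul_eq_mul, mul_comm]
  refine ⟨⟨isGaussian_of_map_eq_gaussianReal fun L => ?_⟩, fun i => ?_⟩
  · obtain ⟨v, hv⟩ := key L
    exact ⟨0, v, hv⟩
  · obtain ⟨v, hv⟩ := hg (Pi.single i 1)
    have e : (fun ω => ∑ x, (Pi.single i 1 : ι → ℝ) x * X x ω) = X i := by
      ext ω; simp [Pi.single_apply]
    rw [e] at hv
    have : ∫ ω, X i ω = ∫ x, x ∂(Measure.map (X i) ℙ) :=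
      (integral_map (hm i).aemeasurable aestronglyMeasurable_id).symm
    rw [this, hv]
    simp

lemma mm_data {Ω : Type u} {ι : Type v} [MeasureSpace Ω] [Fintype ι]
    (X : ι → Ω → ℝ) (hX : HasGaussianLaw (fun ω i => X i ω) (ℙ : Measure Ω))
    (hX0 : ∀ i, ∫ ω, X i ω = 0) : MMData (natDist X) (mmG ℙ X) (mmk / 4) := by
  have hXg : ∀ i, HasGaussianLaw (X i) (ℙ : Measure Ω) := fun i => hX.eval i
  have hXi : ∀ i, Integrable (X i) (ℙ : Measure Ω) := fun i => (hXg i).integrable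
  have hX2 : ∀ i, MemLp (X i) 2 (ℙ : Measure Ω) := fun i => (hXg i).memLp_two
  have hP := hX.isProbabilityMeasure
  refine ⟨by have := mmk_pos; positivity, fun x => by simp [natDist], fun x y => mmn_sub_comm _ _,
    fun x y z => mmn_tri (hX2 x) (hX2 y) (hX2 z), fun x y => mmn_nonneg _ _,
    fun A B hA hAB => mmG_mono hXi hA hAB, fun A hA => mmG_nonneg hXi hX0 hA, ?_⟩
  intro n x A σ G' B hA hσ hsep hball hG hB
  have := mm_growth X hX hX0 (2 ^ n) (by positivity) x A hA σ hσ hsep hball G' hG B hB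
  have e : Real.sqrt ((2 ^ n : ℕ) : ℝ) = Real.sqrt 2 ^ n := by
    push_cast
    rw [Real.sqrt_eq_iff_mul_self_eq (by positivity) (by positivity), ← mul_pow,
      Real.mul_self_sqrt (by norm_num)]
  rw [e] at this
  refine le_trans (le_of_eq ?_) this
  ring

/-- **Lower bound in the majorizing measure theorem** (Theorem 6.7):
`γ₂(T,d) ≤ C·E[sup_{x∈T} X_x]` for a universal constant `C`. -/
theorem majorizing_measure_lower_bound :
    ∃ C : ℝ, 0 < C ∧
      ∀ (Ω : Type u) (ι : Type v) [MeasureSpace Ω] [Fintype ι] [Nonempty ι],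
        ∀ _ : IsProbabilityMeasure (ℙ : Measure Ω),
        ∀ X : ι → Ω → ℝ, IsCenteredGaussianProcess X →
          gammaTwo (fun x y => ENNReal.ofReal (natDist X x y)) (univ : Set ι) ≤
            ENNReal.ofReal (C * ∫ ω, ⨆ x : ι, X x ω) := by
  have hk := mmk_pos
  refine ⟨2 * 16783 / (mmk / 4), by positivity, ?_⟩
  intro Ω ι _ _ _ hP X hX
  obtain ⟨hg, h0⟩ := mm_bridge hP X hX
  refine (mm_abstract (mm_data X hg h0)).trans (ENNReal.ofReal_le_ofReal (le_of_eq ?_))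
  have e : mmG ℙ X univ = ∫ ω, ⨆ x : ι, X x ω := by
    unfold mmG
    congr 1
    ext ω
    exact (Equiv.Set.univ ι).iSup_congr fun x => rfl
  rw [e]
  ring
end
end
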